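/- arXiv:2510.07512 — 4 statements merged into one kernel-verified Lean document; each statement's English description precedes it below -/
import Mathlib

section
/- Let n ≥ k ≥ 1, p ∈ (0,1), d ≥ 1, r = k/n, and let C̃ be any depth-d noisy circuit on n qubits with depolarizing noise of strength p, with encoding channel ℰ(ζ) = C̃(ζ ⊗ (|0⟩⟨0|)^{⊗(n−k)}). If d > p^{−1} ln(1 + 1/r), then the coherent information satisfies I_c < 0. -/
open Matrix

noncomputable section

/-- Partial trace over the first (reference) tensor factor. -/
def ptraceFirst {R B : Type*} [Fintype R] (M : Matrix (R × B) (R × B) ℂ) : Matrix B B ℂ :=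
  Matrix.of fun b b' => ∑ r, M (r, b) (r, b')

/-- Density matrix of the maximally entangled state `|Φ⟩ = (card A)^{-1/2} ∑ᵢ |i⟩⊗|i⟩`. -/
def maxEnt (A : Type*) [Fintype A] [DecidableEq A] : Matrix (A × A) (A × A) ℂ :=
  Matrix.of fun x y => if x.1 = x.2 ∧ y.1 = y.2 then ((Fintype.card A : ℂ))⁻¹ else 0

/-- The map `Id ⊗ ℰ` acting on operators on `R ⊗ A`, defined entrywise. -/
def idTensor {R A B : Type*} (E : Matrix A A ℂ → Matrix B B ℂ)
    (M : Matrix (R × A) (R × A) ℂ) : Matrix (R × B) (R × B) ℂ :=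
  Matrix.of fun x y => E (Matrix.of fun a a' => M (x.1, a) (y.1, a')) x.2 y.2

/-- Von Neumann entropy in bits, `S(ρ) = -Tr[ρ log₂ ρ]`, via the eigenvalues of `ρ`
(with the convention `0 log 0 = 0`). -/
def vN {ι : Type*} [Fintype ι] [DecidableEq ι] (ρ : Matrix ι ι ℂ) : ℝ :=
  if h : ρ.IsHermitian then -∑ i, (h.eigenvalues i) * Real.logb 2 (h.eigenvalues i) else 0

/-- Coherent information of a channel on the maximally mixed input:
`I_c = S(ρ_B) − S(ρ_RB)` where `ρ_RB = (Id ⊗ ℰ)(|Φ⟩⟨Φ|)`. -/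
def cohInfo {A B : Type*} [Fintype A] [DecidableEq A] [Fintype B] [DecidableEq B]
    (E : Matrix A A ℂ → Matrix B B ℂ) : ℝ :=
  vN (ptraceFirst (idTensor (R := A) E (maxEnt A))) - vN (idTensor (R := A) E (maxEnt A))

/-- Hilbert-space index for `n` qubits. -/
abbrev QSpace (n : ℕ) := Fin n → Fin 2

/-- The Pauli matrices `I, X, Y, Z` indexed by `Fin 4`. -/
def pauli (s : Fin 4) : Matrix (Fin 2) (Fin 2) ℂ :=
  if s = 0 then 1
  else if s = 1 then !![0, 1; 1, 0]
  else if s = 2 then !![0, -Complex.I; Complex.I, 0]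
  else !![1, 0; 0, -1]

/-- Probability weights of the depolarizing channel of strength `p`:
`1 − p` for `I` and `p/3` for each of `X, Y, Z`. -/
def pauliWeight (p : ℝ) (s : Fin 4) : ℝ := if s = 0 then 1 - p else p / 3

/-- A tensor product of Pauli matrices over the `n` qubits. -/
def pauliString {n : ℕ} (s : Fin n → Fin 4) : Matrix (QSpace n) (QSpace n) ℂ :=
  Matrix.of fun x y => ∏ i, pauli (s i) (x i) (y i)

/-- `D_p^{⊗n}`: one layer of single-qubit depolarizing noise of strength `p`
acting independently on each of the `n` qubits. -/
def depolLayer {n : ℕ} (p : ℝ) (ρ : Matrix (QSpace n) (QSpace n) ℂ) :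
    Matrix (QSpace n) (QSpace n) ℂ :=
  ∑ s : Fin n → Fin 4, ((∏ i, pauliWeight p (s i) : ℝ) : ℂ) • (pauliString s * ρ * (pauliString s)ᴴ)

/-- The depth-`d` noisy circuit `C̃ = D_p^{⊗n} ∘ 𝒰_d ∘ ⋯ ∘ D_p^{⊗n} ∘ 𝒰_1`,
where `𝒰_i(ρ) = U_i ρ U_i†`. -/
def noisyCircuit {n : ℕ} (p : ℝ) {d : ℕ} (U : Fin d → Matrix (QSpace n) (QSpace n) ℂ)
    (ρ : Matrix (QSpace n) (QSpace n) ℂ) : Matrix (QSpace n) (QSpace n) ℂ :=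
  (List.ofFn U).foldl (fun σ V => depolLayer p (V * σ * Vᴴ)) ρ

/-- The encoding channel `ℰ(ζ) = C(ζ ⊗ (|0⟩⟨0|)^{⊗(n−k)})`, where the first `k` qubits
carry the logical state `ζ` and the remaining `n − k` qubits are ancillas in `|0⟩`. -/
def encode {n k : ℕ} (hk : k ≤ n)
    (C : Matrix (QSpace n) (QSpace n) ℂ → Matrix (QSpace n) (QSpace n) ℂ)
    (ζ : Matrix (QSpace k) (QSpace k) ℂ) : Matrix (QSpace n) (QSpace n) ℂ :=
  C (Matrix.of fun x y =>
    (∏ i : Fin n, if (i : ℕ) < k then (1 : ℂ) else (if x i = 0 ∧ y i = 0 then 1 else 0)) *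
      ζ (fun j => x (Fin.castLE hk j)) (fun j => y (Fin.castLE hk j)))

namespace NoisyCoherent

open scoped ComplexOrder Kronecker

/-- `U` and `p` diagonalize `M`. -/
def IsSpec {ι : Type*} [Fintype ι] [DecidableEq ι] (M U : Matrix ι ι ℂ) (p : ι → ℝ) : Prop :=
  U * Uᴴ = 1 ∧ Uᴴ * U = 1 ∧ M = U * diagonal (fun i => (p i : ℂ)) * Uᴴ

/-- Von Neumann entropy in nats. -/
def ent {ι : Type*} [Fintype ι] [DecidableEq ι] (M : Matrix ι ι ℂ) : ℝ :=
  if h : M.IsHermitian then ∑ i, Real.negMulLog (h.eigenvalues i) else 0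

section Spectral

variable {ι : Type*} [Fintype ι] [DecidableEq ι]

lemma vN_eq_ent (M : Matrix ι ι ℂ) : vN M = ent M / Real.log 2 := by
  unfold vN ent
  split_ifs with h
  · rw [Finset.sum_div, ← Finset.sum_neg_distrib]
    refine Finset.sum_congr rfl fun i _ => ?_
    simp only [Real.negMulLog, Real.logb]
    ring
  · simp

lemma isSpec_eigenvalues {M : Matrix ι ι ℂ} (h : M.IsHermitian) :
    IsSpec M (h.eigenvectorUnitary : Matrix ι ι ℂ) h.eigenvalues := by
  refine ⟨?_, ?_, ?_⟩
  · exact Matrix.mem_unitaryGroup_iff.1 h.eigenvectorUnitary.2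
  · exact Matrix.mem_unitaryGroup_iff'.1 h.eigenvectorUnitary.2
  · have := h.spectral_theorem
    rw [Unitary.conjStarAlgAut_apply] at this
    exact this

lemma IsSpec.isHermitian {M U : Matrix ι ι ℂ} {p : ι → ℝ} (h : IsSpec M U p) :
    M.IsHermitian := by
  rw [h.2.2]
  refine Matrix.isHermitian_mul_mul_conjTranspose _ ?_
  rw [Matrix.isHermitian_diagonal_iff]
  intro i
  simp [IsSelfAdjoint]

lemma IsSpec.ent_eq {M U : Matrix ι ι ℂ} {p : ι → ℝ} (h : IsSpec M U p) :
    ent M = ∑ i, Real.negMulLog (p i) := by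
  have hM := h.isHermitian
  have h1 : M.charpoly.roots = Multiset.map (fun i => (p i : ℂ)) Finset.univ.val := by
    rw [h.2.2, charpoly_mul_comm, ← mul_assoc, h.2.1, one_mul, charpoly_diagonal,
      Polynomial.roots_prod]
    · simp
    · simp [Finset.prod_ne_zero_iff, Polynomial.X_sub_C_ne_zero]
  have h2 := hM.roots_charpoly_eq_eigenvalues
  rw [h1] at h2
  have h3 := congrArg (fun s => (Multiset.map (fun z : ℂ => Real.negMulLog z.re) s).sum) h2
  simp only [Multiset.map_map] at h3
  rw [ent, dif_pos hM]
  exact h3.symm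

lemma IsSpec.conj {M U : Matrix ι ι ℂ} {p : ι → ℝ} (h : IsSpec M U p) {V : Matrix ι ι ℂ}
    (h1 : V * Vᴴ = 1) (h2 : Vᴴ * V = 1) : IsSpec (V * M * Vᴴ) (V * U) p := by
  refine ⟨?_, ?_, ?_⟩
  · rw [conjTranspose_mul, mul_assoc, ← mul_assoc U, h.1, one_mul, h1]
  · rw [conjTranspose_mul, mul_assoc, ← mul_assoc Vᴴ, h2, one_mul, h.2.1]
  · rw [h.2.2, conjTranspose_mul]
    simp only [mul_assoc]

lemma ent_conj {M : Matrix ι ι ℂ} (hM : M.IsHermitian) {V : Matrix ι ι ℂ}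
    (h1 : V * Vᴴ = 1) (h2 : Vᴴ * V = 1) : ent (V * M * Vᴴ) = ent M := by
  rw [((isSpec_eigenvalues hM).conj h1 h2).ent_eq, (isSpec_eigenvalues hM).ent_eq]

lemma IsSpec.affine {M U : Matrix ι ι ℂ} {p : ι → ℝ} (h : IsSpec M U p) (a b : ℝ) :
    IsSpec ((a : ℂ) • M + (b : ℂ) • (1 : Matrix ι ι ℂ)) U (fun i => a * p i + b) := by
  refine ⟨h.1, h.2.1, ?_⟩
  have : diagonal (fun i => ((a * p i + b : ℝ) : ℂ))
      = (a : ℂ) • diagonal (fun i => (p i : ℂ)) + (b : ℂ) • (1 : Matrix ι ι ℂ) := by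
    ext i j
    by_cases hij : i = j
    · subst hij; simp
    · simp [hij]
  rw [this, mul_add, add_mul, h.2.2]
  simp [h.1]

lemma IsSpec.trace_eq {M U : Matrix ι ι ℂ} {p : ι → ℝ} (h : IsSpec M U p) :
    M.trace = ((∑ i, p i : ℝ) : ℂ) := by
  rw [h.2.2, Matrix.trace_mul_comm, ← mul_assoc, h.2.1, one_mul, trace_diagonal]
  simp

lemma IsSpec.sq {M U : Matrix ι ι ℂ} {p : ι → ℝ} (h : IsSpec M U p) :
    IsSpec (M * M) U (fun i => p i ^ 2) := by
  refine ⟨h.1, h.2.1, ?_⟩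
  have : diagonal (fun i => ((p i ^ 2 : ℝ) : ℂ))
      = diagonal (fun i => (p i : ℂ)) * diagonal (fun i => (p i : ℂ)) := by
    rw [diagonal_mul_diagonal]; congr 1; ext i; push_cast; ring
  rw [this, h.2.2]
  simp only [mul_assoc]
  rw [← mul_assoc Uᴴ U, h.2.1, one_mul]

/-- The squared overlaps of two orthonormal bases. -/
def overlap (U V : Matrix ι ι ℂ) (i j : ι) : ℝ := Complex.normSq ((Uᴴ * V) i j)

omit [DecidableEq ι] in
lemma overlap_nonneg (U V : Matrix ι ι ℂ) (i j : ι) : 0 ≤ overlap U V i j :=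
  Complex.normSq_nonneg _

lemma sum_normSq_row {W : Matrix ι ι ℂ} (h : W * Wᴴ = 1) (i : ι) :
    ∑ j, Complex.normSq (W i j) = 1 := by
  have := congrFun (congrFun h i) i
  simp only [mul_apply, conjTranspose_apply, one_apply_eq] at this
  have h2 := congrArg Complex.re this
  simp only [Complex.re_sum, Complex.one_re] at h2
  rw [← h2]
  refine Finset.sum_congr rfl fun j _ => ?_
  rw [Complex.star_def, Complex.mul_conj, Complex.ofReal_re]

lemma overlap_sum_right {U V : Matrix ι ι ℂ} (hU : Uᴴ * U = 1) (hV : V * Vᴴ = 1) (i : ι) :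
    ∑ j, overlap U V i j = 1 := by
  refine sum_normSq_row ?_ i
  rw [conjTranspose_mul, conjTranspose_conjTranspose, mul_assoc, ← mul_assoc V, hV, one_mul, hU]

lemma overlap_sum_left {U V : Matrix ι ι ℂ} (hU : U * Uᴴ = 1) (hV : Vᴴ * V = 1) (j : ι) :
    ∑ i, overlap U V i j = 1 := by
  have := sum_normSq_row (W := Vᴴ * U) (by
    rw [conjTranspose_mul, conjTranspose_conjTranspose, mul_assoc, ← mul_assoc U, hU, one_mul, hV]) j
  rw [← this]
  refine Finset.sum_congr rfl fun i _ => ?_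
  have : (Vᴴ * U) j i = star ((Uᴴ * V) i j) := by
    rw [← conjTranspose_apply, conjTranspose_mul, conjTranspose_conjTranspose]
  rw [this, Complex.star_def, Complex.normSq_conj, overlap]

lemma trace_mul_spec {M U V : Matrix ι ι ℂ} {p : ι → ℝ} (h : IsSpec M U p) (g : ι → ℝ) :
    (M * (V * diagonal (fun j => (g j : ℂ)) * Vᴴ)).trace
      = ((∑ i, ∑ j, overlap U V i j * (p i * g j) : ℝ) : ℂ) := by
  have e : (M * (V * diagonal (fun j => (g j : ℂ)) * Vᴴ)).trace
      = (diagonal (fun i => (p i : ℂ)) * ((Uᴴ * V) * diagonal (fun j => (g j : ℂ)) * (Uᴴ * V)ᴴ)).trace := by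
    rw [h.2.2, conjTranspose_mul, conjTranspose_conjTranspose, mul_assoc, mul_assoc,
      Matrix.trace_mul_comm]
    simp only [mul_assoc]
  have h3 : ∀ i j, ((overlap U V i j : ℝ) : ℂ) = (Uᴴ * V) i j * star ((Uᴴ * V) i j) := by
    intro i j
    rw [Complex.star_def, Complex.mul_conj, overlap]
  rw [e]
  push_cast
  simp only [h3]
  generalize Uᴴ * V = W
  simp only [Matrix.trace, diag_apply, diagonal_mul]
  refine Finset.sum_congr rfl fun i _ => ?_
  rw [mul_apply, Finset.mul_sum]
  refine Finset.sum_congr rfl fun j _ => ?_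
  rw [mul_diagonal, conjTranspose_apply]
  ring

lemma IsSpec.posDef_pos {M U : Matrix ι ι ℂ} {p : ι → ℝ} (h : IsSpec M U p) (hM : M.PosDef)
    (i : ι) : 0 < p i := by
  have h1 : (Uᴴ * M * U).PosDef := by
    refine hM.conjTranspose_mul_mul_same ?_
    intro x y hxy
    have := congrArg (fun z => Uᴴ *ᵥ z) hxy
    simpa [h.2.1] using this
  have h2 : Uᴴ * M * U = diagonal (fun i => (p i : ℂ)) := by
    rw [h.2.2]
    simp only [mul_assoc]
    rw [h.2.1, mul_one, ← mul_assoc, h.2.1, one_mul]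
  rw [h2, posDef_diagonal_iff] at h1
  exact_mod_cast h1 i

lemma IsSpec.posSemidef_nonneg {M U : Matrix ι ι ℂ} {p : ι → ℝ} (h : IsSpec M U p)
    (hM : M.PosSemidef) (i : ι) : 0 ≤ p i := by
  have h1 := hM.conjTranspose_mul_mul_same U
  have h2 : Uᴴ * M * U = diagonal (fun i => (p i : ℂ)) := by
    rw [h.2.2]
    simp only [mul_assoc]
    rw [h.2.1, mul_one, ← mul_assoc, h.2.1, one_mul]
  rw [h2, posSemidef_diagonal_iff] at h1
  exact_mod_cast h1 i

end Spectral

section RelativeEntropy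

variable {ι : Type*} [Fintype ι] [DecidableEq ι]

/-- The mixed unitary channel with weights `w` and unitaries `V`. -/
def mix {κ : Type*} [Fintype κ] (w : κ → ℝ) (V : κ → Matrix ι ι ℂ) (M : Matrix ι ι ℂ) :
    Matrix ι ι ℂ :=
  ∑ k, (w k : ℂ) • (V k * M * (V k)ᴴ)

/-- A concave functional whose maximum over `Z` is a quasi-entropy of `ρ` and `σ`. -/
def bracket (s : ℝ) (Z ρ σ : Matrix ι ι ℂ) : ℝ :=
  2 * (Zᴴ * (ρ - σ)).trace.re - (Zᴴ * ρ * Z).trace.re - s * (Z * σ * Zᴴ).trace.re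

lemma bracket_spec {ρ σ U V : Matrix ι ι ℂ} {p q : ι → ℝ} (hρ : IsSpec ρ U p)
    (hσ : IsSpec σ V q) (s : ℝ) (z : Matrix ι ι ℂ) :
    bracket s (U * z * Vᴴ) ρ σ = ∑ i, ∑ j, (2 * (p i - q j) * (star (z i j) * (Uᴴ * V) i j).re
      - (p i + s * q j) * Complex.normSq (z i j)) := by
  have e1 : ((U * z * Vᴴ)ᴴ * ρ).trace = (zᴴ * (diagonal (fun i => (p i : ℂ)) * (Uᴴ * V))).trace := by
    rw [hρ.2.2]
    simp only [conjTranspose_mul, conjTranspose_conjTranspose, mul_assoc]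
    rw [← mul_assoc Uᴴ U, hρ.2.1, one_mul, Matrix.trace_mul_comm]
    simp only [mul_assoc]
  have e2 : ((U * z * Vᴴ)ᴴ * σ).trace = (zᴴ * ((Uᴴ * V) * diagonal (fun i => (q i : ℂ)))).trace := by
    rw [hσ.2.2]
    simp only [conjTranspose_mul, conjTranspose_conjTranspose, mul_assoc]
    rw [Matrix.trace_mul_comm]
    simp only [mul_assoc]
    rw [hσ.2.1, mul_one]
  have e3 : ((U * z * Vᴴ)ᴴ * ρ * (U * z * Vᴴ)).trace
      = (zᴴ * (diagonal (fun i => (p i : ℂ)) * z)).trace := by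
    rw [hρ.2.2]
    simp only [conjTranspose_mul, conjTranspose_conjTranspose, mul_assoc]
    rw [← mul_assoc Uᴴ U, hρ.2.1, one_mul, ← mul_assoc Uᴴ U, hρ.2.1, one_mul,
      Matrix.trace_mul_comm]
    simp only [mul_assoc]
    rw [hσ.2.1, mul_one]
  have e4 : ((U * z * Vᴴ) * σ * (U * z * Vᴴ)ᴴ).trace
      = (zᴴ * (z * diagonal (fun i => (q i : ℂ)))).trace := by
    rw [hσ.2.2]
    simp only [conjTranspose_mul, conjTranspose_conjTranspose, mul_assoc]
    rw [← mul_assoc Vᴴ V, hσ.2.1, one_mul, ← mul_assoc Vᴴ V, hσ.2.1, one_mul,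
      Matrix.trace_mul_comm]
    simp only [mul_assoc]
    rw [hρ.2.1, mul_one, ← mul_assoc, Matrix.trace_mul_comm]
  have tr : ∀ A B : Matrix ι ι ℂ, (Aᴴ * B).trace = ∑ i, ∑ j, star (A i j) * B i j := by
    intro A B
    simp only [Matrix.trace, diag_apply, mul_apply, conjTranspose_apply]
    rw [Finset.sum_comm]
  rw [bracket, mul_sub, trace_sub, e1, e2, e3, e4, tr, tr, tr, tr]
  simp only [Complex.sub_re, Complex.re_sum, Finset.mul_sum, ← Finset.sum_sub_distrib,
    diagonal_mul, mul_diagonal]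
  refine Finset.sum_congr rfl fun i _ => Finset.sum_congr rfl fun j _ => ?_
  generalize (Uᴴ * V) i j = m
  generalize z i j = x
  simp only [Complex.star_def, Complex.mul_re, Complex.mul_im, Complex.conj_re, Complex.conj_im,
    Complex.ofReal_re, Complex.ofReal_im, Complex.normSq_apply]
  ring

lemma bracket_mix {κ : Type*} [Fintype κ] {w : κ → ℝ} {V : κ → Matrix ι ι ℂ}
    (hV : ∀ k, V k * (V k)ᴴ = 1) (s : ℝ) (Z ρ σ : Matrix ι ι ℂ) :
    bracket s Z (mix w V ρ) (mix w V σ)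
      = ∑ k, w k * bracket s ((V k)ᴴ * Z * V k) ρ σ := by
  have re_smul : ∀ (a : ℝ) (z : ℂ), ((a : ℂ) * z).re = a * z.re := by
    intro a z; simp
  have e1 : ∀ k (M : Matrix ι ι ℂ), (Zᴴ * (V k * M * (V k)ᴴ)).trace
      = (((V k)ᴴ * Z * V k)ᴴ * M).trace := by
    intro k M
    simp only [conjTranspose_mul, conjTranspose_conjTranspose, mul_assoc]
    rw [Matrix.trace_mul_comm ((V k)ᴴ)]
    simp only [mul_assoc]
  have e2 : ∀ k (M : Matrix ι ι ℂ), (Zᴴ * (V k * M * (V k)ᴴ) * Z).trace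
      = (((V k)ᴴ * Z * V k)ᴴ * M * ((V k)ᴴ * Z * V k)).trace := by
    intro k M
    simp only [conjTranspose_mul, conjTranspose_conjTranspose, mul_assoc]
    rw [Matrix.trace_mul_comm ((V k)ᴴ)]
    simp only [mul_assoc]
    rw [hV, mul_one]
  have e3 : ∀ k (M : Matrix ι ι ℂ), (Z * (V k * M * (V k)ᴴ) * Zᴴ).trace
      = (((V k)ᴴ * Z * V k) * M * ((V k)ᴴ * Z * V k)ᴴ).trace := by
    intro k M
    simp only [conjTranspose_mul, conjTranspose_conjTranspose, mul_assoc]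
    rw [Matrix.trace_mul_comm ((V k)ᴴ)]
    simp only [mul_assoc]
    rw [hV, mul_one]
  simp only [bracket, mix, mul_sub, trace_sub, Finset.mul_sum, Finset.sum_mul, trace_sum,
    Matrix.mul_smul, Matrix.smul_mul, trace_smul, e1, e2, e3, smul_eq_mul, Complex.re_sum, Complex.sub_re,
    re_smul, ← Finset.sum_sub_distrib]
  refine Finset.sum_congr rfl fun k _ => ?_
  ring

/-- A quasi-entropy of two spectral decompositions. -/
def quasi (s : ℝ) (U V : Matrix ι ι ℂ) (p q : ι → ℝ) : ℝ :=
  ∑ i, ∑ j, overlap U V i j * ((p i - q j) ^ 2 / (p i + s * q j))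

lemma bracket_le_quasi {ρ σ U V : Matrix ι ι ℂ} {p q : ι → ℝ} (hρ : IsSpec ρ U p)
    (hσ : IsSpec σ V q) (hp : ∀ i, 0 < p i) (hq : ∀ i, 0 < q i) {s : ℝ} (hs : 0 ≤ s)
    (Z : Matrix ι ι ℂ) : bracket s Z ρ σ ≤ quasi s U V p q := by
  have hZ : Z = U * (Uᴴ * Z * V) * Vᴴ := by
    simp only [mul_assoc]
    rw [hσ.1, mul_one, ← mul_assoc, hρ.1, one_mul]
  rw [hZ, bracket_spec hρ hσ, quasi]
  refine Finset.sum_le_sum fun i _ => Finset.sum_le_sum fun j _ => ?_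
  rw [overlap]
  generalize (Uᴴ * V) i j = m
  generalize (Uᴴ * Z * V) i j = x
  have hpos : 0 < p i + s * q j := by have := hp i; have := hq j; positivity
  rw [mul_div_assoc', le_div_iff₀ hpos]
  simp only [Complex.star_def, Complex.mul_re, Complex.conj_re, Complex.conj_im,
    Complex.normSq_apply]
  nlinarith [sq_nonneg ((p i - q j) * m.re - (p i + s * q j) * x.re),
    sq_nonneg ((p i - q j) * m.im - (p i + s * q j) * x.im)]

lemma exists_bracket_eq_quasi {ρ σ U V : Matrix ι ι ℂ} {p q : ι → ℝ} (hρ : IsSpec ρ U p)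
    (hσ : IsSpec σ V q) (hp : ∀ i, 0 < p i) (hq : ∀ i, 0 < q i) {s : ℝ} (hs : 0 ≤ s) :
    ∃ Z, bracket s Z ρ σ = quasi s U V p q := by
  refine ⟨U * (Matrix.of fun i j => (((p i - q j) / (p i + s * q j) : ℝ) : ℂ) * (Uᴴ * V) i j) * Vᴴ,
    ?_⟩
  rw [bracket_spec hρ hσ, quasi]
  refine Finset.sum_congr rfl fun i _ => Finset.sum_congr rfl fun j _ => ?_
  rw [overlap, of_apply]
  generalize (Uᴴ * V) i j = m
  have hpos : p i + s * q j ≠ 0 := by have := hp i; have := hq j; positivity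
  generalize p i + s * q j = c at *
  simp only [Complex.star_def, Complex.mul_re, Complex.mul_im, Complex.conj_re, Complex.conj_im,
    Complex.ofReal_re, Complex.ofReal_im, Complex.normSq_apply]
  field_simp
  ring

lemma quasi_mix_le {κ : Type*} [Fintype κ] {w : κ → ℝ} {W : κ → Matrix ι ι ℂ}
    (hw : ∀ k, 0 ≤ w k) (hw1 : ∑ k, w k = 1) (hW : ∀ k, W k * (W k)ᴴ = 1)
    {ρ σ U V U' V' : Matrix ι ι ℂ} {p q p' q' : ι → ℝ} (hρ : IsSpec ρ U p)
    (hσ : IsSpec σ V q) (hρ' : IsSpec (mix w W ρ) U' p') (hσ' : IsSpec (mix w W σ) V' q')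
    (hp : ∀ i, 0 < p i) (hq : ∀ i, 0 < q i) (hp' : ∀ i, 0 < p' i) (hq' : ∀ i, 0 < q' i)
    {s : ℝ} (hs : 0 ≤ s) : quasi s U' V' p' q' ≤ quasi s U V p q := by
  obtain ⟨Z, hZ⟩ := exists_bracket_eq_quasi hρ' hσ' hp' hq' hs
  rw [← hZ, bracket_mix hW]
  calc _ ≤ ∑ k, w k * quasi s U V p q := Finset.sum_le_sum fun k _ =>
        mul_le_mul_of_nonneg_left (bracket_le_quasi hρ hσ hp hq hs _) (hw k)
    _ = _ := by rw [← Finset.sum_mul, hw1, one_mul]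

/-- The relative entropy of two spectral decompositions. -/
def relEnt (U V : Matrix ι ι ℂ) (p q : ι → ℝ) : ℝ :=
  ∑ i, ∑ j, overlap U V i j * (p i * Real.log (p i) - p i * Real.log (q j) - p i + q j)

/-- An interpolation between minus the relative entropy (at `0`) and zero (at infinity). -/
def interp (U V : Matrix ι ι ℂ) (p q : ι → ℝ) (s : ℝ) : ℝ :=
  ∑ i, ∑ j, overlap U V i j * (p i * (Real.log (1 + s) - Real.log (p i + s * q j) + Real.log (q j))
    + (p i - q j) / (1 + s))

omit [DecidableEq ι] in
lemma interp_zero (U V : Matrix ι ι ℂ) (p q : ι → ℝ) : interp U V p q 0 = -relEnt U V p q := by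
  simp only [interp, relEnt, ← Finset.sum_neg_distrib]
  refine Finset.sum_congr rfl fun i _ => Finset.sum_congr rfl fun j _ => ?_
  simp only [add_zero, Real.log_one, zero_mul, div_one]
  ring

omit [DecidableEq ι] in
lemma hasDerivAt_interp (U V : Matrix ι ι ℂ) {p q : ι → ℝ} (hp : ∀ i, 0 < p i)
    (hq : ∀ i, 0 < q i) {s : ℝ} (hs : 0 ≤ s) :
    HasDerivAt (interp U V p q) (s / (1 + s) ^ 2 * quasi s U V p q) s := by
  have : s / (1 + s) ^ 2 * quasi s U V p q = ∑ i, ∑ j, overlap U V i j *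
      (p i * (1 / (1 + s) - q j / (p i + s * q j)) + -((p i - q j) * 1) / (1 + s) ^ 2) := by
    simp only [quasi, Finset.mul_sum]
    refine Finset.sum_congr rfl fun i _ => Finset.sum_congr rfl fun j _ => ?_
    have hpos : 0 < p i + s * q j := by have := hp i; have := hq j; positivity
    have : 0 < 1 + s := by positivity
    field_simp
    ring
  rw [this]
  unfold interp
  refine HasDerivAt.fun_sum fun i _ => HasDerivAt.fun_sum fun j _ => ?_
  have hpos : 0 < p i + s * q j := by have := hp i; have := hq j; positivity
  have h1s : 0 < 1 + s := by positivity
  have h1 : HasDerivAt (fun s : ℝ => 1 + s) 1 s := (hasDerivAt_id s).const_add 1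
  have h2 : HasDerivAt (fun s : ℝ => p i + s * q j) (q j) s := by
    simpa using ((hasDerivAt_id s).mul_const (q j)).const_add (p i)
  refine HasDerivAt.const_mul _ (HasDerivAt.add (HasDerivAt.const_mul _ ?_) ?_)
  · exact ((h1.log h1s.ne').sub (h2.log hpos.ne')).add_const _
  · have := (hasDerivAt_const s (p i - q j)).div h1 h1s.ne'
    rwa [zero_mul, zero_sub] at this

omit [DecidableEq ι] in
lemma tendsto_interp (U V : Matrix ι ι ℂ) {p q : ι → ℝ} (hp : ∀ i, 0 < p i)
    (hq : ∀ i, 0 < q i) :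
    Filter.Tendsto (interp U V p q) Filter.atTop (nhds 0) := by
  unfold interp
  have : (0 : ℝ) = ∑ i : ι, ∑ j : ι, overlap U V i j *
      (p i * (Real.log 1) + 0) := by simp
  rw [this]
  refine tendsto_finsetSum _ fun i _ => tendsto_finsetSum _ fun j _ => ?_
  refine Filter.Tendsto.const_mul _ (Filter.Tendsto.add (Filter.Tendsto.const_mul _ ?_) ?_)
  · have h0 : Filter.Tendsto (fun s : ℝ => s⁻¹) Filter.atTop (nhds 0) := tendsto_inv_atTop_zero
    have h : Filter.Tendsto (fun s : ℝ => (s⁻¹ + 1) * q j / (p i * s⁻¹ + q j)) Filter.atTop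
        (nhds ((0 + 1) * q j / (p i * 0 + q j))) := by
      refine Filter.Tendsto.div ((h0.add_const 1).mul_const _) ((h0.const_mul _).add_const _) ?_
      simpa using (hq j).ne'
    have h' : (0 + 1) * q j / (p i * 0 + q j) = 1 := by
      rw [mul_zero, zero_add, zero_add, one_mul, div_self (hq j).ne']
    rw [h'] at h
    refine ((Real.continuousAt_log one_ne_zero).tendsto.comp h).congr' ?_
    filter_upwards [Filter.eventually_gt_atTop 0] with s hs
    have h3 := hp i
    have h4 := hq j
    rw [Function.comp, ← Real.log_div (by positivity) (by positivity),
      ← Real.log_mul (by positivity) (by positivity)]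
    congr 1
    field_simp
  · exact Filter.Tendsto.div_atTop tendsto_const_nhds
      (Filter.tendsto_atTop_add_const_left _ _ Filter.tendsto_id)

/-- Monotonicity of the relative entropy under mixed unitary channels. -/
theorem relEnt_mix_le {κ : Type*} [Fintype κ] {w : κ → ℝ} {W : κ → Matrix ι ι ℂ}
    (hw : ∀ k, 0 ≤ w k) (hw1 : ∑ k, w k = 1) (hW : ∀ k, W k * (W k)ᴴ = 1)
    {ρ σ U V U' V' : Matrix ι ι ℂ} {p q p' q' : ι → ℝ} (hρ : IsSpec ρ U p)
    (hσ : IsSpec σ V q) (hρ' : IsSpec (mix w W ρ) U' p') (hσ' : IsSpec (mix w W σ) V' q')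
    (hp : ∀ i, 0 < p i) (hq : ∀ i, 0 < q i) (hp' : ∀ i, 0 < p' i) (hq' : ∀ i, 0 < q' i) :
    relEnt U' V' p' q' ≤ relEnt U V p q := by
  set f : ℝ → ℝ := fun s => interp U V p q s - interp U' V' p' q' s with hf
  have hder : ∀ s, 0 ≤ s → HasDerivAt f (s / (1 + s) ^ 2 * quasi s U V p q
      - s / (1 + s) ^ 2 * quasi s U' V' p' q') s := fun s hs =>
    (hasDerivAt_interp U V hp hq hs).sub (hasDerivAt_interp U' V' hp' hq' hs)
  have hmono : MonotoneOn f (Set.Ici 0) := by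
    refine monotoneOn_of_hasDerivWithinAt_nonneg (convex_Ici 0)
      (fun s hs => (hder s hs).continuousAt.continuousWithinAt)
      (fun s hs => (hder s (interior_subset hs)).hasDerivWithinAt) ?_
    intro s hs
    have hs : 0 ≤ s := interior_subset (s := Set.Ici (0 : ℝ)) hs
    rw [← mul_sub]
    exact mul_nonneg (by positivity)
      (sub_nonneg.2 (quasi_mix_le hw hw1 hW hρ hσ hρ' hσ' hp hq hp' hq' hs))
  have hlim : Filter.Tendsto f Filter.atTop (nhds 0) := by
    simpa using (tendsto_interp U V hp hq).sub (tendsto_interp U' V' hp' hq')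
  have h0 : f 0 ≤ 0 := by
    refine ge_of_tendsto hlim ?_
    filter_upwards [Filter.eventually_ge_atTop 0] with s hs
    exact hmono Set.self_mem_Ici hs hs
  simp only [hf, interp_zero] at h0
  linarith

omit [DecidableEq ι] in
lemma relEnt_nonneg (U V : Matrix ι ι ℂ) {p q : ι → ℝ} (hp : ∀ i, 0 ≤ p i)
    (hq : ∀ i, 0 < q i) : 0 ≤ relEnt U V p q := by
  refine Finset.sum_nonneg fun i _ => Finset.sum_nonneg fun j _ =>
    mul_nonneg (overlap_nonneg _ _ _ _) ?_
  rcases (hp i).eq_or_lt with h | h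
  · rw [← h]
    simpa using (hq j).le
  · have h2 := Real.add_one_le_exp (Real.log (q j) - Real.log (p i))
    rw [Real.exp_sub, Real.exp_log (hq j), Real.exp_log h, le_div_iff₀ h] at h2
    linarith

lemma relEnt_eq {ρ σ U V : Matrix ι ι ℂ} {p q : ι → ℝ} (hρ : IsSpec ρ U p)
    (hσ : IsSpec σ V q) : relEnt U V p q = -ent ρ
      - (ρ * (V * diagonal (fun j => (Real.log (q j) : ℂ)) * Vᴴ)).trace.re
      - ρ.trace.re + σ.trace.re := by
  have h1 : ∑ i, ∑ j, overlap U V i j * (p i * Real.log (p i)) = -ent ρ := by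
    rw [hρ.ent_eq, ← Finset.sum_neg_distrib]
    refine Finset.sum_congr rfl fun i _ => ?_
    rw [← Finset.sum_mul, overlap_sum_right hρ.2.1 hσ.1, Real.negMulLog]
    ring
  have h2 : ∑ i, ∑ j, overlap U V i j * p i = ρ.trace.re := by
    rw [hρ.trace_eq, Complex.ofReal_re]
    refine Finset.sum_congr rfl fun i _ => ?_
    rw [← Finset.sum_mul, overlap_sum_right hρ.2.1 hσ.1, one_mul]
  have h3 : ∑ i, ∑ j, overlap U V i j * q j = σ.trace.re := by
    rw [hσ.trace_eq, Complex.ofReal_re, Finset.sum_comm]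
    refine Finset.sum_congr rfl fun i _ => ?_
    rw [← Finset.sum_mul, overlap_sum_left hρ.1 hσ.2.1, one_mul]
  rw [trace_mul_spec hρ, Complex.ofReal_re, ← h1, ← h2, ← h3, relEnt]
  simp only [mul_add, mul_sub, Finset.sum_add_distrib, Finset.sum_sub_distrib]

end RelativeEntropy

section MixedUnitary

variable {ι κ : Type*} [Fintype ι] [DecidableEq ι] [Fintype κ]

omit [DecidableEq ι] in
lemma mix_posSemidef {w : κ → ℝ} (hw : ∀ k, 0 ≤ w k) (W : κ → Matrix ι ι ℂ) {M : Matrix ι ι ℂ}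
    (hM : M.PosSemidef) : (mix w W M).PosSemidef :=
  posSemidef_sum _ fun k _ => (hM.mul_mul_conjTranspose_same (W k)).smul
    (Complex.zero_le_real.2 (hw k))

lemma trace_mix {w : κ → ℝ} {W : κ → Matrix ι ι ℂ} (hw1 : ∑ k, w k = 1)
    (hW : ∀ k, (W k)ᴴ * W k = 1) (M : Matrix ι ι ℂ) : (mix w W M).trace = M.trace := by
  have : ∀ k, (W k * M * (W k)ᴴ).trace = M.trace := fun k => by
    rw [Matrix.trace_mul_comm, ← mul_assoc, hW, one_mul]
  simp only [mix, trace_sum, trace_smul, this, ← Finset.sum_smul]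
  rw [← Complex.ofReal_sum, hw1, Complex.ofReal_one, one_smul]

lemma mix_add (w : κ → ℝ) (W : κ → Matrix ι ι ℂ) (M N : Matrix ι ι ℂ) :
    mix w W (M + N) = mix w W M + mix w W N := by
  simp only [mix, mul_add, add_mul, smul_add, Finset.sum_add_distrib]

omit [DecidableEq ι] in
lemma mix_smul (w : κ → ℝ) (W : κ → Matrix ι ι ℂ) (a : ℂ) (M : Matrix ι ι ℂ) :
    mix w W (a • M) = a • mix w W M := by
  simp only [mix, Matrix.mul_smul, Matrix.smul_mul, Finset.smul_sum]
  refine Finset.sum_congr rfl fun k _ => smul_comm _ _ _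

lemma mix_one {w : κ → ℝ} {W : κ → Matrix ι ι ℂ} (hw1 : ∑ k, w k = 1)
    (hW : ∀ k, W k * (W k)ᴴ = 1) : mix w W 1 = 1 := by
  simp only [mix, mul_one, hW, ← Finset.sum_smul]
  rw [← Complex.ofReal_sum, hw1, Complex.ofReal_one, one_smul]

lemma IsSpec.exists_posDef {M : Matrix ι ι ℂ} (hM : M.PosDef) :
    ∃ U p, IsSpec M U p ∧ ∀ i, 0 < p i :=
  ⟨_, _, isSpec_eigenvalues hM.1, (isSpec_eigenvalues hM.1).posDef_pos hM⟩

lemma IsSpec.posDef {M U : Matrix ι ι ℂ} {p : ι → ℝ} (h : IsSpec M U p) (hp : ∀ i, 0 < p i) :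
    M.PosDef := by
  rw [h.2.2]
  refine PosDef.mul_mul_conjTranspose_same (posDef_diagonal_iff.2 fun i => ?_) ?_
  · exact_mod_cast hp i
  · intro x y hxy
    have := congrArg (fun z => z ᵥ* Uᴴ) hxy
    simpa [h.1] using this

lemma PosDef.conj_unitary {M V : Matrix ι ι ℂ} (hM : M.PosDef) (h1 : V * Vᴴ = 1)
    (h2 : Vᴴ * V = 1) : (V * M * Vᴴ).PosDef := by
  obtain ⟨U, p, h, hp⟩ := IsSpec.exists_posDef hM
  exact (h.conj h1 h2).posDef hp

lemma mix_posDef {w : κ → ℝ} {W : κ → Matrix ι ι ℂ} (hw : ∀ k, 0 ≤ w k) (hw1 : ∑ k, w k = 1)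
    (hW : ∀ k, W k * (W k)ᴴ = 1) (hW' : ∀ k, (W k)ᴴ * W k = 1) {M : Matrix ι ι ℂ}
    (hM : M.PosDef) : (mix w W M).PosDef := by
  obtain ⟨k, -, hk⟩ : ∃ k ∈ Finset.univ, 0 < w k := by
    by_contra! h
    have := Finset.sum_nonpos h
    linarith
  classical
  rw [mix, ← Finset.add_sum_erase _ _ (Finset.mem_univ k)]
  refine PosDef.add_posSemidef ((PosDef.conj_unitary hM (hW k) (hW' k)).smul
    (Complex.zero_lt_real.2 hk)) ?_
  exact posSemidef_sum _ fun k _ => (hM.posSemidef.mul_mul_conjTranspose_same (W k)).smul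
    (Complex.zero_le_real.2 (hw k))

lemma IsSpec.trace_mul_log {M V : Matrix ι ι ℂ} {q : ι → ℝ} (h : IsSpec M V q) :
    (M * (V * diagonal (fun j => (Real.log (q j) : ℂ)) * Vᴴ)).trace.re = -ent M := by
  have : M * (V * diagonal (fun j => (Real.log (q j) : ℂ)) * Vᴴ)
      = V * diagonal (fun i => ((q i * Real.log (q i) : ℝ) : ℂ)) * Vᴴ := by
    have e : diagonal (fun i => ((q i * Real.log (q i) : ℝ) : ℂ))
      = diagonal (fun i => (q i : ℂ)) * diagonal (fun i => (Real.log (q i) : ℂ)) := by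
      rw [diagonal_mul_diagonal]; congr 1; ext i; push_cast; rfl
    rw [e, h.2.2]
    simp only [mul_assoc]
    rw [← mul_assoc Vᴴ V, h.2.1, one_mul]
  rw [this, IsSpec.trace_eq ⟨h.1, h.2.1, rfl⟩, Complex.ofReal_re, h.ent_eq,
    ← Finset.sum_neg_distrib]
  refine Finset.sum_congr rfl fun i _ => ?_
  rw [Real.negMulLog]
  ring

omit [DecidableEq ι] in
lemma re_trace_smul (a : ℝ) (M : Matrix ι ι ℂ) : ((a : ℂ) • M).trace.re = a * M.trace.re := by
  rw [trace_smul, smul_eq_mul, Complex.re_ofReal_mul]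

/-- Concavity of the entropy. -/
lemma ent_concave {ρ σ : Matrix ι ι ℂ} (hρ : ρ.PosDef) (hσ : σ.PosDef) (ht : ρ.trace = σ.trace)
    {l : ℝ} (h0 : 0 ≤ l) (h1 : l ≤ 1) :
    l * ent ρ + (1 - l) * ent σ ≤ ent ((l : ℂ) • ρ + ((1 - l : ℝ) : ℂ) • σ) := by
  have hτ : ((l : ℂ) • ρ + ((1 - l : ℝ) : ℂ) • σ).PosDef := by
    rcases h0.eq_or_lt with h | h
    · subst h; simpa using hσ
    · exact (hρ.smul (Complex.zero_lt_real.2 h)).add_posSemidef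
        (hσ.posSemidef.smul (Complex.zero_le_real.2 (by linarith)))
  have htr : ((l : ℂ) • ρ + ((1 - l : ℝ) : ℂ) • σ).trace.re = σ.trace.re := by
    rw [trace_add, Complex.add_re, re_trace_smul, re_trace_smul, ht]; ring
  set τ := (l : ℂ) • ρ + ((1 - l : ℝ) : ℂ) • σ with hτd
  obtain ⟨U, p, hU, hp⟩ := IsSpec.exists_posDef hρ
  obtain ⟨V, q, hV, hq⟩ := IsSpec.exists_posDef hσ
  obtain ⟨X, x, hX, hx⟩ := IsSpec.exists_posDef hτ
  have a1 := relEnt_nonneg U X (fun i => (hp i).le) hx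
  have a2 := relEnt_nonneg V X (fun i => (hq i).le) hx
  rw [relEnt_eq hU hX] at a1
  rw [relEnt_eq hV hX] at a2
  have a3 := hX.trace_mul_log
  generalize X * diagonal (fun j => (Real.log (x j) : ℂ)) * Xᴴ = L at a1 a2 a3
  have a4 : (τ * L).trace.re = l * (ρ * L).trace.re + (1 - l) * (σ * L).trace.re := by
    rw [hτd, add_mul, trace_add, Complex.add_re, Matrix.smul_mul, Matrix.smul_mul, re_trace_smul,
      re_trace_smul]
  rw [ht] at a1
  nlinarith [mul_nonneg h0 a1, mul_nonneg (sub_nonneg.2 h1) a2]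

lemma conj_log_of_conj {M V : Matrix ι ι ℂ} {q : ι → ℝ} (h : IsSpec M V q) {P : Matrix ι ι ℂ}
    (hP : P * M * Pᴴ = M) (h2 : Pᴴ * P = 1) (f : ℝ → ℝ) :
    Pᴴ * (V * diagonal (fun j => (f (q j) : ℂ)) * Vᴴ) * P
      = V * diagonal (fun j => (f (q j) : ℂ)) * Vᴴ := by
  have hc : M * P = P * M := by
    conv_lhs => rw [← hP]
    rw [mul_assoc, h2, mul_one]
  have hA : diagonal (fun j => (q j : ℂ)) * (Vᴴ * P * V)
      = (Vᴴ * P * V) * diagonal (fun j => (q j : ℂ)) := by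
    have hd : diagonal (fun j => (q j : ℂ)) = Vᴴ * M * V := by
      rw [h.2.2]
      simp only [mul_assoc]
      rw [h.2.1, mul_one, ← mul_assoc, h.2.1, one_mul]
    rw [hd]
    calc _ = Vᴴ * M * (V * Vᴴ) * P * V := by simp only [mul_assoc]
      _ = Vᴴ * (M * P) * V := by rw [h.1]; simp only [mul_assoc, one_mul]
      _ = Vᴴ * P * (V * Vᴴ) * M * V := by rw [hc, h.1]; simp only [mul_assoc, one_mul]
      _ = _ := by simp only [mul_assoc]
  have hB : diagonal (fun j => (f (q j) : ℂ)) * (Vᴴ * P * V)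
      = (Vᴴ * P * V) * diagonal (fun j => (f (q j) : ℂ)) := by
    ext i j
    have := congrFun (congrFun hA i) j
    rw [diagonal_mul, mul_diagonal] at this ⊢
    by_cases hz : (Vᴴ * P * V) i j = 0
    · simp [hz]
    · rw [mul_comm] at this
      have := mul_left_cancel₀ hz this
      rw [Complex.ofReal_inj.1 this, mul_comm]
  have hL : (V * diagonal (fun j => (f (q j) : ℂ)) * Vᴴ) * P
      = P * (V * diagonal (fun j => (f (q j) : ℂ)) * Vᴴ) := by
    calc _ = V * diagonal (fun j => (f (q j) : ℂ)) * (Vᴴ * P) * (V * Vᴴ) := by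
          rw [h.1]; simp only [mul_assoc, mul_one]
      _ = V * (diagonal (fun j => (f (q j) : ℂ)) * (Vᴴ * P * V)) * Vᴴ := by
          simp only [mul_assoc]
      _ = (V * Vᴴ) * P * (V * diagonal (fun j => (f (q j) : ℂ)) * Vᴴ) := by
          rw [hB]; simp only [mul_assoc]
      _ = _ := by rw [h.1, one_mul]
  rw [mul_assoc, hL, ← mul_assoc, h2, one_mul]

lemma relEnt_mix_eq {w : κ → ℝ} {W : κ → Matrix ι ι ℂ} (hw1 : ∑ k, w k = 1)
    (hW' : ∀ k, (W k)ᴴ * W k = 1) {ρ U V : Matrix ι ι ℂ}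
    {p q : ι → ℝ} (hρ : IsSpec ρ U p) (hσ : IsSpec (mix w W ρ) V q)
    (hfix : ∀ k, w k ≠ 0 → W k * mix w W ρ * (W k)ᴴ = mix w W ρ) :
    relEnt U V p q = ent (mix w W ρ) - ent ρ := by
  rw [relEnt_eq hρ hσ, trace_mix hw1 hW']
  have h1 := hσ.trace_mul_log
  set L := V * diagonal (fun j => (Real.log (q j) : ℂ)) * Vᴴ with hL
  have h2 : (mix w W ρ * L).trace = (ρ * L).trace := by
    have : ∀ k, (w k : ℂ) * (W k * ρ * (W k)ᴴ * L).trace = (w k : ℂ) * (ρ * L).trace := by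
      intro k
      by_cases hk : w k = 0
      · simp [hk]
      · congr 1
        have := conj_log_of_conj hσ (hfix k hk) (hW' k) Real.log
        rw [← hL] at this
        conv_rhs => rw [← this]
        rw [mul_assoc, mul_assoc, Matrix.trace_mul_comm]
        simp only [mul_assoc]
    conv_lhs => rw [mix]
    simp only [Finset.sum_mul, trace_sum, Matrix.smul_mul, trace_smul, smul_eq_mul, this]
    rw [← Finset.sum_mul, ← Complex.ofReal_sum, hw1, Complex.ofReal_one, one_mul]
  rw [← h2]
  linarith

/-- Strong subadditivity for a mixed unitary channel and a commuting conditional expectation. -/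
theorem ent_add_ent_le {κ' : Type*} [Fintype κ'] {w : κ → ℝ} {W : κ → Matrix ι ι ℂ}
    (hw : ∀ k, 0 ≤ w k) (hw1 : ∑ k, w k = 1)
    (hW : ∀ k, W k * (W k)ᴴ = 1) (hW' : ∀ k, (W k)ᴴ * W k = 1)
    {v : κ' → ℝ} {X : κ' → Matrix ι ι ℂ} (hv : ∀ k, 0 ≤ v k) (hv1 : ∑ k, v k = 1)
    (hX : ∀ k, X k * (X k)ᴴ = 1) (hX' : ∀ k, (X k)ᴴ * X k = 1) {ρ : Matrix ι ι ℂ}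
    (hρ : ρ.PosDef) (hfix : ∀ k, v k ≠ 0 → ∀ M, X k * mix v X M * (X k)ᴴ = mix v X M)
    (hcomm : mix v X (mix w W ρ) = mix w W (mix v X ρ)) :
    ent ρ + ent (mix w W (mix v X ρ)) ≤ ent (mix w W ρ) + ent (mix v X ρ) := by
  have hE := mix_posDef hw hw1 hW hW' hρ
  have hF := mix_posDef hv hv1 hX hX' hρ
  have hEF := mix_posDef hw hw1 hW hW' hF
  obtain ⟨U, p, hU, hp⟩ := IsSpec.exists_posDef hρ
  obtain ⟨U1, p1, hU1, hp1⟩ := IsSpec.exists_posDef hE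
  obtain ⟨U2, p2, hU2, hp2⟩ := IsSpec.exists_posDef hF
  obtain ⟨U3, p3, hU3, hp3⟩ := IsSpec.exists_posDef hEF
  have h1 := relEnt_mix_eq hv1 hX' hU hU2 (fun k hk => hfix k hk _)
  have h2 := relEnt_mix_eq hv1 hX' hU1 (hcomm ▸ hU3) (fun k hk => hfix k hk _)
  have h3 := relEnt_mix_le hw hw1 hW hU hU2 hU1 hU3 hp hp2 hp1 hp3
  rw [h1, h2, hcomm] at h3
  linarith

end MixedUnitary

section Kernel

variable {R : Type*} [Fintype R] [DecidableEq R] {n : ℕ}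

/-- The blocks of an operator on a bipartite system. -/
def blk {B : Type*} (M : Matrix (R × B) (R × B) ℂ) (r r' : R) : Matrix B B ℂ :=
  Matrix.of fun x y => M (r, x) (r', y)

/-- The operator acting trivially on the first factor. -/
def lift {B : Type*} (P : Matrix B B ℂ) : Matrix (R × B) (R × B) ℂ := (1 : Matrix R R ℂ) ⊗ₖ P

lemma blk_lift_conj {B : Type*} [Fintype B] (P : Matrix B B ℂ) (M : Matrix (R × B) (R × B) ℂ)
    (r r' : R) : blk (lift P * M * (lift P)ᴴ) r r' = P * blk M r r' * Pᴴ := by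
  ext x y
  simp only [blk, lift, of_apply, mul_apply, Fintype.sum_prod_type, conjTranspose_apply,
    kroneckerMap_apply, one_apply, ite_mul, one_mul, zero_mul, apply_ite star, star_zero, mul_ite,
    mul_zero]
  simp

lemma lift_mul {B : Type*} [Fintype B] (P Q : Matrix B B ℂ) :
    (lift P * lift Q : Matrix (R × B) (R × B) ℂ) = lift (P * Q) := by
  rw [lift, lift, ← mul_kronecker_mul, one_mul, lift]

omit [Fintype R] in
lemma lift_conjTranspose {B : Type*} (P : Matrix B B ℂ) :
    (lift P : Matrix (R × B) (R × B) ℂ)ᴴ = lift Pᴴ := by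
  rw [lift, conjTranspose_kronecker, conjTranspose_one, lift]

omit [Fintype R] in
lemma lift_one {B : Type*} [DecidableEq B] :
    (lift (1 : Matrix B B ℂ) : Matrix (R × B) (R × B) ℂ) = 1 := one_kronecker_one

/-- The weights of the Pauli operators in the one-qubit channel contracting the traceless part
by `l`. -/
def wt (l : ℝ) (s : Fin 4) : ℝ := if s = 0 then (1 + 3 * l) / 4 else (1 - l) / 4

lemma sum_wt (l : ℝ) : ∑ s, wt l s = 1 := by
  simp [Fin.sum_univ_four, wt]
  ring

lemma wt_nonneg {l : ℝ} (h0 : -(1 / 3) ≤ l) (h1 : l ≤ 1) (s : Fin 4) : 0 ≤ wt l s := by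
  unfold wt
  split_ifs <;> linarith

lemma pauliWeight_eq (p : ℝ) : pauliWeight p = wt (1 - 4 * p / 3) := by
  ext s
  unfold pauliWeight wt
  split_ifs <;> ring

lemma pauli_hermitian (s : Fin 4) : (pauli s)ᴴ = pauli s := by
  fin_cases s <;> ext i j <;> fin_cases i <;> fin_cases j <;> simp [pauli]

lemma pauli_sq (s : Fin 4) : pauli s * pauli s = 1 := by
  fin_cases s <;> ext i j <;> fin_cases i <;> fin_cases j <;> simp [pauli]

lemma pauliString_mul (s t : Fin n → Fin 4) (x y : QSpace n) :
    (pauliString s * pauliString t) x y = ∏ i, (pauli (s i) * pauli (t i)) (x i) (y i) := by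
  simp only [pauliString, mul_apply, of_apply, Fintype.prod_sum, Finset.prod_mul_distrib]

lemma prod_one_apply (x y : QSpace n) :
    ∏ i, (1 : Matrix (Fin 2) (Fin 2) ℂ) (x i) (y i) = (1 : Matrix (QSpace n) (QSpace n) ℂ) x y := by
  by_cases h : x = y
  · subst h; simp
  · rw [one_apply_ne h]
    obtain ⟨i, hi⟩ := Function.ne_iff.1 h
    exact Finset.prod_eq_zero (Finset.mem_univ i) (one_apply_ne hi)

lemma pauliString_sq (s : Fin n → Fin 4) : pauliString s * pauliString s = 1 := by
  ext x y
  simp only [pauliString_mul, pauli_sq, prod_one_apply]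

lemma pauliString_hermitian (s : Fin n → Fin 4) : (pauliString s)ᴴ = pauliString s := by
  ext x y
  simp only [conjTranspose_apply, pauliString, of_apply, star_prod]
  refine Finset.prod_congr rfl fun i _ => ?_
  rw [← conjTranspose_apply, pauli_hermitian]

/-- The Pauli strings on the second factor. -/
def pl (s : Fin n → Fin 4) : Matrix (R × QSpace n) (R × QSpace n) ℂ := lift (pauliString s)

omit [Fintype R] in
lemma pl_hermitian (s : Fin n → Fin 4) : (pl s : Matrix (R × QSpace n) _ ℂ)ᴴ = pl s := by
  rw [pl, lift_conjTranspose, pauliString_hermitian]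

lemma pl_sq (s : Fin n → Fin 4) : (pl s : Matrix (R × QSpace n) _ ℂ) * pl s = 1 := by
  rw [pl, lift_mul, pauliString_sq, lift_one]

lemma pl_unitary (s : Fin n → Fin 4) : (pl s : Matrix (R × QSpace n) _ ℂ) * (pl s)ᴴ = 1 := by
  rw [pl_hermitian, pl_sq]

lemma pl_unitary' (s : Fin n → Fin 4) : (pl s : Matrix (R × QSpace n) _ ℂ)ᴴ * pl s = 1 := by
  rw [pl_hermitian, pl_sq]

/-- Product weights of Pauli strings. -/
def wts (l : Fin n → ℝ) (s : Fin n → Fin 4) : ℝ := ∏ i, wt (l i) (s i)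

lemma sum_wts (l : Fin n → ℝ) : ∑ s, wts l s = 1 := by
  simp only [wts, ← Fintype.prod_sum, sum_wt, Finset.prod_const_one]

lemma wts_nonneg {l : Fin n → ℝ} (h0 : ∀ i, -(1 / 3) ≤ l i) (h1 : ∀ i, l i ≤ 1)
    (s : Fin n → Fin 4) : 0 ≤ wts l s :=
  Finset.prod_nonneg fun i _ => wt_nonneg (h0 i) (h1 i) _

/-- Depolarizing noise with site-dependent contraction factors `l`, on the second factor. -/
def dep (l : Fin n → ℝ) (M : Matrix (R × QSpace n) (R × QSpace n) ℂ) :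
    Matrix (R × QSpace n) (R × QSpace n) ℂ := mix (wts l) pl M

/-- The product superoperator with one-site kernels `κ`, on the second factor. -/
def prodSuper (κ : Fin n → Matrix (Fin 2 × Fin 2) (Fin 2 × Fin 2) ℂ)
    (M : Matrix (R × QSpace n) (R × QSpace n) ℂ) : Matrix (R × QSpace n) (R × QSpace n) ℂ :=
  Matrix.of fun a b => ∑ z : Fin n → Fin 2 × Fin 2, (∏ i, κ i (a.2 i, b.2 i) (z i)) *
    M (a.1, fun i => (z i).1) (b.1, fun i => (z i).2)

omit [Fintype R] [DecidableEq R] in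
lemma prodSuper_prodSuper (κ κ' : Fin n → Matrix (Fin 2 × Fin 2) (Fin 2 × Fin 2) ℂ)
    (M : Matrix (R × QSpace n) (R × QSpace n) ℂ) :
    prodSuper κ (prodSuper κ' M) = prodSuper (fun i => κ i * κ' i) M := by
  ext a b
  simp only [prodSuper, of_apply, mul_apply, Finset.mul_sum, Fintype.prod_sum,
    Finset.sum_mul, Finset.prod_mul_distrib]
  rw [Finset.sum_comm]
  simp only [mul_assoc]

/-- Kernel of the conjugation by a Pauli matrix. -/
def kerP (s : Fin 4) : Matrix (Fin 2 × Fin 2) (Fin 2 × Fin 2) ℂ :=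
  Matrix.of fun a b => pauli s a.1 b.1 * star (pauli s a.2 b.2)

/-- Kernel of the completely depolarizing channel. -/
def kerE : Matrix (Fin 2 × Fin 2) (Fin 2 × Fin 2) ℂ :=
  Matrix.of fun a b => if a.1 = a.2 ∧ b.1 = b.2 then 1 / 2 else 0

/-- Kernel of the depolarizing channel. -/
def kerT (l : ℝ) : Matrix (Fin 2 × Fin 2) (Fin 2 × Fin 2) ℂ :=
  (l : ℂ) • (1 : Matrix (Fin 2 × Fin 2) (Fin 2 × Fin 2) ℂ) + (1 - l : ℂ) • kerE

lemma kerE_mul_kerE : kerE * kerE = kerE := by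
  ext ⟨a, b⟩ ⟨c, d⟩
  fin_cases a <;> fin_cases b <;> fin_cases c <;> fin_cases d <;>
    simp [kerE, mul_apply, Fintype.sum_prod_type]

lemma kerP_mul_kerE (s : Fin 4) : kerP s * kerE = kerE := by
  ext ⟨a, b⟩ ⟨c, d⟩
  fin_cases s <;> fin_cases a <;> fin_cases b <;> fin_cases c <;> fin_cases d <;>
    simp [kerE, kerP, pauli, mul_apply, Fintype.sum_prod_type]

lemma kerP_zero : kerP 0 = 1 := by
  ext ⟨a, b⟩ ⟨c, d⟩
  fin_cases a <;> fin_cases b <;> fin_cases c <;> fin_cases d <;>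
    simp [kerP, pauli, one_apply]

lemma sum_wt_kerP (l : ℝ) : ∑ s, (wt l s : ℂ) • kerP s = kerT l := by
  ext ⟨a, b⟩ ⟨c, d⟩
  simp only [Fin.sum_univ_four]
  fin_cases a <;> fin_cases b <;> fin_cases c <;> fin_cases d <;>
    simp [kerE, kerP, kerT, pauli, wt, one_apply] <;> ring

lemma kerT_mul (l m : ℝ) : kerT l * kerT m = kerT (l * m) := by
  simp only [kerT, add_mul, mul_add, Matrix.smul_mul, Matrix.mul_smul, one_mul, mul_one,
    kerE_mul_kerE]
  push_cast
  module

lemma kerT_one : kerT 1 = 1 := by simp [kerT]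

lemma kerT_zero : kerT 0 = kerE := by simp [kerT]

lemma pl_conj (s : Fin n → Fin 4) (M : Matrix (R × QSpace n) (R × QSpace n) ℂ) :
    pl s * M * (pl s)ᴴ = prodSuper (fun i => kerP (s i)) M := by
  ext ⟨r, x⟩ ⟨r', y⟩
  have := congrFun (congrFun (blk_lift_conj (pauliString s) M r r') x) y
  rw [pl]
  refine Eq.trans this ?_
  simp only [prodSuper, kerP, of_apply, mul_apply, conjTranspose_apply, blk, pauliString,
    Finset.prod_mul_distrib, Finset.sum_mul, star_prod]
  rw [← (Equiv.arrowProdEquivProdArrow (Fin n) (fun _ => Fin 2) (fun _ => Fin 2)).symm.sum_comp,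
    Fintype.sum_prod_type, Finset.sum_comm]
  refine Finset.sum_congr rfl fun u _ => Finset.sum_congr rfl fun v _ => ?_
  simp only [Equiv.arrowProdEquivProdArrow, Equiv.coe_fn_symm_mk]
  ring

lemma dep_eq (l : Fin n → ℝ) (M : Matrix (R × QSpace n) (R × QSpace n) ℂ) :
    dep l M = prodSuper (fun i => kerT (l i)) M := by
  simp only [dep, mix, pl_conj]
  ext a b
  simp only [Matrix.sum_apply, Matrix.smul_apply, prodSuper, of_apply, smul_eq_mul, Finset.mul_sum]
  rw [Finset.sum_comm]
  refine Finset.sum_congr rfl fun z _ => ?_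
  simp only [← sum_wt_kerP, Matrix.sum_apply, Matrix.smul_apply, smul_eq_mul, Fintype.prod_sum, wts,
    Finset.prod_mul_distrib, Finset.sum_mul]
  push_cast
  simp only [mul_assoc]

lemma dep_dep (l m : Fin n → ℝ) (M : Matrix (R × QSpace n) (R × QSpace n) ℂ) :
    dep l (dep m M) = dep (fun i => l i * m i) M := by
  simp only [dep_eq, prodSuper_prodSuper, kerT_mul]

omit [Fintype R] [DecidableEq R] in
lemma prodSuper_one (M : Matrix (R × QSpace n) (R × QSpace n) ℂ) :
    prodSuper (fun _ => 1) M = M := by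
  ext ⟨r, x⟩ ⟨r', y⟩
  simp only [prodSuper, of_apply]
  rw [Finset.sum_eq_single (fun i => (x i, y i))]
  · simp
  · intro z _ hz
    obtain ⟨i, hi⟩ := Function.ne_iff.1 hz
    refine mul_eq_zero_of_left (Finset.prod_eq_zero (Finset.mem_univ i) ?_) _
    exact one_apply_ne hi.symm
  · simp

lemma dep_one (M : Matrix (R × QSpace n) (R × QSpace n) ℂ) : dep (fun _ => 1) M = M := by
  rw [dep_eq, kerT_one, prodSuper_one]

lemma dep_zero_apply (M : Matrix (R × QSpace n) (R × QSpace n) ℂ) (r r' : R) (x y : QSpace n) :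
    dep (fun _ => 0) M (r, x) (r', y)
      = (if x = y then ((2 : ℂ) ^ n)⁻¹ else 0) * (blk M r r').trace := by
  rw [dep_eq, kerT_zero]
  simp only [prodSuper, of_apply, kerE, Matrix.trace, diag_apply, blk, Finset.mul_sum]
  rw [← (Equiv.arrowProdEquivProdArrow (Fin n) (fun _ => Fin 2) (fun _ => Fin 2)).symm.sum_comp,
    Fintype.sum_prod_type]
  refine Finset.sum_congr rfl fun u _ => ?_
  rw [Finset.sum_eq_single u]
  · simp only [Equiv.arrowProdEquivProdArrow, Equiv.coe_fn_symm_mk, and_true]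
    congr 1
    split_ifs with h
    · subst h; simp
    · obtain ⟨i, hi⟩ := Function.ne_iff.1 h
      exact Finset.prod_eq_zero (Finset.mem_univ i) (by simp [hi])
  · intro v _ hv
    obtain ⟨i, hi⟩ := Function.ne_iff.1 hv
    rw [Finset.prod_eq_zero (Finset.mem_univ i), zero_mul]
    simp [Equiv.arrowProdEquivProdArrow, hi.symm]
  · simp

lemma dep_update (l : Fin n → ℝ) (i : Fin n) (a : ℝ)
    (M : Matrix (R × QSpace n) (R × QSpace n) ℂ) :
    dep (Function.update l i a) M = (a : ℂ) • dep (Function.update l i 1) M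
      + ((1 - a : ℝ) : ℂ) • dep (Function.update l i 0) M := by
  have e : ∀ (a : ℝ) (x y : QSpace n) (z : Fin n → Fin 2 × Fin 2),
      ∏ j, kerT (Function.update l i a j) (x j, y j) (z j)
        = kerT a (x i, y i) (z i) *
          ∏ j ∈ Finset.univ.erase i, kerT (l j) (x j, y j) (z j) := by
    intro a x y z
    rw [← Finset.mul_prod_erase _ _ (Finset.mem_univ i), Function.update_self]
    congr 1
    refine Finset.prod_congr rfl fun j hj => ?_
    rw [Function.update_of_ne (Finset.ne_of_mem_erase hj)]
  simp only [dep_eq]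
  ext ⟨r, x⟩ ⟨r', y⟩
  simp only [prodSuper, Matrix.add_apply, Matrix.smul_apply, of_apply, smul_eq_mul, Finset.mul_sum,
    ← Finset.sum_add_distrib, e]
  refine Finset.sum_congr rfl fun z _ => ?_
  rw [kerT_one, kerT_zero, kerT]
  simp only [Matrix.add_apply, Matrix.smul_apply, smul_eq_mul]
  push_cast
  ring

lemma dep_fixed {g : Fin n → ℝ} (hg : ∀ i, g i = 0 ∨ g i = 1) {s : Fin n → Fin 4}
    (hs : wts g s ≠ 0) (M : Matrix (R × QSpace n) (R × QSpace n) ℂ) :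
    pl s * dep g M * (pl s)ᴴ = dep g M := by
  rw [pl_conj, dep_eq, prodSuper_prodSuper]
  congr 1
  ext1 i
  rcases hg i with h | h
  · rw [h, kerT_zero, kerP_mul_kerE]
  · have h1 : wt (g i) (s i) ≠ 0 := fun h0 => hs (Finset.prod_eq_zero (Finset.mem_univ i) h0)
    have h2 : s i = 0 := by
      by_contra h3
      rw [h] at h1
      simp [wt, h3] at h1
    rw [h2, kerP_zero, one_mul]

lemma dep_comm (l m : Fin n → ℝ) (M : Matrix (R × QSpace n) (R × QSpace n) ℂ) :
    dep l (dep m M) = dep m (dep l M) := by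
  rw [dep_dep, dep_dep]
  simp only [mul_comm]

end Kernel

section Contraction

variable {R : Type*} [Fintype R] [DecidableEq R] {n : ℕ}

lemma dep_posSemidef {l : Fin n → ℝ} (h0 : ∀ i, -(1 / 3) ≤ l i) (h1 : ∀ i, l i ≤ 1)
    {M : Matrix (R × QSpace n) (R × QSpace n) ℂ} (hM : M.PosSemidef) : (dep l M).PosSemidef :=
  mix_posSemidef (wts_nonneg h0 h1) _ hM

lemma dep_posDef {l : Fin n → ℝ} (h0 : ∀ i, -(1 / 3) ≤ l i) (h1 : ∀ i, l i ≤ 1)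
    {M : Matrix (R × QSpace n) (R × QSpace n) ℂ} (hM : M.PosDef) : (dep l M).PosDef :=
  mix_posDef (wts_nonneg h0 h1) (sum_wts l) pl_unitary pl_unitary' hM

lemma trace_dep (l : Fin n → ℝ) (M : Matrix (R × QSpace n) (R × QSpace n) ℂ) :
    (dep l M).trace = M.trace := trace_mix (sum_wts l) pl_unitary' M

lemma ent_dep_add_ent_dep {e g : Fin n → ℝ} (h0 : ∀ i, -(1 / 3) ≤ e i) (h1 : ∀ i, e i ≤ 1)
    (hg : ∀ i, g i = 0 ∨ g i = 1) {M : Matrix (R × QSpace n) (R × QSpace n) ℂ} (hM : M.PosDef) :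
    ent M + ent (dep e (dep g M)) ≤ ent (dep e M) + ent (dep g M) :=
  ent_add_ent_le (wts_nonneg h0 h1) (sum_wts e) pl_unitary pl_unitary'
    (wts_nonneg (fun i => by rcases hg i with h | h <;> rw [h] <;> norm_num)
      (fun i => by rcases hg i with h | h <;> rw [h] <;> norm_num))
    (sum_wts g) pl_unitary pl_unitary' hM (fun _ hs M => dep_fixed hg hs M) (dep_comm g e M)

lemma ent_dep_finset {l : ℝ} (h0 : 0 ≤ l) (h1 : l ≤ 1) (S : Finset (Fin n)) :
    ∀ {M : Matrix (R × QSpace n) (R × QSpace n) ℂ}, M.PosDef →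
    l * ent M + (1 - l) * ent (dep (fun i => if i ∈ S then 0 else 1) M)
      ≤ ent (dep (fun i => if i ∈ S then l else 1) M) := by
  induction S using Finset.induction_on with
  | empty =>
    intro M _
    simp only [Finset.notMem_empty, if_false, dep_one]
    linarith
  | insert i S hi ih =>
    intro M hM
    have hup : ∀ a : ℝ, (fun j => if j ∈ insert i S then a else 1)
        = Function.update (fun j => if j ∈ S then a else 1) i a := by
      intro a
      ext j
      by_cases hj : j = i
      · subst hj; simp
      · simp [hj]
    have hself : ∀ a : ℝ, Function.update (fun j => if j ∈ S then a else 1) i 1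
        = fun j => if j ∈ S then a else 1 := by
      intro a
      rw [Function.update_eq_iff]
      simp [hi]
    have hmul : ∀ a : ℝ, dep (Function.update (fun j => if j ∈ S then a else 1) i 0) M
        = dep (fun j => if j ∈ S then a else 1) (dep (Function.update (fun _ => 1) i 0) M) := by
      intro a
      rw [dep_dep]
      congr 1
      ext j
      by_cases hj : j = i
      · subst hj; simp
      · simp [hj]
    have hl0 : ∀ j, -(1 / 3) ≤ (fun j => if j ∈ S then l else 1) j := by
      intro j; dsimp only; split_ifs <;> linarith
    have hl1 : ∀ j, (fun j => if j ∈ S then l else 1) j ≤ 1 := by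
      intro j; dsimp only; split_ifs <;> linarith
    have hg0 : ∀ j, -(1 / 3) ≤ (fun j => if j ∈ S then (0 : ℝ) else 1) j := by
      intro j; dsimp only; split_ifs <;> linarith
    have hg1 : ∀ j, (fun j => if j ∈ S then (0 : ℝ) else 1) j ≤ 1 := by
      intro j; dsimp only; split_ifs <;> linarith
    have hh : ∀ j, Function.update (fun _ : Fin n => (1 : ℝ)) i 0 j = 0 ∨
        Function.update (fun _ : Fin n => (1 : ℝ)) i 0 j = 1 := by
      intro j
      by_cases hj : j = i
      · subst hj; simp
      · simp [hj]
    have hK : (dep (Function.update (fun _ => 1) i 0) M).PosDef := by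
      refine dep_posDef ?_ ?_ hM
      · intro j; rcases hh j with h | h <;> rw [h] <;> norm_num
      · intro j; rcases hh j with h | h <;> rw [h] <;> norm_num
    rw [hup l, hup 0, hmul 0, dep_update _ i l, hself l, hmul l]
    have c := ent_concave (dep_posDef hl0 hl1 hM) (dep_posDef hl0 hl1 hK)
      (by simp only [trace_dep]) h0 h1
    have s := ent_dep_add_ent_dep hg0 hg1 hh hM
    have i1 := ih hM
    have i2 := ih hK
    have h1' := sub_nonneg.2 h1
    nlinarith [mul_le_mul_of_nonneg_left i1 h0, mul_le_mul_of_nonneg_left i2 h1',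
      mul_le_mul_of_nonneg_left s (mul_nonneg h0 h1')]

/-- A density operator whose marginal on the first factor is maximally mixed. -/
structure Good (M : Matrix (R × QSpace n) (R × QSpace n) ℂ) : Prop where
  posSemidef : M.PosSemidef
  marginal : dep (fun _ => 0) M
    = (((Fintype.card (R × QSpace n) : ℝ)⁻¹ : ℝ) : ℂ) • (1 : Matrix (R × QSpace n) _ ℂ)

/-- The entropy deficit. -/
def deficit (M : Matrix (R × QSpace n) (R × QSpace n) ℂ) : ℝ :=
  Real.log (Fintype.card (R × QSpace n)) - ent M

lemma isSpec_smul_one {ι : Type*} [Fintype ι] [DecidableEq ι] (c : ℝ) :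
    IsSpec ((c : ℂ) • (1 : Matrix ι ι ℂ)) 1 (fun _ => c) := by
  refine ⟨by simp, by simp, ?_⟩
  simp [smul_one_eq_diagonal]

lemma ent_smul_one {ι : Type*} [Fintype ι] [DecidableEq ι] [Nonempty ι] :
    ent ((((Fintype.card ι : ℝ)⁻¹ : ℝ) : ℂ) • (1 : Matrix ι ι ℂ)) = Real.log (Fintype.card ι) := by
  have : (Fintype.card ι : ℝ) ≠ 0 := by simp
  rw [(isSpec_smul_one _).ent_eq]
  simp [Real.negMulLog, this]

lemma tendsto_ent {ι : Type*} [Fintype ι] [DecidableEq ι] {M : Matrix ι ι ℂ}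
    (hM : M.IsHermitian) (c : ℝ) :
    Filter.Tendsto (fun ε : ℝ => ent (((1 - ε : ℝ) : ℂ) • M + ((ε * c : ℝ) : ℂ) • (1 : Matrix ι ι ℂ)))
      (nhdsWithin 0 (Set.Ioo 0 1)) (nhds (ent M)) := by
  have h := isSpec_eigenvalues hM
  simp only [(h.affine _ _).ent_eq, h.ent_eq]
  refine tendsto_nhdsWithin_of_tendsto_nhds ?_
  have hc : Continuous fun ε : ℝ =>
      ∑ i, Real.negMulLog ((1 - ε) * hM.eigenvalues i + ε * c) := by
    refine continuous_finsetSum _ fun i _ => Real.continuous_negMulLog.comp ?_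
    fun_prop
  simpa using hc.tendsto 0

lemma Good.dep [Nonempty R] {M : Matrix (R × QSpace n) (R × QSpace n) ℂ} (hM : Good M) {l : ℝ}
    (h0 : -(1 / 3) ≤ l) (h1 : l ≤ 1) : Good (dep (fun _ => l) M) := by
  refine ⟨dep_posSemidef (fun _ => h0) (fun _ => h1) hM.posSemidef, ?_⟩
  rw [dep_dep]
  simp only [zero_mul]
  exact hM.marginal

lemma dep_smul_one (l : Fin n → ℝ) (c : ℂ) :
    dep l (c • (1 : Matrix (R × QSpace n) (R × QSpace n) ℂ)) = c • 1 := by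
  rw [dep, mix_smul, mix_one (sum_wts l) pl_unitary]

/-- A layer of depolarizing noise contracts the entropy deficit. -/
theorem deficit_dep_le [Nonempty R] {M : Matrix (R × QSpace n) (R × QSpace n) ℂ} (hM : Good M)
    {l : ℝ} (h0 : 0 ≤ l) (h1 : l ≤ 1) : deficit (dep (fun _ => l) M) ≤ l * deficit M := by
  set c : ℝ := (Fintype.card (R × QSpace n) : ℝ)⁻¹ with hc
  have hcpos : 0 < c := by
    rw [hc, inv_pos, Nat.cast_pos]
    exact Fintype.card_pos
  have hD := (hM.dep (l := l) (by linarith) h1).posSemidef.1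
  have key : ∀ ε ∈ Set.Ioo (0 : ℝ) 1,
      l * ent (((1 - ε : ℝ) : ℂ) • M + ((ε * c : ℝ) : ℂ) • (1 : Matrix (R × QSpace n) _ ℂ))
        + (1 - l) * Real.log (Fintype.card (R × QSpace n))
      ≤ ent (((1 - ε : ℝ) : ℂ) • dep (fun _ => l) M
        + ((ε * c : ℝ) : ℂ) • (1 : Matrix (R × QSpace n) _ ℂ)) := by
    rintro ε ⟨he0, he1⟩
    have hpd : (((1 - ε : ℝ) : ℂ) • M
        + ((ε * c : ℝ) : ℂ) • (1 : Matrix (R × QSpace n) _ ℂ)).PosDef := by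
      refine PosDef.posSemidef_add (hM.posSemidef.smul (Complex.zero_le_real.2 (by linarith))) ?_
      exact PosDef.one.smul (Complex.zero_lt_real.2 (by positivity))
    have h := ent_dep_finset h0 h1 Finset.univ hpd
    simp only [Finset.mem_univ, if_true] at h
    have hd : ∀ a : ℝ, dep (fun _ => a) (((1 - ε : ℝ) : ℂ) • M
        + ((ε * c : ℝ) : ℂ) • (1 : Matrix (R × QSpace n) _ ℂ))
        = ((1 - ε : ℝ) : ℂ) • dep (fun _ => a) M
        + ((ε * c : ℝ) : ℂ) • (1 : Matrix (R × QSpace n) _ ℂ) := by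
      intro a
      rw [dep, mix_add, ← dep, ← dep, dep_smul_one, dep, mix_smul, ← dep]
    rw [hd, hd, hM.marginal, ← hc, smul_smul, ← add_smul] at h
    have he : ((1 - ε : ℝ) : ℂ) * (c : ℂ) + ((ε * c : ℝ) : ℂ) = (c : ℂ) := by
      push_cast; ring
    rw [he, hc, ent_smul_one, ← hc] at h
    exact h
  have := left_nhdsWithin_Ioo_neBot (zero_lt_one (α := ℝ))
  have hlim := le_of_tendsto_of_tendsto
    (((tendsto_ent hM.posSemidef.1 c).const_mul l).add_const
      ((1 - l) * Real.log (Fintype.card (R × QSpace n))))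
    (tendsto_ent hD c) (Filter.eventually_of_mem self_mem_nhdsWithin key)
  unfold deficit
  linarith

lemma lift_unitary {B : Type*} [Fintype B] [DecidableEq B] {V : Matrix B B ℂ} (h : V * Vᴴ = 1) :
    (lift V : Matrix (R × B) (R × B) ℂ) * (lift V)ᴴ = 1 := by
  rw [lift_conjTranspose, lift_mul, h, lift_one]

lemma lift_unitary' {B : Type*} [Fintype B] [DecidableEq B] {V : Matrix B B ℂ} (h : Vᴴ * V = 1) :
    (lift V : Matrix (R × B) (R × B) ℂ)ᴴ * (lift V) = 1 := by
  rw [lift_conjTranspose, lift_mul, h, lift_one]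

lemma Good.conj {M : Matrix (R × QSpace n) (R × QSpace n) ℂ} (hM : Good M)
    {V : Matrix (QSpace n) (QSpace n) ℂ} (hV : Vᴴ * V = 1) :
    Good (lift V * M * (lift V)ᴴ) := by
  refine ⟨hM.posSemidef.mul_mul_conjTranspose_same _, ?_⟩
  rw [← hM.marginal]
  ext ⟨r, x⟩ ⟨r', y⟩
  rw [dep_zero_apply, dep_zero_apply, blk_lift_conj, Matrix.trace_mul_comm, ← mul_assoc, hV,
    one_mul]

lemma deficit_conj {M : Matrix (R × QSpace n) (R × QSpace n) ℂ} (hM : M.IsHermitian)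
    {V : Matrix (QSpace n) (QSpace n) ℂ} (hV : V * Vᴴ = 1) (hV' : Vᴴ * V = 1) :
    deficit (lift V * M * (lift V)ᴴ) = deficit M := by
  rw [deficit, ent_conj hM (lift_unitary hV) (lift_unitary' hV'), deficit]

end Contraction

section EntropyBounds

variable {ι : Type*} [Fintype ι] [DecidableEq ι]

lemma IsSpec.sum_eq_one {M U : Matrix ι ι ℂ} {p : ι → ℝ} (h : IsSpec M U p) (ht : M.trace = 1) :
    ∑ i, p i = 1 := by
  have := h.trace_eq
  rw [ht] at this
  exact_mod_cast this.symm

lemma ent_nonneg {M : Matrix ι ι ℂ} (hM : M.PosSemidef) (ht : M.trace = 1) : 0 ≤ ent M := by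
  have h := isSpec_eigenvalues hM.1
  have hp := h.posSemidef_nonneg hM
  rw [h.ent_eq]
  refine Finset.sum_nonneg fun i _ => Real.negMulLog_nonneg (hp i) ?_
  rw [← h.sum_eq_one ht]
  exact Finset.single_le_sum (fun j _ => hp j) (Finset.mem_univ i)

lemma ent_le_log_card [Nonempty ι] {M : Matrix ι ι ℂ} (hM : M.PosSemidef) (ht : M.trace = 1) :
    ent M ≤ Real.log (Fintype.card ι) := by
  have h := isSpec_eigenvalues hM.1
  have hp := h.posSemidef_nonneg hM
  have hs := h.sum_eq_one ht
  have hN : (0 : ℝ) < Fintype.card ι := by exact_mod_cast Fintype.card_pos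
  rw [h.ent_eq]
  generalize hM.1.eigenvalues = p at hp hs
  have key : ∀ i, Real.negMulLog (p i) ≤ p i * Real.log (Fintype.card ι)
      + ((Fintype.card ι : ℝ)⁻¹ - p i) := by
    intro i
    rcases (hp i).eq_or_lt with h0 | h0
    · rw [← h0]; simp
    · have h1 := Real.add_one_le_exp (-(Real.log (p i) + Real.log (Fintype.card ι)))
      rw [Real.exp_neg, Real.exp_add, Real.exp_log h0, Real.exp_log hN, mul_inv] at h1
      have h2 := mul_le_mul_of_nonneg_left h1 h0.le
      rw [← mul_assoc, mul_inv_cancel₀ h0.ne', one_mul] at h2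
      rw [Real.negMulLog]
      linarith
  calc _ ≤ ∑ i, (p i * Real.log (Fintype.card ι) + ((Fintype.card ι : ℝ)⁻¹ - p i)) :=
        Finset.sum_le_sum fun i _ => key i
    _ = _ := by
        rw [Finset.sum_add_distrib, Finset.sum_sub_distrib, ← Finset.sum_mul, hs]
        simp [hN.ne']

lemma purity_pos {M : Matrix ι ι ℂ} (hM : M.PosSemidef) (ht : M.trace = 1) :
    0 < (M * M).trace.re := by
  have h := isSpec_eigenvalues hM.1
  have hs := h.sum_eq_one ht
  rw [h.sq.trace_eq, Complex.ofReal_re]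
  refine (Finset.sum_nonneg fun i _ => sq_nonneg _).lt_of_ne' fun h0 => ?_
  have h1 := (Finset.sum_eq_zero_iff_of_nonneg fun i _ => sq_nonneg _).1 h0
  rw [Finset.sum_eq_zero fun i hi => pow_eq_zero_iff two_ne_zero |>.1 (h1 i hi)] at hs
  exact zero_ne_one hs

lemma neg_log_purity_le_ent {M : Matrix ι ι ℂ} (hM : M.PosSemidef) (ht : M.trace = 1) :
    -Real.log (M * M).trace.re ≤ ent M := by
  have h := isSpec_eigenvalues hM.1
  have hp := h.posSemidef_nonneg hM
  have hs := h.sum_eq_one ht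
  have ht0 := purity_pos hM ht
  rw [h.sq.trace_eq, Complex.ofReal_re] at ht0 ⊢
  rw [h.ent_eq]
  generalize hM.1.eigenvalues = p at hp hs ht0
  set t := ∑ i, p i ^ 2 with htd
  have key : ∀ i, -(p i ^ 2 / t - p i + p i * Real.log t) ≤ Real.negMulLog (p i) := by
    intro i
    rcases (hp i).eq_or_lt with h0 | h0
    · rw [← h0]; simp
    · have h1 := Real.add_one_le_exp (Real.log (p i) - Real.log t)
      rw [Real.exp_sub, Real.exp_log h0, Real.exp_log ht0] at h1
      have h2 := mul_le_mul_of_nonneg_left h1 h0.le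
      rw [mul_div_assoc', ← sq] at h2
      rw [Real.negMulLog]
      linarith
  calc -Real.log t = ∑ i, -(p i ^ 2 / t - p i + p i * Real.log t) := by
        rw [Finset.sum_neg_distrib, Finset.sum_add_distrib, Finset.sum_sub_distrib,
          ← Finset.sum_div, ← Finset.sum_mul, ← htd, hs, div_self ht0.ne']
        ring
    _ ≤ _ := Finset.sum_le_sum fun i _ => key i

lemma trace_mul_conj_nonneg {M P : Matrix ι ι ℂ} (hM : M.PosSemidef) (h1 : P * Pᴴ = 1)
    (h2 : Pᴴ * P = 1) : 0 ≤ (M * (P * M * Pᴴ)).trace.re := by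
  have h := isSpec_eigenvalues hM.1
  have hp := h.posSemidef_nonneg hM
  rw [(h.conj h1 h2).2.2, trace_mul_spec h, Complex.ofReal_re]
  exact Finset.sum_nonneg fun i _ => Finset.sum_nonneg fun j _ =>
    mul_nonneg (overlap_nonneg _ _ _ _) (mul_nonneg (hp i) (hp j))

end EntropyBounds

section Layers

variable {R : Type*} [Fintype R] [DecidableEq R] {n : ℕ}

/-- A unitary followed by a layer of depolarizing noise. -/
def layer (l : ℝ) (V : Matrix (QSpace n) (QSpace n) ℂ)
    (M : Matrix (R × QSpace n) (R × QSpace n) ℂ) : Matrix (R × QSpace n) (R × QSpace n) ℂ :=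
  dep (fun _ => l) (lift V * M * (lift V)ᴴ)

lemma Good.layer [Nonempty R] {M : Matrix (R × QSpace n) (R × QSpace n) ℂ} (hM : Good M) {l : ℝ}
    (h0 : -(1 / 3) ≤ l) (h1 : l ≤ 1) {V : Matrix (QSpace n) (QSpace n) ℂ} (hV : Vᴴ * V = 1) :
    Good (layer l V M) := (hM.conj hV).dep h0 h1

lemma Good.trace_eq [Nonempty R] {M : Matrix (R × QSpace n) (R × QSpace n) ℂ} (hM : Good M) :
    M.trace = 1 := by
  rw [← trace_dep (fun _ => 0) M, hM.marginal, trace_smul, trace_one, smul_eq_mul,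
    Complex.ofReal_inv, Complex.ofReal_natCast, inv_mul_cancel₀]
  simp

lemma deficit_layer_le [Nonempty R] {M : Matrix (R × QSpace n) (R × QSpace n) ℂ} (hM : Good M)
    {l : ℝ} (h0 : 0 ≤ l) (h1 : l ≤ 1) {V : Matrix (QSpace n) (QSpace n) ℂ} (hV : V * Vᴴ = 1)
    (hV' : Vᴴ * V = 1) : deficit (layer l V M) ≤ l * deficit M := by
  rw [← deficit_conj hM.posSemidef.1 hV hV']
  exact deficit_dep_le (hM.conj hV') h0 h1

/-- The conjugate of a unitary by the spin flip. -/
def flip (V : Matrix (QSpace n) (QSpace n) ℂ) : Matrix (QSpace n) (QSpace n) ℂ :=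
  pauliString (fun _ => 2) * Vᴴᵀ * pauliString (fun _ => 2)

lemma flip_mul (V W : Matrix (QSpace n) (QSpace n) ℂ) : flip V * flip W = flip (V * W) := by
  unfold flip
  calc _ = pauliString (fun _ => 2) * Vᴴᵀ * (pauliString (fun _ => 2) * pauliString (fun _ => 2))
        * Wᴴᵀ * pauliString (fun _ => 2) := by simp only [mul_assoc]
    _ = _ := by
        rw [pauliString_sq, conjTranspose_mul, transpose_mul]
        simp only [mul_assoc, one_mul]

lemma flip_conjTranspose (V : Matrix (QSpace n) (QSpace n) ℂ) : (flip V)ᴴ = flip Vᴴ := by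
  unfold flip
  rw [conjTranspose_mul, conjTranspose_mul, pauliString_hermitian, mul_assoc]
  rfl

lemma flip_one : flip (1 : Matrix (QSpace n) (QSpace n) ℂ) = 1 := by
  unfold flip
  rw [conjTranspose_one, transpose_one, mul_one, pauliString_sq]

lemma kerT_neg_one_apply (a b c d : Fin 2) :
    kerT (-1) (a, b) (c, d) = pauli 2 a d * star (pauli 2 b c) := by
  fin_cases a <;> fin_cases b <;> fin_cases c <;> fin_cases d <;>
    simp [kerE, kerT, pauli, one_apply] <;> norm_num

lemma blk_dep_neg_one (M : Matrix (R × QSpace n) (R × QSpace n) ℂ) (r r' : R) :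
    blk (dep (fun _ => -1) M) r r'
      = pauliString (fun _ => 2) * (blk M r r')ᵀ * pauliString (fun _ => 2) := by
  ext x y
  rw [dep_eq]
  have e : ∀ z : Fin n → Fin 2 × Fin 2, ∏ i, kerT (-1) (x i, y i) (z i)
      = (∏ i, pauli 2 (x i) (z i).2) * ∏ i, star (pauli 2 (y i) (z i).1) := by
    intro z
    rw [← Finset.prod_mul_distrib]
    exact Finset.prod_congr rfl fun i _ => kerT_neg_one_apply _ _ _ _
  have e2 : ∀ u : QSpace n, pauliString (fun _ => 2) u y = ∏ i, star (pauli 2 (y i) (u i)) := by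
    intro u
    have := congrFun (congrFun (pauliString_hermitian (n := n) (fun _ => 2)) u) y
    rw [← this, conjTranspose_apply, pauliString, of_apply, star_prod]
  simp only [blk, prodSuper, of_apply, mul_apply, e, e2, transpose_apply, Finset.sum_mul]
  rw [← (Equiv.arrowProdEquivProdArrow (Fin n) (fun _ => Fin 2) (fun _ => Fin 2)).symm.sum_comp,
    Fintype.sum_prod_type]
  refine Finset.sum_congr rfl fun u _ => Finset.sum_congr rfl fun v _ => ?_
  simp only [Equiv.arrowProdEquivProdArrow, Equiv.coe_fn_symm_mk, pauliString, of_apply]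
  ring

omit [Fintype R] [DecidableEq R] in
lemma ext_blk {B : Type*} {M N : Matrix (R × B) (R × B) ℂ} (h : ∀ r r', blk M r r' = blk N r r') :
    M = N := by
  ext ⟨r, x⟩ ⟨r', y⟩
  exact congrFun (congrFun (h r r') x) y

lemma dep_neg_one_conj (V : Matrix (QSpace n) (QSpace n) ℂ)
    (M : Matrix (R × QSpace n) (R × QSpace n) ℂ) :
    dep (fun _ => -1) (lift V * M * (lift V)ᴴ)
      = lift (flip V) * dep (fun _ => -1) M * (lift (flip V))ᴴ := by
  refine ext_blk fun r r' => ?_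
  rw [blk_dep_neg_one, blk_lift_conj, blk_lift_conj, blk_dep_neg_one, flip_conjTranspose, flip, flip]
  have h := pauliString_sq (n := n) (fun _ => 2)
  generalize pauliString (n := n) (fun _ => 2) = K at h
  calc K * (V * blk M r r' * Vᴴ)ᵀ * K = K * Vᴴᵀ * 1 * (blk M r r')ᵀ * 1 * Vᵀ * K := by
        rw [transpose_mul, transpose_mul]
        simp only [mul_assoc, one_mul]
    _ = _ := by
        rw [← h, conjTranspose_conjTranspose]
        simp only [mul_assoc]

lemma layer_neg_layer_neg (l : ℝ) (U V : Matrix (QSpace n) (QSpace n) ℂ)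
    (M : Matrix (R × QSpace n) (R × QSpace n) ℂ) :
    layer (-l) V (layer (-l) U M) = layer l (flip V) (layer l U M) := by
  have h : ∀ N : Matrix (R × QSpace n) (R × QSpace n) ℂ,
      dep (fun _ => -l) N = dep (fun _ => l) (dep (fun _ => -1) N) := by
    intro N; rw [dep_dep]; simp
  rw [layer, h, dep_neg_one_conj, layer, dep_dep]
  simp only [neg_mul_neg, one_mul]
  rfl

theorem foldl_good [Nonempty R] {l : ℝ} (h0 : -(1 / 3) ≤ l) (h1 : l ≤ 1)
    (L : List (Matrix (QSpace n) (QSpace n) ℂ)) (hL : ∀ V ∈ L, Vᴴ * V = 1) :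
    ∀ M : Matrix (R × QSpace n) (R × QSpace n) ℂ, Good M →
      Good (L.foldl (fun σ V => layer l V σ) M) := by
  induction L with
  | nil => exact fun M hM => hM
  | cons V L ih =>
    intro M hM
    exact ih (fun W hW => hL W (List.mem_cons_of_mem _ hW)) _
      (hM.layer h0 h1 (hL V List.mem_cons_self))

theorem deficit_foldl_le [Nonempty R] {l : ℝ} (h0 : 0 ≤ l) (h1 : l ≤ 1)
    (L : List (Matrix (QSpace n) (QSpace n) ℂ)) (hL : ∀ V ∈ L, V * Vᴴ = 1 ∧ Vᴴ * V = 1) :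
    ∀ M : Matrix (R × QSpace n) (R × QSpace n) ℂ, Good M →
      deficit (L.foldl (fun σ V => layer l V σ) M) ≤ l ^ L.length * deficit M := by
  induction L with
  | nil => intro M _; simp
  | cons V L ih =>
    intro M hM
    have hV := hL V List.mem_cons_self
    refine (ih (fun W hW => hL W (List.mem_cons_of_mem _ hW)) _
      (hM.layer (by linarith) h1 hV.2)).trans ?_
    rw [List.length_cons, pow_succ, mul_assoc]
    exact mul_le_mul_of_nonneg_left (deficit_layer_le hM h0 h1 hV.1 hV.2) (pow_nonneg h0 _)

theorem deficit_foldl_neg_le [Nonempty R] {l : ℝ} (h0 : 0 ≤ l) (h1 : l ≤ 1 / 3) (m : ℕ) :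
    ∀ L : List (Matrix (QSpace n) (QSpace n) ℂ), (∀ V ∈ L, V * Vᴴ = 1 ∧ Vᴴ * V = 1) →
      L.length = 2 * m → ∀ M : Matrix (R × QSpace n) (R × QSpace n) ℂ, Good M →
      deficit (L.foldl (fun σ V => layer (-l) V σ) M) ≤ l ^ (2 * m) * deficit M := by
  induction m with
  | zero =>
    intro L _ hlen M _
    rw [List.length_eq_zero_iff.1 hlen]
    simp
  | succ m ih =>
    intro L hL hlen M hM
    match L, hL, hlen with
    | U :: V :: L, hL, hlen =>
      have hU := hL U (by simp)
      have hV := hL V (by simp)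
      have hF : flip V * (flip V)ᴴ = 1 := by
        rw [flip_conjTranspose, flip_mul, hV.1, flip_one]
      have hF' : (flip V)ᴴ * flip V = 1 := by
        rw [flip_conjTranspose, flip_mul, hV.2, flip_one]
      have hG := hM.layer (l := l) (by linarith) (by linarith) hU.2
      rw [List.foldl_cons, List.foldl_cons, layer_neg_layer_neg]
      refine (ih L (fun W hW => hL W (by simp [hW])) (by simp at hlen; omega) _
        (hG.layer (by linarith) (by linarith) hF')).trans ?_
      have h2 : l ^ (2 * (m + 1)) * deficit M = l ^ (2 * m) * (l * (l * deficit M)) := by ring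
      rw [h2]
      refine mul_le_mul_of_nonneg_left ?_ (pow_nonneg h0 _)
      refine (deficit_layer_le hG h0 (by linarith) hF hF').trans ?_
      exact mul_le_mul_of_nonneg_left
        (deficit_layer_le hM h0 (by linarith) hU.1 hU.2) h0

lemma trace_mul_dep (l : Fin n → ℝ) (A B : Matrix (R × QSpace n) (R × QSpace n) ℂ) :
    (dep l A * B).trace = (A * dep l B).trace := by
  simp only [dep, mix, Finset.sum_mul, Finset.mul_sum, trace_sum, Matrix.smul_mul,
    Matrix.mul_smul, trace_smul]
  refine Finset.sum_congr rfl fun s _ => ?_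
  congr 1
  rw [mul_assoc, mul_assoc, Matrix.trace_mul_comm, pl_hermitian]
  simp only [mul_assoc]

lemma wts_le {u : ℝ} (h0 : 0 ≤ u) (h1 : u ≤ 1) (s : Fin n → Fin 4) :
    wts (fun _ => u) s ≤ (1 + 3 * u) ^ n * wts (fun _ => 0) s := by
  have : (1 + 3 * u) ^ n = ∏ _i : Fin n, (1 + 3 * u) := by simp
  rw [wts, wts, this, ← Finset.prod_mul_distrib]
  refine Finset.prod_le_prod (fun i _ => wt_nonneg (by linarith) h1 _) fun i _ => ?_
  unfold wt
  split_ifs <;> linarith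

/-- A single layer of noise bounds the entropy deficit through the purity. -/
theorem deficit_dep_le_log [Nonempty R] {M : Matrix (R × QSpace n) (R × QSpace n) ℂ} (hM : Good M)
    {l : ℝ} (h0 : -(1 / 3) ≤ l) (h1 : l ≤ 1) :
    deficit (dep (fun _ => l) M) ≤ n * Real.log (1 + 3 * l ^ 2) := by
  have hN : (0 : ℝ) < Fintype.card (R × QSpace n) := by exact_mod_cast Fintype.card_pos
  have hG := hM.dep h0 h1
  have hu1 : l * l ≤ 1 := by nlinarith
  have hpur : (dep (fun _ => l) M * dep (fun _ => l) M).trace.re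
      ≤ (1 + 3 * l ^ 2) ^ n * (Fintype.card (R × QSpace n) : ℝ)⁻¹ := by
    rw [trace_mul_dep, dep_dep]
    have hz : (M * dep (fun _ => 0) M).trace.re = (Fintype.card (R × QSpace n) : ℝ)⁻¹ := by
      rw [hM.marginal, Matrix.mul_smul, mul_one, re_trace_smul, hM.trace_eq, Complex.one_re, mul_one]
    rw [← hz]
    simp only [dep, mix, Finset.mul_sum, trace_sum, Matrix.mul_smul, Complex.re_sum, re_trace_smul]
    refine Finset.sum_le_sum fun s _ => ?_
    have := mul_le_mul_of_nonneg_right (wts_le (mul_self_nonneg l) hu1 s)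
      (trace_mul_conj_nonneg hM.posSemidef (pl_unitary s) (pl_unitary' s))
    rw [mul_assoc ((1 + 3 * (l * l)) ^ n)] at this
    rwa [sq]
  have hpos := purity_pos hG.posSemidef hG.trace_eq
  have h2 := neg_log_purity_le_ent hG.posSemidef hG.trace_eq
  have h3 := Real.log_le_log hpos hpur
  rw [Real.log_mul (by positivity) (by positivity), Real.log_pow, Real.log_inv] at h3
  unfold deficit
  linarith

end Layers

section Circuit

variable {R : Type*} [Fintype R] [DecidableEq R] {n k : ℕ}

lemma blk_layer (p : ℝ) (V : Matrix (QSpace n) (QSpace n) ℂ)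
    (M : Matrix (R × QSpace n) (R × QSpace n) ℂ) (r r' : R) :
    blk (layer (1 - 4 * p / 3) V M) r r' = depolLayer p (V * blk M r r' * Vᴴ) := by
  rw [← blk_lift_conj V]
  ext x y
  simp only [depolLayer, ← blk_lift_conj]
  simp only [blk, layer, dep, mix, pl, of_apply, Matrix.sum_apply, Matrix.smul_apply,
    pauliWeight_eq, wts]

lemma blk_foldl (p : ℝ) (L : List (Matrix (QSpace n) (QSpace n) ℂ)) (r r' : R) :
    ∀ M : Matrix (R × QSpace n) (R × QSpace n) ℂ,
      blk (L.foldl (fun σ V => layer (1 - 4 * p / 3) V σ) M) r r'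
        = L.foldl (fun σ V => depolLayer p (V * σ * Vᴴ)) (blk M r r') := by
  induction L with
  | nil => exact fun M => rfl
  | cons V L ih =>
    intro M
    rw [List.foldl_cons, ih, blk_layer, List.foldl_cons]

/-- The maximally entangled state followed by the preparation of the ancillas. -/
def initialState (hk : k ≤ n) : Matrix (QSpace k × QSpace n) (QSpace k × QSpace n) ℂ :=
  Matrix.of fun a b => encode hk id (blk (maxEnt (QSpace k)) a.1 b.1) a.2 b.2

lemma idTensor_encode (hk : k ≤ n) (p : ℝ) {d : ℕ} (U : Fin d → Matrix (QSpace n) (QSpace n) ℂ) :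
    idTensor (R := QSpace k) (encode hk (noisyCircuit p U)) (maxEnt (QSpace k))
      = (List.ofFn U).foldl (fun σ V => layer (1 - 4 * p / 3) V σ) (initialState hk) := by
  refine ext_blk fun r r' => ?_
  rw [blk_foldl]
  rfl

/-- The unnormalized amplitudes of the initial state. -/
def amplitude (hk : k ≤ n) (a : QSpace k × QSpace n) : ℂ :=
  (∏ i : Fin n, if (i : ℕ) < k then (1 : ℂ) else if a.2 i = 0 then 1 else 0) *
    if a.1 = fun j => a.2 (Fin.castLE hk j) then 1 else 0

lemma star_amplitude (hk : k ≤ n) (a : QSpace k × QSpace n) :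
    star (amplitude hk a) = amplitude hk a := by
  simp only [amplitude, star_mul', star_prod, apply_ite star, star_one, star_zero]

lemma initialState_eq (hk : k ≤ n) : initialState hk
    = (((2 ^ k : ℝ)⁻¹ : ℝ) : ℂ) • vecMulVec (amplitude hk) (star (amplitude hk)) := by
  ext a b
  rw [Matrix.smul_apply, vecMulVec_apply, Pi.star_apply, star_amplitude]
  have h : ∀ i : Fin n, (if (i : ℕ) < k then (1 : ℂ) else if a.2 i = 0 ∧ b.2 i = 0 then 1 else 0)
      = (if (i : ℕ) < k then (1 : ℂ) else if a.2 i = 0 then 1 else 0)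
        * (if (i : ℕ) < k then (1 : ℂ) else if b.2 i = 0 then 1 else 0) := by
    intro i
    split_ifs <;> simp_all
  simp only [initialState, encode, id, of_apply, blk, maxEnt, amplitude, h,
    Finset.prod_mul_distrib, smul_eq_mul]
  by_cases h1 : a.1 = fun j => a.2 (Fin.castLE hk j) <;>
    by_cases h2 : b.1 = fun j => b.2 (Fin.castLE hk j) <;> simp [h1, h2]
  ring

/-- Padding a logical basis state by zeros. -/
def pad (n : ℕ) (r : QSpace k) : QSpace n := fun i => if h : (i : ℕ) < k then r ⟨i, h⟩ else 0

lemma amplitude_eq (hk : k ≤ n) (r : QSpace k) (x : QSpace n) :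
    amplitude hk (r, x) = if x = pad n r then 1 else 0 := by
  split_ifs with h
  · subst h
    rw [amplitude, if_pos, mul_one]
    · refine Finset.prod_eq_one fun i _ => ?_
      by_cases hi : (i : ℕ) < k <;> simp [pad, hi]
    · ext j
      simp [pad]
  · by_contra h0
    apply h
    have h1 := left_ne_zero_of_mul h0
    have h2 := right_ne_zero_of_mul h0
    have h3 : r = fun j => x (Fin.castLE hk j) := by
      by_contra h3
      exact h2 (if_neg h3)
    rw [Finset.prod_ne_zero_iff] at h1
    ext1 i
    by_cases hi : (i : ℕ) < k
    · simp [pad, hi, h3]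
    · have := h1 i (Finset.mem_univ i)
      rw [if_neg hi] at this
      simp only [pad, hi, dite_false]
      by_contra h4
      exact this (if_neg h4)

lemma pad_injective (hk : k ≤ n) : Function.Injective (pad (k := k) n) := by
  intro r r' h
  ext1 j
  have := congrFun h (Fin.castLE hk j)
  simpa [pad] using this

lemma card_qspace (n : ℕ) : Fintype.card (QSpace n) = 2 ^ n := by simp [QSpace]

lemma good_initialState (hk : k ≤ n) : Good (initialState hk) := by
  refine ⟨?_, ?_⟩
  · rw [initialState_eq]
    exact (posSemidef_vecMulVec_self_star _).smul (Complex.zero_le_real.2 (by positivity))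
  · ext ⟨r, x⟩ ⟨r', y⟩
    have ht : (blk (initialState hk) r r').trace
        = (if r = r' then 1 else 0) * (((2 ^ k : ℝ)⁻¹ : ℝ) : ℂ) := by
      simp only [Matrix.trace, diag_apply, blk, of_apply, initialState_eq, Matrix.smul_apply,
        vecMulVec_apply, Pi.star_apply, amplitude_eq, smul_eq_mul]
      simp [(pad_injective hk).eq_iff, eq_comm (a := r')]
    rw [dep_zero_apply, ht, Fintype.card_prod, card_qspace, card_qspace, Matrix.smul_apply,
      one_apply, smul_eq_mul]
    by_cases h1 : r = r' <;> by_cases h2 : x = y <;> simp [h1, h2, mul_comm]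

omit [DecidableEq R] in
lemma posSemidef_ptraceFirst {B : Type*} [Fintype B] {M : Matrix (R × B) (R × B) ℂ}
    (hM : M.PosSemidef) : (ptraceFirst M).PosSemidef := by
  have : ptraceFirst M = ∑ r, M.submatrix (fun b => (r, b)) (fun b => (r, b)) := by
    ext b b'
    simp [ptraceFirst, Matrix.sum_apply]
  rw [this]
  exact posSemidef_sum _ fun r _ => hM.submatrix _

omit [DecidableEq R] in
lemma trace_ptraceFirst {B : Type*} [Fintype B] (M : Matrix (R × B) (R × B) ℂ) :
    (ptraceFirst M).trace = M.trace := by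
  simp only [Matrix.trace, diag_apply, ptraceFirst, of_apply, Fintype.sum_prod_type]
  rw [Finset.sum_comm]

lemma log_card (k n : ℕ) :
    Real.log (Fintype.card (QSpace k × QSpace n)) = (n + k) * Real.log 2 := by
  rw [Fintype.card_prod, card_qspace, card_qspace, ← pow_add]
  push_cast
  rw [Real.log_pow]
  push_cast
  ring

lemma Good.deficit_le {M : Matrix (QSpace k × QSpace n) (QSpace k × QSpace n) ℂ} (hM : Good M) :
    deficit M ≤ (n + k) * Real.log 2 := by
  have := ent_nonneg hM.posSemidef hM.trace_eq
  rw [deficit, log_card]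
  linarith

end Circuit

section Numerics

lemma exp_odd_le (m : ℕ) : Real.exp (2 * m + 1) ≤ 1 + 12 / 5 * 9 ^ m := by
  have h := Real.exp_one_lt_d9
  have hp := Real.exp_pos 1
  have h2 : Real.exp 2 ≤ 7.4 := by
    have : Real.exp 2 = Real.exp 1 * Real.exp 1 := by rw [← Real.exp_add]; norm_num
    rw [this]; nlinarith
  rcases m with _ | m
  · norm_num at h ⊢; linarith
  · induction m with
    | zero =>
      have : Real.exp (2 * ((0 + 1 : ℕ) : ℝ) + 1) = Real.exp 2 * Real.exp 1 := by
        rw [← Real.exp_add]; norm_num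
      rw [this]
      nlinarith
    | succ m ih =>
      have : Real.exp (2 * ((m + 1 + 1 : ℕ) : ℝ) + 1)
          = Real.exp 2 * Real.exp (2 * ((m + 1 : ℕ) : ℝ) + 1) := by
        rw [← Real.exp_add]; congr 1; push_cast; ring
      rw [this]
      have h9 : (1 : ℝ) ≤ 9 ^ m := one_le_pow₀ (by norm_num)
      calc _ ≤ 7.4 * (1 + 12 / 5 * 9 ^ (m + 1) : ℝ) :=
            mul_le_mul h2 ih (Real.exp_pos _).le (by norm_num)
        _ ≤ _ := by rw [pow_succ 9 (m + 1), pow_succ 9 m]; linarith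

lemma log_four_thirds_le : Real.log (4 / 3) ≤ 5 / 12 * Real.log 2 := by
  have h : Real.log ((4 / 3) ^ 12) ≤ Real.log (2 ^ 5) :=
    Real.log_le_log (by norm_num) (by norm_num)
  rw [Real.log_pow, Real.log_pow] at h
  push_cast at h
  linarith

lemma exp_one_le_three : Real.exp 1 ≤ 3 := by
  have := Real.exp_one_lt_d9
  linarith

end Numerics

/-- The entropy deficit of the output of a deep circuit is small. -/
theorem deficit_foldl_lt {n k d : ℕ} {p : ℝ} (hk1 : 1 ≤ k) (hp0 : 0 < p) (hp1 : p < 1)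
    (hdeep : (n + k : ℝ) < k * Real.exp (p * d)) {L : List (Matrix (QSpace n) (QSpace n) ℂ)}
    (hL : ∀ V ∈ L, V * Vᴴ = 1 ∧ Vᴴ * V = 1) (hlen : L.length = d)
    {M : Matrix (QSpace k × QSpace n) (QSpace k × QSpace n) ℂ} (hM : Good M) :
    deficit (L.foldl (fun σ V => layer (1 - 4 * p / 3) V σ) M) < k * Real.log 2 := by
  have hk : (0 : ℝ) < k := by exact_mod_cast hk1
  have hlog : 0 < Real.log 2 := Real.log_pos one_lt_two
  have fin : ∀ l : ℝ, 0 ≤ l → l ≤ Real.exp (-p) → l ^ d * deficit M < k * Real.log 2 := by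
    intro l h0 h1
    calc l ^ d * deficit M ≤ Real.exp (-p) ^ d * ((n + k) * Real.log 2) :=
          mul_le_mul (pow_le_pow_left₀ h0 h1 d) hM.deficit_le ?_ (by positivity)
      _ = Real.exp (-p) ^ d * (n + k) * Real.log 2 := by ring
      _ < Real.exp (-p) ^ d * (k * Real.exp (p * d)) * Real.log 2 := by gcongr
      _ = k * Real.log 2 := by
          rw [← Real.exp_nat_mul, mul_left_comm, ← Real.exp_add]
          ring_nf
          simp
    have := ent_le_log_card hM.posSemidef hM.trace_eq
    rw [deficit]
    linarith
  rcases le_or_gt p (3 / 4) with hp | hp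
  · have h0 : 0 ≤ 1 - 4 * p / 3 := by linarith
    refine (deficit_foldl_le h0 (by linarith) L hL M hM).trans_lt ?_
    rw [hlen]
    refine fin _ h0 ?_
    have := Real.add_one_le_exp (-p)
    linarith
  · obtain ⟨l, hl⟩ : ∃ l, l = 4 * p / 3 - 1 := ⟨_, rfl⟩
    have h0 : 0 ≤ l := by linarith
    have h1 : l ≤ 1 / 3 := by linarith
    have hneg : 1 - 4 * p / 3 = -l := by linarith
    rw [hneg]
    rcases Nat.even_or_odd' d with ⟨m, hm | hm⟩
    · refine (deficit_foldl_neg_le h0 h1 m L hL (hlen.trans hm) M hM).trans_lt ?_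
      rw [← hm]
      refine fin l h0 (h1.trans ?_)
      calc (1 / 3 : ℝ) ≤ (Real.exp 1)⁻¹ := by
            rw [one_div]
            exact inv_anti₀ (Real.exp_pos 1) exp_one_le_three
        _ = Real.exp (-1) := (Real.exp_neg 1).symm
        _ ≤ Real.exp (-p) := Real.exp_le_exp.2 (by linarith)
    · match L, hL, hlen with
      | [], _, hlen => simp at hlen; omega
      | V :: L, hL, hlen =>
        have hV := hL V List.mem_cons_self
        rw [List.foldl_cons]
        have hG := hM.layer (l := -l) (by linarith) (by linarith) hV.2
        refine (deficit_foldl_neg_le h0 h1 m L (fun W hW => hL W (List.mem_cons_of_mem _ hW))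
          (by simp at hlen; omega) _ hG).trans_lt ?_
        have h2 : deficit (layer (-l) V M) ≤ n * (5 / 12 * Real.log 2) := by
          refine (deficit_dep_le_log (hM.conj hV.2) (by linarith) (by linarith)).trans ?_
          refine mul_le_mul_of_nonneg_left (le_trans ?_ log_four_thirds_le) (Nat.cast_nonneg n)
          exact Real.log_le_log (by positivity) (by nlinarith)
        have h3 : (n : ℝ) < k * (12 / 5 * 9 ^ m) := by
          have : Real.exp (p * d) ≤ 1 + 12 / 5 * 9 ^ m := by
            refine le_trans (Real.exp_le_exp.2 ?_) (exp_odd_le m)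
            rw [hm]
            push_cast
            have : (0 : ℝ) ≤ 2 * m + 1 := by positivity
            nlinarith
          nlinarith
        have h4 : l ^ (2 * m) ≤ ((9 : ℝ) ^ m)⁻¹ := by
          calc l ^ (2 * m) ≤ (1 / 3) ^ (2 * m) := pow_le_pow_left₀ h0 h1 _
            _ = _ := by rw [pow_mul, ← inv_pow]; norm_num
        calc _ ≤ l ^ (2 * m) * (n * (5 / 12 * Real.log 2)) :=
              mul_le_mul_of_nonneg_left h2 (pow_nonneg h0 _)
          _ ≤ ((9 : ℝ) ^ m)⁻¹ * (n * (5 / 12 * Real.log 2)) :=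
              mul_le_mul_of_nonneg_right h4 (by positivity)
          _ < ((9 : ℝ) ^ m)⁻¹ * (k * (12 / 5 * 9 ^ m) * (5 / 12 * Real.log 2)) := by gcongr
          _ = k * Real.log 2 := by field_simp

end NoisyCoherent

/-- With encoding rate `r = k/n`, if `d > p⁻¹ ln(1 + 1/r)`, then the coherent
information of the noisy encoding channel is strictly negative. -/
theorem coherent_info_neg_of_deep
    (n k d : ℕ) (p r : ℝ) (hk1 : 1 ≤ k) (hkn : k ≤ n) (hd : 1 ≤ d)
    (hp0 : 0 < p) (hp1 : p < 1)
    (hr : r = (k : ℝ) / n)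
    (hdeep : (d : ℝ) > p⁻¹ * Real.log (1 + 1 / r))
    (U : Fin d → Matrix (QSpace n) (QSpace n) ℂ)
    (hU : ∀ i, U i ∈ Matrix.unitaryGroup (QSpace n) ℂ) :
    cohInfo (encode hkn (noisyCircuit p U)) < 0 := by
  have hk : (0 : ℝ) < k := by exact_mod_cast hk1
  have hn : (0 : ℝ) < n := by exact_mod_cast hk1.trans hkn
  have hdeep' : (n + k : ℝ) < k * Real.exp (p * d) := by
    have h1 : Real.log (1 + 1 / r) < p * d := by
      rw [gt_iff_lt, inv_mul_lt_iff₀ hp0] at hdeep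
      exact hdeep
    have h2 : 1 + 1 / r = (n + k) / k := by
      rw [hr]
      field_simp
      ring
    rw [h2, Real.log_lt_iff_lt_exp (by positivity), div_lt_iff₀ hk] at h1
    linarith
  have hL : ∀ V ∈ List.ofFn U, V * Vᴴ = 1 ∧ Vᴴ * V = 1 := by
    intro V hV
    obtain ⟨i, rfl⟩ := (List.mem_ofFn' U V).1 hV
    exact ⟨Matrix.mem_unitaryGroup_iff.1 (hU i), Matrix.mem_unitaryGroup_iff'.1 (hU i)⟩
  have hM := NoisyCoherent.good_initialState hkn
  have hlt := NoisyCoherent.deficit_foldl_lt hk1 hp0 hp1 hdeep' hL (List.length_ofFn) hM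
  have hG := NoisyCoherent.foldl_good (l := 1 - 4 * p / 3) (by linarith) (by linarith)
    (List.ofFn U) (fun V hV => (hL V hV).2) _ hM
  rw [← NoisyCoherent.idTensor_encode] at hlt hG
  rw [NoisyCoherent.deficit, NoisyCoherent.log_card] at hlt
  have hB := NoisyCoherent.ent_le_log_card (NoisyCoherent.posSemidef_ptraceFirst hG.posSemidef)
    ((NoisyCoherent.trace_ptraceFirst _).trans hG.trace_eq)
  rw [NoisyCoherent.card_qspace] at hB
  push_cast at hB
  rw [Real.log_pow] at hB
  rw [cohInfo, NoisyCoherent.vN_eq_ent, NoisyCoherent.vN_eq_ent, ← sub_div]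
  exact div_neg_of_neg_of_pos (by linarith) (Real.log_pos one_lt_two)
end
end

section
/- Let n ≥ k ≥ 1, p ∈ (0,1), d ≥ 1, r = k/n, and let C̃ be any depth-d noisy circuit on n qubits with depolarizing noise of strength p, with encoding channel ℰ(ζ) = C̃(ζ ⊗ (|0⟩⟨0|)^{⊗(n−k)}). If the encoding rate satisfies r > (e^p − 1)^{−1}, then the coherent information satisfies I_c < 0 (in particular, already at depth d = 1 no noisy circuit with encoding rate exceeding (e^p − 1)^{−1} has nonnegative coherent information). -/
open Matrix

noncomputable section

open scoped ComplexOrder Kronecker MatrixOrder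

/-! ### Entropy bounds -/

theorem Matrix.IsHermitian.sum_eigenvalues_sq {ι : Type*} [Fintype ι] [DecidableEq ι]
    {ρ : Matrix ι ι ℂ} (h : ρ.IsHermitian) :
    ∑ i, h.eigenvalues i ^ 2 = (ρ * ρ).trace.re := by
  have key : ρ * ρ = Unitary.conjStarAlgAut ℂ _ h.eigenvectorUnitary
      (diagonal fun i => ((h.eigenvalues i ^ 2 : ℝ) : ℂ)) := by
    conv_lhs => rw [h.spectral_theorem, ← map_mul, diagonal_mul_diagonal]
    congr 2
    ext i
    simp [sq]
  rw [key, Unitary.conjStarAlgAut_apply, trace_mul_cycle, Unitary.coe_star_mul_self, one_mul,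
    trace_diagonal, ← Complex.ofReal_sum, Complex.ofReal_re]

theorem Matrix.IsHermitian.sum_eigenvalues_eq_one {ι : Type*} [Fintype ι] [DecidableEq ι]
    {ρ : Matrix ι ι ℂ} (h : ρ.IsHermitian) (htr : ρ.trace = 1) :
    ∑ i, h.eigenvalues i = 1 := by
  have := h.trace_eq_sum_eigenvalues
  rw [htr, ← RCLike.ofReal_sum] at this
  exact (Complex.ofReal_eq_one.mp this.symm)

theorem vN_eq {ι : Type*} [Fintype ι] [DecidableEq ι] {ρ : Matrix ι ι ℂ} (h : ρ.IsHermitian) :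
    vN ρ = -(∑ i, h.eigenvalues i * Real.log (h.eigenvalues i)) / Real.log 2 := by
  simp only [vN, h, dite_true, Real.logb]
  rw [neg_div, Finset.sum_div]
  simp only [mul_div_assoc]

/-- The entropy of a state is at most the logarithm of the dimension. -/
theorem vN_le_logb_card {ι : Type*} [Fintype ι] [DecidableEq ι] {ρ : Matrix ι ι ℂ}
    (hρ : ρ.PosSemidef) (htr : ρ.trace = 1) : vN ρ ≤ Real.logb 2 (Fintype.card ι) := by
  rw [vN_eq hρ.isHermitian, Real.logb]
  refine div_le_div_of_nonneg_right ?_ (Real.log_nonneg (by norm_num))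
  set l := hρ.isHermitian.eigenvalues
  have hsum : ∑ i, l i = 1 := hρ.isHermitian.sum_eigenvalues_eq_one htr
  have hne : Nonempty ι := by
    by_contra hcon
    rw [not_nonempty_iff] at hcon
    simp at hsum
  have hN : (0 : ℝ) < Fintype.card ι := by exact_mod_cast Fintype.card_pos
  have hterm : ∀ i, l i * (1 - Real.log (Fintype.card ι)) - (Fintype.card ι : ℝ)⁻¹
      ≤ l i * Real.log (l i) := by
    intro i
    rcases (hρ.eigenvalues_nonneg i).eq_or_lt with h0 | hpos
    · have h0' : l i = 0 := h0.symm
      rw [h0']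
      simp
    · change 0 < l i at hpos
      have h1 := Real.one_sub_inv_le_log_of_pos (mul_pos hpos hN)
      rw [Real.log_mul hpos.ne' hN.ne'] at h1
      have h2 := mul_le_mul_of_nonneg_left h1 hpos.le
      have h3 : l i * (1 - (l i * (Fintype.card ι : ℝ))⁻¹) = l i - (Fintype.card ι : ℝ)⁻¹ := by
        field_simp
      linarith
  have := Finset.sum_le_sum fun i (_ : i ∈ Finset.univ) => hterm i
  rw [Finset.sum_sub_distrib, ← Finset.sum_mul, hsum, Finset.sum_const, Finset.card_univ,
    nsmul_eq_mul, mul_inv_cancel₀ hN.ne'] at this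
  linarith

/-- The von Neumann entropy is at least the collision entropy. -/
theorem neg_logb_le_vN {ι : Type*} [Fintype ι] [DecidableEq ι] {ρ : Matrix ι ι ℂ}
    (hρ : ρ.PosSemidef) (htr : ρ.trace = 1) {q : ℝ} (hq : 0 < q)
    (hpur : (ρ * ρ).trace.re ≤ q) : -Real.logb 2 q ≤ vN ρ := by
  rw [vN_eq hρ.isHermitian, Real.logb, ← neg_div]
  refine div_le_div_of_nonneg_right (neg_le_neg ?_) (Real.log_nonneg (by norm_num))
  rw [← hρ.isHermitian.sum_eigenvalues_sq] at hpur
  set l := hρ.isHermitian.eigenvalues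
  have hsum : ∑ i, l i = 1 := hρ.isHermitian.sum_eigenvalues_eq_one htr
  have hterm : ∀ i, l i * Real.log (l i) ≤ l i * (Real.log q - 1) + l i ^ 2 / q := by
    intro i
    rcases (hρ.eigenvalues_nonneg i).eq_or_lt with h0 | hpos
    · have h0' : l i = 0 := h0.symm
      simp [h0']
    · change 0 < l i at hpos
      have h1 := Real.log_le_sub_one_of_pos (div_pos hpos hq)
      rw [Real.log_div hpos.ne' hq.ne'] at h1
      have h2 := mul_le_mul_of_nonneg_left h1 hpos.le
      have h3 : l i * (l i / q - 1) = l i ^ 2 / q - l i := by ring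
      linarith
  have := Finset.sum_le_sum fun i (_ : i ∈ Finset.univ) => hterm i
  rw [Finset.sum_add_distrib, ← Finset.sum_mul, hsum, ← Finset.sum_div] at this
  have h1 : (∑ i, l i ^ 2) / q ≤ 1 := (div_le_one hq).2 hpur
  linarith

theorem Matrix.PosSemidef.re_trace_mul_nonneg {ι : Type*} [Fintype ι] [DecidableEq ι]
    {M N : Matrix ι ι ℂ} (hM : M.PosSemidef) (hN : N.PosSemidef) : 0 ≤ (M * N).trace.re := by
  obtain ⟨C, rfl⟩ := CStarAlgebra.nonneg_iff_eq_star_mul_self.mp hM.nonneg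
  rw [star_eq_conjTranspose, Matrix.mul_assoc, trace_mul_comm]
  exact (Complex.nonneg_iff.mp (hN.mul_mul_conjTranspose_same C).trace_nonneg).1

/-! ### Pauli twirls on the second tensor factor -/

theorem one_kronecker_conj_apply {A B : Type*} [Fintype A] [DecidableEq A] [Fintype B]
    (V : Matrix B B ℂ) (M : Matrix (A × B) (A × B) ℂ) (r r' : A) (x y : B) :
    ((1 ⊗ₖ V) * M * (1 ⊗ₖ V)ᴴ : Matrix (A × B) (A × B) ℂ) (r, x) (r', y) =
      ∑ x', ∑ y', V x x' * star (V y y') * M (r, x') (r', y') := by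
  simp only [Matrix.mul_apply, Fintype.sum_prod_type, conjTranspose_apply, kroneckerMap_apply,
    Matrix.one_apply, ite_mul, one_mul, zero_mul, Finset.sum_mul, apply_ite star,
    star_zero, mul_ite, mul_zero, Finset.sum_ite_eq, Finset.mem_univ, if_true,
    Finset.sum_ite_irrel, Finset.sum_const_zero]
  rw [Finset.sum_comm]
  exact Finset.sum_congr rfl fun _ _ => Finset.sum_congr rfl fun _ _ => by ring

theorem idTensor_conj {A B : Type*} [Fintype A] [DecidableEq A] [Fintype B]
    (V : Matrix B B ℂ) (M : Matrix (A × B) (A × B) ℂ) :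
    idTensor (fun ρ => V * ρ * Vᴴ) M = (1 ⊗ₖ V) * M * (1 ⊗ₖ V)ᴴ := by
  ext ⟨r, x⟩ ⟨r', y⟩
  rw [one_kronecker_conj_apply]
  simp only [idTensor, of_apply, Matrix.mul_apply, conjTranspose_apply, Finset.sum_mul]
  rw [Finset.sum_comm]
  exact Finset.sum_congr rfl fun _ _ => Finset.sum_congr rfl fun _ _ => by ring

/-- The random Pauli channel on the second tensor factor with single-qubit weights `w`. -/
def pauliTwirl {A : Type*} [Fintype A] [DecidableEq A] {n : ℕ} (w : Fin 4 → ℝ)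
    (M : Matrix (A × QSpace n) (A × QSpace n) ℂ) : Matrix (A × QSpace n) (A × QSpace n) ℂ :=
  ∑ s : Fin n → Fin 4, ((∏ i, w (s i) : ℝ) : ℂ) •
    ((1 ⊗ₖ pauliString s) * M * (1 ⊗ₖ pauliString s)ᴴ)

theorem idTensor_depolLayer {A : Type*} [Fintype A] [DecidableEq A] {n : ℕ} (p : ℝ)
    (M : Matrix (A × QSpace n) (A × QSpace n) ℂ) :
    idTensor (depolLayer p) M = pauliTwirl (pauliWeight p) M := by
  ext ⟨r, x⟩ ⟨r', y⟩
  simp only [pauliTwirl, ← idTensor_conj, Matrix.sum_apply, Matrix.smul_apply]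
  simp only [idTensor, of_apply, depolLayer, Matrix.sum_apply, Matrix.smul_apply]

/-- Matrix entries of the single-qubit map `ρ ↦ ∑ₛ w s • Pₛ ρ Pₛ†`. -/
def pauliKernel (w : Fin 4 → ℝ) (a a' b b' : Fin 2) : ℂ :=
  ∑ s, (w s : ℂ) * (pauli s a a' * star (pauli s b b'))

theorem pauliTwirl_apply {A : Type*} [Fintype A] [DecidableEq A] {n : ℕ} (w : Fin 4 → ℝ)
    (M : Matrix (A × QSpace n) (A × QSpace n) ℂ) (r r' : A) (x y : QSpace n) :
    pauliTwirl w M (r, x) (r', y) =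
      ∑ x', ∑ y', (∏ i, pauliKernel w (x i) (x' i) (y i) (y' i)) * M (r, x') (r', y') := by
  simp only [pauliTwirl, Matrix.sum_apply, Matrix.smul_apply, one_kronecker_conj_apply,
    smul_eq_mul, Finset.mul_sum]
  rw [Finset.sum_comm]
  refine Finset.sum_congr rfl fun x' _ => ?_
  rw [Finset.sum_comm]
  refine Finset.sum_congr rfl fun y' _ => ?_
  simp only [pauliKernel, Finset.prod_univ_sum, Fintype.piFinset_univ, Finset.sum_mul]
  refine Finset.sum_congr rfl fun s _ => ?_
  simp only [pauliString, of_apply, star_prod, Finset.prod_mul_distrib, Complex.ofReal_prod]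
  ring

theorem pauliString_conjTranspose {n : ℕ} (s : Fin n → Fin 4) :
    (pauliString s)ᴴ = pauliString s := by
  have h : ∀ (t : Fin 4) (a b : Fin 2), star (pauli t b a) = pauli t a b := by
    intro t a b
    fin_cases t <;> fin_cases a <;> fin_cases b <;> simp [pauli]
  ext x y
  simp [pauliString, conjTranspose_apply, h]

theorem pauliString_mul_self {n : ℕ} (s : Fin n → Fin 4) :
    pauliString s * pauliString s = 1 := by
  have h : ∀ (t : Fin 4) (a b : Fin 2),
      ∑ c, pauli t a c * pauli t c b = if a = b then 1 else 0 := by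
    intro t a b
    fin_cases t <;> fin_cases a <;> fin_cases b <;> simp [pauli, Matrix.one_apply]
  ext x y
  simp only [pauliString, Matrix.mul_apply, of_apply, ← Finset.prod_mul_distrib]
  have hsum := Finset.prod_univ_sum (fun _ : Fin n => (Finset.univ : Finset (Fin 2)))
    (fun i c => pauli (s i) (x i) c * pauli (s i) c (y i))
  rw [Fintype.piFinset_univ] at hsum
  rw [← hsum]
  simp only [h, Matrix.one_apply, Finset.prod_ite_zero, Finset.prod_const_one, Finset.mem_univ,
    true_implies, funext_iff]

/-- The weights of two successive single-qubit depolarizing channels. -/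
def pauliWeightSq (p : ℝ) (s : Fin 4) : ℝ :=
  if s = 0 then (1 - p) ^ 2 + p ^ 2 / 3 else 2 * p * (1 - p) / 3 + 2 * p ^ 2 / 9

theorem pauliKernel_comp (p : ℝ) (a a'' b b'' : Fin 2) :
    ∑ a', ∑ b', pauliKernel (pauliWeight p) a a' b b' * pauliKernel (pauliWeight p) a' a'' b' b'' =
      pauliKernel (pauliWeightSq p) a a'' b b'' := by
  fin_cases a <;> fin_cases a'' <;> fin_cases b <;> fin_cases b'' <;>
    simp [pauliKernel, pauli, pauliWeight, pauliWeightSq, Fin.sum_univ_four] <;> ring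

theorem pauliKernel_one (a a' b b' : Fin 2) :
    pauliKernel 1 a a' b b' = if a = b ∧ a' = b' then 2 else 0 := by
  fin_cases a <;> fin_cases a' <;> fin_cases b <;> fin_cases b' <;>
    simp [pauliKernel, pauli, Fin.sum_univ_four] <;> norm_num

theorem pauliTwirl_pauliTwirl {A : Type*} [Fintype A] [DecidableEq A] {n : ℕ} (p : ℝ)
    (M : Matrix (A × QSpace n) (A × QSpace n) ℂ) :
    pauliTwirl (pauliWeight p) (pauliTwirl (pauliWeight p) M) = pauliTwirl (pauliWeightSq p) M := by
  ext ⟨r, x⟩ ⟨r', y⟩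
  simp only [pauliTwirl_apply, ← pauliKernel_comp, Finset.prod_univ_sum, Fintype.piFinset_univ,
    Finset.prod_mul_distrib, Finset.sum_mul, Finset.mul_sum]
  rw [Finset.sum_congr rfl fun _ _ => Finset.sum_comm, Finset.sum_comm]
  refine Finset.sum_congr rfl fun x'' _ => ?_
  rw [Finset.sum_congr rfl fun _ _ => Finset.sum_comm, Finset.sum_comm]
  exact Finset.sum_congr rfl fun y'' _ => Finset.sum_congr rfl fun _ _ =>
    Finset.sum_congr rfl fun _ _ => by ring

theorem pauliTwirl_one_apply {A : Type*} [Fintype A] [DecidableEq A] {n : ℕ}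
    (M : Matrix (A × QSpace n) (A × QSpace n) ℂ) (r r' : A) (x y : QSpace n) :
    pauliTwirl 1 M (r, x) (r', y) = if x = y then 2 ^ n * ∑ z, M (r, z) (r', z) else 0 := by
  have h : ∀ x' y' : QSpace n, ∏ i, pauliKernel 1 (x i) (x' i) (y i) (y' i) =
      if x = y ∧ x' = y' then 2 ^ n else 0 := by
    intro x' y'
    simp only [pauliKernel_one, Finset.prod_ite_zero, Finset.prod_const, Finset.card_univ,
      Fintype.card_fin, Finset.mem_univ, true_implies, forall_and, funext_iff]
  simp only [pauliTwirl_apply, h, ite_mul, zero_mul, ite_and]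
  split_ifs with hxy
  · simp [Finset.mul_sum]
  · simp

theorem trace_pauliTwirl_mul {A : Type*} [Fintype A] [DecidableEq A] {n : ℕ} (w : Fin 4 → ℝ)
    (M N : Matrix (A × QSpace n) (A × QSpace n) ℂ) :
    (pauliTwirl w M * N).trace = (M * pauliTwirl w N).trace := by
  simp only [pauliTwirl, Finset.sum_mul, Finset.mul_sum, trace_sum, Matrix.smul_mul, Matrix.mul_smul, trace_smul,
    conjTranspose_kronecker, pauliString_conjTranspose, conjTranspose_one]
  refine Finset.sum_congr rfl fun s _ => ?_
  rw [Matrix.mul_assoc, Matrix.mul_assoc, trace_mul_comm]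
  simp only [Matrix.mul_assoc]

theorem Matrix.PosSemidef.pauliTwirl {A : Type*} [Fintype A] [DecidableEq A] {n : ℕ}
    {w : Fin 4 → ℝ} (hw : ∀ s, 0 ≤ w s) {M : Matrix (A × QSpace n) (A × QSpace n) ℂ}
    (hM : M.PosSemidef) : (_root_.pauliTwirl w M).PosSemidef :=
  posSemidef_sum _ fun s _ => (hM.mul_mul_conjTranspose_same _).smul
    (by exact_mod_cast Finset.prod_nonneg fun i _ => hw (s i))

theorem pauliWeight_nonneg {p : ℝ} (hp0 : 0 ≤ p) (hp1 : p ≤ 1) (s : Fin 4) :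
    0 ≤ pauliWeight p s := by
  unfold pauliWeight
  split_ifs <;> linarith

theorem sum_pauliWeight (p : ℝ) : ∑ s, pauliWeight p s = 1 := by
  simp [pauliWeight, Fin.sum_univ_four]
  ring

theorem pauliWeightSq_mem {p : ℝ} (hp0 : 1 / 2 ≤ p) (hp1 : p ≤ 1) (s : Fin 4) :
    0 ≤ pauliWeightSq p s ∧ pauliWeightSq p s ≤ 1 / 3 := by
  unfold pauliWeightSq
  split_ifs <;> constructor <;> nlinarith [sq_nonneg (p - 1), sq_nonneg (4 * p - 3)]

/-- The purity after one depolarizing layer is controlled by the marginal on the first factor. -/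
theorem re_trace_pauliTwirl_sq_le {A : Type*} [Fintype A] [DecidableEq A] {n : ℕ} {p : ℝ}
    (hp0 : 1 / 2 ≤ p) (hp1 : p ≤ 1) {M : Matrix (A × QSpace n) (A × QSpace n) ℂ}
    (hM : M.PosSemidef) :
    (pauliTwirl (pauliWeight p) M * pauliTwirl (pauliWeight p) M).trace.re ≤
      (1 / 3) ^ n * (M * pauliTwirl 1 M).trace.re := by
  rw [trace_pauliTwirl_mul, pauliTwirl_pauliTwirl]
  simp only [pauliTwirl, Finset.mul_sum, trace_sum, Matrix.mul_smul, trace_smul, Complex.re_sum,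
    smul_eq_mul, Complex.re_ofReal_mul, Pi.one_apply, Finset.prod_const_one, one_mul]
  refine Finset.sum_le_sum fun s _ => mul_le_mul_of_nonneg_right ?_
    (hM.re_trace_mul_nonneg (hM.mul_mul_conjTranspose_same _))
  calc ∏ i, pauliWeightSq p (s i) ≤ ∏ _i : Fin n, (1 / 3 : ℝ) :=
        Finset.prod_le_prod (fun i _ => (pauliWeightSq_mem hp0 hp1 _).1)
          fun i _ => (pauliWeightSq_mem hp0 hp1 _).2
    _ = (1 / 3) ^ n := by simp

/-! ### States with maximally mixed reference -/

/-- A positive operator on `A ⊗ B` whose marginal on `A` is the maximally mixed state. -/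
structure HasMixedReference {A B : Type*} [Fintype A] [DecidableEq A] [Fintype B]
    (M : Matrix (A × B) (A × B) ℂ) : Prop where
  posSemidef : M.PosSemidef
  sum_apply : ∀ r r', ∑ z, M (r, z) (r', z) = if r = r' then (Fintype.card A : ℂ)⁻¹ else 0

theorem HasMixedReference.idTensor {A B : Type*} [Fintype A] [DecidableEq A] [Fintype B]
    {E : Matrix B B ℂ → Matrix B B ℂ}
    {M : Matrix (A × B) (A × B) ℂ} (hM : HasMixedReference M) (hE : ∀ ρ, (E ρ).trace = ρ.trace)
    (hpos : (_root_.idTensor E M).PosSemidef) : HasMixedReference (_root_.idTensor E M) :=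
  ⟨hpos, fun r r' =>
    (hE (Matrix.of fun b b' => M (r, b) (r', b'))).trans (hM.sum_apply r r')⟩

theorem HasMixedReference.trace_eq_one {A B : Type*} [Fintype A] [DecidableEq A] [Fintype B]
    [Nonempty A] {M : Matrix (A × B) (A × B) ℂ} (hM : HasMixedReference M) : M.trace = 1 := by
  simp only [trace, diag_apply, Fintype.sum_prod_type, hM.sum_apply]
  simp

theorem trace_ptraceFirst {A B : Type*} [Fintype A] [Fintype B] (M : Matrix (A × B) (A × B) ℂ) :
    (ptraceFirst M).trace = M.trace := by
  simp only [trace, diag_apply, Fintype.sum_prod_type, ptraceFirst, of_apply]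
  exact Finset.sum_comm

theorem Matrix.PosSemidef.ptraceFirst {A B : Type*} [Fintype A]
    {M : Matrix (A × B) (A × B) ℂ} (hM : M.PosSemidef) :
    (_root_.ptraceFirst M).PosSemidef := by
  have h : _root_.ptraceFirst M = ∑ r, M.submatrix (Prod.mk r) (Prod.mk r) := by
    ext b b'
    simp [_root_.ptraceFirst, Matrix.sum_apply]
  rw [h]
  exact posSemidef_sum _ fun r _ => hM.submatrix _

theorem trace_depolLayer {n : ℕ} (p : ℝ) (ρ : Matrix (QSpace n) (QSpace n) ℂ) :
    (depolLayer p ρ).trace = ρ.trace := by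
  have hw : ∑ s : Fin n → Fin 4, ((∏ i, pauliWeight p (s i) : ℝ) : ℂ) = 1 := by
    have h := Finset.prod_univ_sum (fun _ : Fin n => (Finset.univ : Finset (Fin 4)))
      fun _ s => pauliWeight p s
    rw [Fintype.piFinset_univ] at h
    rw [← Complex.ofReal_sum, ← h]
    simp [sum_pauliWeight]
  simp only [depolLayer, trace_sum, trace_smul, trace_mul_cycle, pauliString_conjTranspose,
    pauliString_mul_self, one_mul, ← Finset.sum_smul, hw, one_smul]

section

variable {A : Type*} [Fintype A] [DecidableEq A] {n : ℕ} {p : ℝ}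
  {M : Matrix (A × QSpace n) (A × QSpace n) ℂ}

theorem HasMixedReference.conj (hM : HasMixedReference M)
    {V : Matrix (QSpace n) (QSpace n) ℂ} (hV : V ∈ Matrix.unitaryGroup (QSpace n) ℂ) :
    HasMixedReference (_root_.idTensor (fun ρ => V * ρ * Vᴴ) M) := by
  refine hM.idTensor (fun ρ => ?_) ?_
  · rw [trace_mul_cycle, ← star_eq_conjTranspose, mem_unitaryGroup_iff'.1 hV, one_mul]
  · rw [idTensor_conj]
    exact hM.posSemidef.mul_mul_conjTranspose_same _

theorem HasMixedReference.depolLayer (hM : HasMixedReference M) (hp0 : 0 ≤ p) (hp1 : p ≤ 1) :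
    HasMixedReference (_root_.idTensor (_root_.depolLayer p) M) := by
  refine hM.idTensor (trace_depolLayer p) ?_
  rw [idTensor_depolLayer]
  exact hM.posSemidef.pauliTwirl (pauliWeight_nonneg hp0 hp1)

theorem HasMixedReference.foldl (hp0 : 0 ≤ p) (hp1 : p ≤ 1)
    (l : List (Matrix (QSpace n) (QSpace n) ℂ)) (hl : ∀ V ∈ l, V ∈ Matrix.unitaryGroup (QSpace n) ℂ)
    (hM : HasMixedReference M) :
    HasMixedReference (_root_.idTensor
      (fun ρ => l.foldl (fun σ V => _root_.depolLayer p (V * σ * Vᴴ)) ρ) M) := by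
  induction l generalizing M with
  | nil => exact hM
  | cons V l ih =>
    exact ih (fun W hW => hl W (List.mem_cons_of_mem _ hW))
      ((hM.conj (hl V List.mem_cons_self)).depolLayer hp0 hp1)

theorem HasMixedReference.trace_mul_pauliTwirl_one [Nonempty A] (hM : HasMixedReference M) :
    (M * pauliTwirl 1 M).trace = 2 ^ n * (Fintype.card A : ℂ)⁻¹ := by
  have h : ∀ r : A, ∑ x, (M * pauliTwirl 1 M) (r, x) (r, x) =
      2 ^ n * ((Fintype.card A : ℂ)⁻¹ * (Fintype.card A : ℂ)⁻¹) := by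
    intro r
    simp only [Matrix.mul_apply, Fintype.sum_prod_type, pauliTwirl_one_apply, hM.sum_apply,
      mul_ite, mul_zero, Finset.sum_ite_eq', Finset.mem_univ, if_true]
    rw [← Finset.sum_mul, hM.sum_apply, if_pos rfl]
    ring
  simp only [trace, diag_apply, Fintype.sum_prod_type, h, Finset.sum_const, Finset.card_univ,
    nsmul_eq_mul]
  field_simp

end

theorem hasMixedReference_encode_id {n k : ℕ} (hk : k ≤ n) :
    HasMixedReference (idTensor (encode hk id) (maxEnt (QSpace k))) := by
  set v : QSpace k × QSpace n → ℂ := fun z =>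
    if (∀ i : Fin n, ¬ (i : ℕ) < k → z.2 i = 0) ∧ z.1 = fun j => z.2 (Fin.castLE hk j)
    then 1 else 0 with hv
  have key : idTensor (encode hk id) (maxEnt (QSpace k)) =
      (Fintype.card (QSpace k) : ℂ)⁻¹ • vecMulVec v (star v) := by
    ext ⟨r, x⟩ ⟨r', y⟩
    have hprod : (∏ i : Fin n, if (i : ℕ) < k then (1 : ℂ) else
        (if x i = 0 ∧ y i = 0 then 1 else 0)) =
        if (∀ i : Fin n, ¬ (i : ℕ) < k → x i = 0) ∧ (∀ i : Fin n, ¬ (i : ℕ) < k → y i = 0)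
        then 1 else 0 := by
      have : ∀ i : Fin n, (if (i : ℕ) < k then (1 : ℂ) else (if x i = 0 ∧ y i = 0 then 1 else 0)) =
          if (¬ (i : ℕ) < k → x i = 0) ∧ (¬ (i : ℕ) < k → y i = 0) then 1 else 0 := by
        intro i
        by_cases hi : (i : ℕ) < k <;> simp [hi]
      simp only [this, Finset.prod_ite_zero, Finset.prod_const_one, Finset.mem_univ, true_implies,
        forall_and]
    simp only [idTensor, encode, id, maxEnt, of_apply, hprod, Matrix.smul_apply, vecMulVec_apply,
      hv, Pi.star_apply, smul_eq_mul]
    split_ifs <;> simp_all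
  refine ⟨?_, fun r r' => ?_⟩
  · rw [key]
    refine (posSemidef_vecMulVec_self_star v).smul ?_
    rw [inv_nonneg]
    exact Nat.cast_nonneg _
  · rw [key]
    set x₀ : QSpace n := fun i => if h : (i : ℕ) < k then r ⟨i, h⟩ else 0 with hx₀
    have hv₀ : ∀ x, v (r, x) = if x = x₀ then 1 else 0 := by
      intro x
      simp only [hv]
      refine if_congr ⟨fun ⟨h1, h2⟩ => ?_, fun h => ?_⟩ rfl rfl
      · funext i
        by_cases hi : (i : ℕ) < k
        · simp [hx₀, hi, h2]
        · simp [hx₀, hi, h1 i hi]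
      · subst h
        refine ⟨fun i hi => by simp [hx₀, hi], ?_⟩
        funext j
        simp [hx₀]
    have hv₁ : v (r', x₀) = if r = r' then 1 else 0 := by
      simp only [hv]
      refine if_congr ⟨fun ⟨_, h2⟩ => ?_, fun h => ⟨fun i hi => by simp [hx₀, hi], ?_⟩⟩ rfl rfl
      · rw [h2]
        funext j
        simp [hx₀]
      · rw [← h]
        funext j
        simp [hx₀]
    simp only [Matrix.smul_apply, vecMulVec_apply, hv₀, Pi.star_apply, ite_mul, one_mul, zero_mul,
      smul_eq_mul, mul_ite, mul_zero, Finset.sum_ite_eq', Finset.mem_univ, if_true, hv₁]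
    split_ifs <;> simp

/-- One depolarizing layer of strength at least `1/2` makes the conditional entropy positive as soon
as the reference is large enough. -/
theorem vN_ptraceFirst_lt_vN {n k : ℕ} {p : ℝ} (hp0 : 1 / 2 ≤ p) (hp1 : p ≤ 1)
    (hnk : (4 / 3 : ℝ) ^ n < 2 ^ k) {M : Matrix (QSpace k × QSpace n) (QSpace k × QSpace n) ℂ}
    (hM : HasMixedReference M) :
    vN (ptraceFirst (idTensor (depolLayer p) M)) < vN (idTensor (depolLayer p) M) := by
  have hN := hM.depolLayer (by linarith : 0 ≤ p) hp1
  have hpur : (idTensor (depolLayer p) M * idTensor (depolLayer p) M).trace.re ≤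
      (1 / 3) ^ n * (2 ^ n * (2 ^ k)⁻¹) := by
    rw [idTensor_depolLayer]
    refine (re_trace_pauliTwirl_sq_le hp0 hp1 hM.posSemidef).trans_eq ?_
    have hcast : (2 ^ n * (Fintype.card (QSpace k) : ℂ)⁻¹) =
        ((2 ^ n * (2 ^ k)⁻¹ : ℝ) : ℂ) := by simp
    rw [hM.trace_mul_pauliTwirl_one, hcast, Complex.ofReal_re]
  have hlow := neg_logb_le_vN hN.posSemidef hN.trace_eq_one (by positivity) hpur
  have hup := vN_le_logb_card hN.posSemidef.ptraceFirst
    ((trace_ptraceFirst _).trans hN.trace_eq_one)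
  refine hup.trans_lt (lt_of_lt_of_le ?_ hlow)
  rw [← Real.logb_inv]
  refine Real.logb_lt_logb (by norm_num) (by simp) ?_
  rw [lt_inv_comm₀ (by simp) (by positivity)]
  have hcard : (Fintype.card (QSpace n) : ℝ) = 2 ^ n := by simp
  rw [hcard, ← mul_assoc, ← div_eq_mul_inv, div_lt_iff₀ (by positivity), inv_mul_eq_div,
    lt_div_iff₀ (by positivity)]
  calc (1 / 3 : ℝ) ^ n * 2 ^ n * 2 ^ n = (4 / 3) ^ n := by
        rw [← mul_pow, ← mul_pow]; norm_num
    _ < 2 ^ k := hnk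

theorem half_lt_of_two_lt_exp {p : ℝ} (h : 2 < Real.exp p) : 1 / 2 < p := by
  by_contra! hp
  have h1 : Real.exp p ≤ Real.exp (1 / 2) := Real.exp_le_exp.2 hp
  have h2 : Real.exp (1 / 2) * Real.exp (1 / 2) = Real.exp 1 := by
    rw [← Real.exp_add]; norm_num
  nlinarith [Real.exp_one_lt_three]

/-- With encoding rate `r = k/n`, if `r > (e^p − 1)⁻¹`, then (for any depth
`d ≥ 1`) the coherent information of the noisy encoding channel is strictly negative. -/
theorem coherent_info_neg_of_high_rate
    (n k d : ℕ) (p r : ℝ) (hk1 : 1 ≤ k) (hkn : k ≤ n) (hd : 1 ≤ d)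
    (hp0 : 0 < p) (hp1 : p < 1)
    (hr : r = (k : ℝ) / n)
    (hrate : r > (Real.exp p - 1)⁻¹)
    (U : Fin d → Matrix (QSpace n) (QSpace n) ℂ)
    (hU : ∀ i, U i ∈ Matrix.unitaryGroup (QSpace n) ℂ) :
    cohInfo (encode hkn (noisyCircuit p U)) < 0 := by
  have hk0 : (0 : ℝ) < k := by exact_mod_cast hk1
  have hknR : (k : ℝ) ≤ n := by exact_mod_cast hkn
  have hn0 : (0 : ℝ) < n := hk0.trans_le hknR
  have hexp : 0 < Real.exp p - 1 := by linarith [Real.add_one_lt_exp hp0.ne']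
  have hlt : (n : ℝ) < k * (Real.exp p - 1) := by
    rw [hr, gt_iff_lt, inv_eq_one_div, div_lt_div_iff₀ hexp hn0, one_mul] at hrate
    exact hrate
  have hp : 1 / 2 < p := half_lt_of_two_lt_exp (by nlinarith)
  have hexp3 : Real.exp p < 3 :=
    (Real.exp_lt_exp.2 hp1).trans Real.exp_one_lt_three
  have hn2k : n ≤ 2 * k := by
    have h : (n : ℝ) ≤ 2 * k := by nlinarith
    exact_mod_cast h
  have hnk : (4 / 3 : ℝ) ^ n < 2 ^ k :=
    calc (4 / 3 : ℝ) ^ n ≤ (4 / 3) ^ (2 * k) := pow_le_pow_right₀ (by norm_num) hn2k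
      _ = (16 / 9) ^ k := by rw [pow_mul]; norm_num
      _ < 2 ^ k := pow_lt_pow_left₀ (by norm_num) (by norm_num) (by omega)
  obtain ⟨m, rfl⟩ : ∃ m, d = m + 1 := ⟨d - 1, by omega⟩
  have hsplit : idTensor (encode hkn (noisyCircuit p U)) (maxEnt (QSpace k)) =
      idTensor (depolLayer p) (idTensor (fun ρ => U (Fin.last m) * ρ * (U (Fin.last m))ᴴ)
        (idTensor (noisyCircuit p fun i => U i.castSucc)
          (idTensor (encode hkn id) (maxEnt (QSpace k))))) := by
    ext x y
    simp only [idTensor, of_apply, encode, noisyCircuit, List.ofFn_succ', List.concat_eq_append,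
      List.foldl_append, List.foldl_cons, List.foldl_nil]
    rfl
  rw [cohInfo, sub_neg, hsplit]
  refine vN_ptraceFirst_lt_vN hp.le hp1.le hnk (HasMixedReference.conj ?_ (hU _))
  refine HasMixedReference.foldl hp0.le hp1.le _ (fun V hV => ?_) (hasMixedReference_encode_id hkn)
  obtain ⟨i, rfl⟩ := (List.mem_ofFn' _ _).1 hV
  exact hU _
end
end

section
/- Let ℰ be a quantum channel from states on ℂ^{2^k} to states on ℂ^{m}. If the coherent information on the maximally mixed input satisfies I_c = k, then there exists a quantum channel 𝒟 from states on ℂ^{m} to states on ℂ^{2^k} such that 𝒟(ℰ(|ψ⟩⟨ψ|)) = |ψ⟩⟨ψ| for every unit vector |ψ⟩ ∈ ℂ^{2^k}. -/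
open Matrix

noncomputable section

/-- A quantum channel: a map admitting a Kraus representation `{K_j}` with `∑ⱼ Kⱼ†Kⱼ = I`
and `Φ(M) = ∑ⱼ Kⱼ M Kⱼ†`. -/
def IsQChannel {A B : Type*} [Fintype A] [DecidableEq A] [Fintype B]
    (Φ : Matrix A A ℂ → Matrix B B ℂ) : Prop :=
  ∃ (s : ℕ) (K : Fin s → Matrix B A ℂ),
    (∑ j, (K j)ᴴ * K j) = 1 ∧ ∀ M, Φ M = ∑ j, K j * M * (K j)ᴴ

/-- The rank-one projector `|ψ⟩⟨ψ|`. -/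
def outer {A : Type*} (ψ : A → ℂ) : Matrix A A ℂ := Matrix.vecMulVec ψ (star ψ)

theorem vN_of_isHermitian {ι : Type*} [Fintype ι] [DecidableEq ι] {ρ : Matrix ι ι ℂ}
    (h : ρ.IsHermitian) :
    vN ρ = -∑ i, h.eigenvalues i * Real.logb 2 (h.eigenvalues i) :=
  dif_pos h

/-- The spectral decomposition of a Hermitian matrix, entrywise. -/
theorem Matrix.IsHermitian.apply_eq_sum_eigenvalues {ι : Type*} [Fintype ι] [DecidableEq ι]
    {ρ : Matrix ι ι ℂ} (h : ρ.IsHermitian) (x y : ι) :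
    ρ x y = ∑ a, (h.eigenvectorUnitary : Matrix ι ι ℂ) x a * (h.eigenvalues a : ℂ) *
      star ((h.eigenvectorUnitary : Matrix ι ι ℂ) y a) := by
  conv_lhs => rw [h.spectral_theorem, Unitary.conjStarAlgAut_apply, Matrix.mul_apply]
  refine Finset.sum_congr rfl fun a _ => ?_
  rw [Matrix.mul_diagonal]
  rfl

/-- The sum of a function vanishing at zero over the spectrum of a Hermitian matrix is the
corresponding sum over the roots of its characteristic polynomial. -/
theorem Matrix.IsHermitian.sum_eigenvalues_eq {ι : Type*} [Fintype ι] [DecidableEq ι]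
    {ρ : Matrix ι ι ℂ} (h : ρ.IsHermitian) (f : ℝ → ℝ) :
    ∑ i, f (h.eigenvalues i) = (ρ.charpoly.roots.map fun z => f z.re).sum := by
  rw [h.roots_charpoly_eq_eigenvalues, Multiset.map_map]
  rfl

theorem vN_mul_conjTranspose_self {m n : Type*} [Fintype m] [Fintype n] [DecidableEq m]
    [DecidableEq n] (W : Matrix m n ℂ) : vN (W * Wᴴ) = vN (Wᴴ * W) := by
  have h₁ := isHermitian_mul_conjTranspose_self W
  have h₂ := isHermitian_conjTranspose_mul_self W
  rw [vN_of_isHermitian h₁, vN_of_isHermitian h₂,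
    h₁.sum_eigenvalues_eq fun t => t * Real.logb 2 t,
    h₂.sum_eigenvalues_eq fun t => t * Real.logb 2 t]
  have key := congrArg Polynomial.roots (charpoly_mul_comm' W Wᴴ)
  rw [Polynomial.roots_mul, Polynomial.roots_mul] at key
  · have key' := congrArg (fun s : Multiset ℂ =>
      (s.map fun z => z.re * Real.logb 2 z.re).sum) key
    simpa [Multiset.map_nsmul, Multiset.sum_nsmul] using key'
  · exact mul_ne_zero (pow_ne_zero _ Polynomial.X_ne_zero) (charpoly_monic _).ne_zero
  · exact mul_ne_zero (pow_ne_zero _ Polynomial.X_ne_zero) (charpoly_monic _).ne_zero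

theorem mul_log_div_le {l q : ℝ} (hl : 0 ≤ l) (hq : 0 ≤ q) (h : q = 0 → l = 0) :
    l * (Real.log q - Real.log l) ≤ q - l := by
  rcases hl.eq_or_lt with rfl | hl
  · simpa using hq
  have hq : 0 < q := hq.lt_of_ne' fun h' => hl.ne' (h h')
  rw [← Real.log_div hq.ne' hl.ne']
  calc l * Real.log (q / l) ≤ l * (q / l - 1) := by
        gcongr
        exact Real.log_le_sub_one_of_pos (by positivity)
    _ = q - l := by field_simp

theorem eq_of_mul_log_div_eq {l q : ℝ} (hl : 0 ≤ l) (hq : 0 ≤ q) (h : q = 0 → l = 0)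
    (he : l * (Real.log q - Real.log l) = q - l) : q = l := by
  rcases hl.eq_or_lt with rfl | hl
  · simpa [eq_comm] using he
  have hq : 0 < q := hq.lt_of_ne' fun h' => hl.ne' (h h')
  by_contra hne
  rw [← Real.log_div hq.ne' hl.ne'] at he
  have h1 : Real.log (q / l) < q / l - 1 :=
    Real.log_lt_sub_one_of_pos (by positivity) (by rwa [Ne, div_eq_one_iff_eq hl.ne'])
  have h2 : l * Real.log (q / l) < l * (q / l - 1) := by gcongr
  have h3 : l * (q / l - 1) = q - l := by field_simp
  linarith

open scoped ComplexOrder in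
/-- The equality case of Klein's inequality `S(σ) ≤ -Tr[σ log₂ τ]` for a diagonal matrix `τ`
with the same trace as `σ`. -/
theorem eq_diagonal_of_vN_eq {ι : Type*} [Fintype ι] [DecidableEq ι] {σ : Matrix ι ι ℂ}
    (hσ : σ.PosSemidef) {q : ι → ℝ} (hq : ∀ x, 0 ≤ q x) (hzero : ∀ x, q x = 0 → (σ x x).re = 0)
    (hsum : ∑ x, q x = ∑ x, (σ x x).re)
    (h : vN σ = -∑ x, (σ x x).re * Real.logb 2 (q x)) :
    σ = diagonal fun x => (q x : ℂ) := by
  set l := hσ.1.eigenvalues with hl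
  have hl0 : ∀ a, 0 ≤ l a := hσ.eigenvalues_nonneg
  set U : Matrix ι ι ℂ := hσ.1.eigenvectorUnitary.1 with hU
  have hUU : U * Uᴴ = 1 := Unitary.coe_mul_star_self hσ.1.eigenvectorUnitary
  have hUU' : Uᴴ * U = 1 := Unitary.coe_star_mul_self hσ.1.eigenvectorUnitary
  have hdec : ∀ x y, σ x y = ∑ a, U x a * (l a : ℂ) * star (U y a) :=
    hσ.1.apply_eq_sum_eigenvalues
  have hw : ∀ x a, U x a * star (U x a) = (Complex.normSq (U x a) : ℂ) := fun x a =>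
    Complex.mul_conj _
  have hrow : ∀ x, ∑ a, Complex.normSq (U x a) = 1 := fun x => by
    have := congrFun (congrFun hUU x) x
    simp only [mul_apply, conjTranspose_apply, hw, one_apply_eq] at this
    exact_mod_cast this
  have hcol : ∀ a, ∑ x, Complex.normSq (U x a) = 1 := fun a => by
    have := congrFun (congrFun hUU' a) a
    simp only [mul_apply, conjTranspose_apply, mul_comm (star _), hw, one_apply_eq] at this
    exact_mod_cast this
  have hdiag : ∀ x, (σ x x).re = ∑ a, Complex.normSq (U x a) * l a := fun x => by
    have : σ x x = ((∑ a, Complex.normSq (U x a) * l a : ℝ) : ℂ) := by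
      rw [hdec]
      push_cast
      exact Finset.sum_congr rfl fun a _ => by rw [← hw]; ring
    rw [this, Complex.ofReal_re]
  have hsupp : ∀ x a, Complex.normSq (U x a) ≠ 0 → q x = 0 → l a = 0 := fun x a hx hqx => by
    have h0 := hzero x hqx
    rw [hdiag, Finset.sum_eq_zero_iff_of_nonneg fun b _ =>
      mul_nonneg (Complex.normSq_nonneg _) (hl0 b)] at h0
    exact (mul_eq_zero.1 (h0 a (Finset.mem_univ a))).resolve_left hx
  have hlog : ∑ x, ∑ a, Complex.normSq (U x a) * (l a * (Real.log (q x) - Real.log (l a))) = 0 := by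
    rw [vN_of_isHermitian hσ.1, neg_inj] at h
    simp only [Real.logb, ← mul_div_assoc, ← Finset.sum_div] at h
    rw [div_left_inj' (Real.log_pos one_lt_two).ne'] at h
    simp only [mul_sub, Finset.sum_sub_distrib]
    rw [sub_eq_zero, Finset.sum_comm (f := fun x a => Complex.normSq (U x a) *
      (l a * Real.log (l a)))]
    simp only [← Finset.sum_mul, hcol, one_mul]
    rw [← hl] at h
    rw [h]
    exact Finset.sum_congr rfl fun x _ => by simp only [hdiag, Finset.sum_mul, mul_assoc]
  have hlin : ∑ x, ∑ a, Complex.normSq (U x a) * (q x - l a) = 0 := by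
    simp only [mul_sub, Finset.sum_sub_distrib, ← Finset.sum_mul, hrow, one_mul]
    rw [hsum, sub_eq_zero]
    exact Finset.sum_congr rfl fun x _ => hdiag x
  have hterm : ∀ x a, 0 ≤ Complex.normSq (U x a) *
      ((q x - l a) - l a * (Real.log (q x) - Real.log (l a))) := fun x a => by
    by_cases hx : Complex.normSq (U x a) = 0
    · simp [hx]
    · exact mul_nonneg (Complex.normSq_nonneg _)
        (sub_nonneg.2 (mul_log_div_le (hl0 a) (hq x) (hsupp x a hx)))
  have htot : ∑ x, ∑ a, Complex.normSq (U x a) *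
      ((q x - l a) - l a * (Real.log (q x) - Real.log (l a))) = 0 := by
    simp only [mul_sub (Complex.normSq _) (_ - _) (_ * _), Finset.sum_sub_distrib]
    rw [hlog, hlin, sub_zero]
  have heq : ∀ x a, U x a * (l a : ℂ) = q x * U x a := fun x a => by
    rw [Finset.sum_eq_zero_iff_of_nonneg fun x _ => Finset.sum_nonneg fun a _ => hterm x a] at htot
    have h1 := htot x (Finset.mem_univ x)
    rw [Finset.sum_eq_zero_iff_of_nonneg fun a _ => hterm x a] at h1
    rcases mul_eq_zero.1 (h1 a (Finset.mem_univ a)) with h2 | h2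
    · simp [Complex.normSq_eq_zero.1 h2]
    · by_cases hx : Complex.normSq (U x a) = 0
      · simp [Complex.normSq_eq_zero.1 hx]
      · rw [eq_of_mul_log_div_eq (hl0 a) (hq x) (hsupp x a hx) (sub_eq_zero.1 h2).symm, mul_comm]
  ext x y
  rw [hdec]
  simp only [heq, mul_assoc, ← Finset.mul_sum]
  have := congrFun (congrFun hUU x) y
  rw [mul_apply] at this
  simp only [conjTranspose_apply] at this
  rw [this, diagonal_apply, one_apply]
  split_ifs <;> simp

theorem isQChannel_of_kraus {ι A B : Type*} [Fintype ι] [Fintype A] [DecidableEq A] [Fintype B]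
    (K : ι → Matrix B A ℂ) (hK : ∑ i, (K i)ᴴ * K i = 1) :
    IsQChannel fun M : Matrix A A ℂ => ∑ i, K i * M * (K i)ᴴ := by
  refine ⟨Fintype.card ι, K ∘ (Fintype.equivFin ι).symm, ?_, fun M => ?_⟩
  · rw [← hK]
    exact (Fintype.equivFin ι).symm.sum_comp fun i => (K i)ᴴ * K i
  · exact ((Fintype.equivFin ι).symm.sum_comp fun i => K i * M * (K i)ᴴ).symm

theorem sum_kraus_apply {ι A B : Type*} [Fintype ι] [Fintype A] (K : ι → Matrix B A ℂ)
    (M : Matrix A A ℂ) (b b' : B) :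
    (∑ i, K i * M * (K i)ᴴ) b b' =
      ∑ a', ∑ a, M a a' * ∑ i, K i b a * star (K i b' a') := by
  simp only [Matrix.sum_apply, mul_apply, conjTranspose_apply, Finset.sum_mul, Finset.mul_sum]
  rw [Finset.sum_comm]
  refine Finset.sum_congr rfl fun a' _ => ?_
  rw [Finset.sum_comm]
  exact Finset.sum_congr rfl fun a _ => Finset.sum_congr rfl fun i _ => by ring

/-- The Choi state of a map given by Kraus operators. -/
theorem idTensor_maxEnt_apply {ι A B : Type*} [Fintype ι] [Fintype A] [DecidableEq A]
    (K : ι → Matrix B A ℂ) (x y : A × B) :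
    idTensor (R := A) (fun M : Matrix A A ℂ => ∑ i, K i * M * (K i)ᴴ) (maxEnt A) x y =
      (Fintype.card A : ℂ)⁻¹ * ∑ i, K i x.2 x.1 * star (K i y.2 y.1) := by
  simp only [idTensor, of_apply, sum_kraus_apply, maxEnt, ite_and, ite_mul, zero_mul,
    Finset.sum_ite_eq, Finset.mem_univ, if_true]

theorem inv_natCast_eq_inv_sqrt_mul_self (n : ℕ) :
    (n : ℂ)⁻¹ = (((√n)⁻¹ : ℝ) : ℂ) * (((√n)⁻¹ : ℝ) : ℂ) := by
  rw [← Complex.ofReal_mul, ← mul_inv, Real.mul_self_sqrt (Nat.cast_nonneg _)]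
  simp

open scoped ComplexOrder in
/-- Kraus operators whose Choi vectors are eigenvectors of the Choi state. -/
theorem IsQChannel.exists_spectral_kraus {A B : Type*} [Fintype A] [DecidableEq A] [Nonempty A]
    [Fintype B] [DecidableEq B] {E : Matrix A A ℂ → Matrix B B ℂ} (hE : IsQChannel E) :
    ∃ (p : A × B → ℝ) (K : A × B → Matrix B A ℂ), (∀ i, 0 ≤ p i) ∧ ∑ i, p i = 1 ∧
      vN (idTensor (R := A) E (maxEnt A)) = -∑ i, p i * Real.logb 2 (p i) ∧
      (∀ i, ((K i)ᴴ * K i).trace = Fintype.card A * p i) ∧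
      E = fun M : Matrix A A ℂ => ∑ i, K i * M * (K i)ᴴ := by
  obtain ⟨s, L, hL, hEL⟩ := hE
  obtain rfl : E = fun M : Matrix A A ℂ => ∑ j, L j * M * (L j)ᴴ := funext hEL
  set ρ := idTensor (R := A) (fun M : Matrix A A ℂ => ∑ j, L j * M * (L j)ᴴ) (maxEnt A) with hρ
  have hd : (Fintype.card A : ℂ) ≠ 0 := Nat.cast_ne_zero.2 Fintype.card_ne_zero
  have hρG : ρ = (of fun (x : A × B) j => ((√(Fintype.card A))⁻¹ : ℝ) * L j x.2 x.1) *
      (of fun (x : A × B) j => ((√(Fintype.card A))⁻¹ : ℝ) * L j x.2 x.1)ᴴ := by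
    ext x y
    rw [hρ, idTensor_maxEnt_apply, mul_apply, Finset.mul_sum]
    refine Finset.sum_congr rfl fun j _ => ?_
    simp only [conjTranspose_apply, of_apply, star_mul', inv_natCast_eq_inv_sqrt_mul_self]
    rw [Complex.star_def, Complex.conj_ofReal]
    ring
  have hpos : ρ.PosSemidef := hρG ▸ posSemidef_self_mul_conjTranspose _
  have htr : ρ.trace = 1 := by
    have h1 : ∑ j, ((L j)ᴴ * L j).trace = Fintype.card A := by
      rw [← trace_sum, hL, trace_one]
    rw [trace]
    simp only [diag_apply, hρ, idTensor_maxEnt_apply]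
    rw [← Finset.mul_sum, inv_mul_eq_one₀ hd, ← h1, Finset.sum_comm]
    refine Finset.sum_congr rfl fun j _ => ?_
    simp only [trace, diag_apply, mul_apply, conjTranspose_apply, Fintype.sum_prod_type]
    exact Finset.sum_congr rfl fun a _ => Finset.sum_congr rfl fun b _ => mul_comm _ _
  have hsq : ∀ i, ((√(Fintype.card A * hpos.1.eigenvalues i) : ℝ) : ℂ) *
      (√(Fintype.card A * hpos.1.eigenvalues i) : ℝ) =
        Fintype.card A * hpos.1.eigenvalues i := fun i => by
    rw [← Complex.ofReal_mul, Real.mul_self_sqrt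
      (mul_nonneg (Nat.cast_nonneg _) (hpos.eigenvalues_nonneg i))]
    simp
  refine ⟨hpos.1.eigenvalues, fun i => of fun b a =>
    ((√(Fintype.card A * hpos.1.eigenvalues i) : ℝ) : ℂ) * hpos.1.eigenvectorUnitary.1 (a, b) i,
    hpos.eigenvalues_nonneg, ?_, vN_of_isHermitian hpos.1, fun i => ?_, ?_⟩
  · have := hpos.1.trace_eq_sum_eigenvalues
    rw [htr] at this
    simpa using (congrArg Complex.re this).symm
  · have hcol := congrFun (congrFun (Unitary.coe_star_mul_self hpos.1.eigenvectorUnitary) i) i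
    rw [one_apply_eq, star_eq_conjTranspose, mul_apply] at hcol
    rw [← hsq, ← mul_one (Complex.ofReal _ * _), ← hcol, Fintype.sum_prod_type]
    simp only [trace, diag_apply, mul_apply, conjTranspose_apply, of_apply, star_mul',
      Complex.star_def, Complex.conj_ofReal, Finset.mul_sum]
    exact Finset.sum_congr rfl fun a _ => Finset.sum_congr rfl fun b _ => by ring
  · funext M
    ext b b'
    rw [sum_kraus_apply, sum_kraus_apply]
    refine Finset.sum_congr rfl fun a' _ => Finset.sum_congr rfl fun a _ => ?_
    congr 1
    have h1 := idTensor_maxEnt_apply L (a, b) (a', b')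
    rw [← hρ, eq_comm, inv_mul_eq_iff_eq_mul₀ hd] at h1
    rw [h1, hpos.1.apply_eq_sum_eigenvalues, Finset.mul_sum]
    refine Finset.sum_congr rfl fun i _ => ?_
    simp only [of_apply, star_mul', Complex.star_def, Complex.conj_ofReal]
    linear_combination (- hpos.1.eigenvectorUnitary.1 (a, b) i *
      (starRingEnd ℂ) (hpos.1.eigenvectorUnitary.1 (a', b') i)) * hsq i

open scoped ComplexOrder in
/-- Maximal coherent information forces the Knill–Laflamme conditions for spectral Kraus
operators. -/
theorem knillLaflamme_of_cohInfo_eq {A B ι : Type*} [Fintype A] [DecidableEq A] [Nonempty A]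
    [Fintype B] [DecidableEq B] [Fintype ι] [DecidableEq ι] {p : ι → ℝ} {K : ι → Matrix B A ℂ}
    (hp : ∀ i, 0 ≤ p i) (hp1 : ∑ i, p i = 1)
    (hS : vN (idTensor (R := A) (fun M : Matrix A A ℂ => ∑ i, K i * M * (K i)ᴴ) (maxEnt A)) =
      -∑ i, p i * Real.logb 2 (p i))
    (hK : ∀ i, ((K i)ᴴ * K i).trace = Fintype.card A * p i)
    (hI : cohInfo (fun M : Matrix A A ℂ => ∑ i, K i * M * (K i)ᴴ) = Real.logb 2 (Fintype.card A)) (i j : ι) :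
    (K i)ᴴ * K j = if i = j then (p i : ℂ) • (1 : Matrix A A ℂ) else 0 := by
  have hd : (Fintype.card A : ℂ) ≠ 0 := Nat.cast_ne_zero.2 Fintype.card_ne_zero
  have hd' : (Fintype.card A : ℝ) ≠ 0 := Nat.cast_ne_zero.2 Fintype.card_ne_zero
  have hc := inv_natCast_eq_inv_sqrt_mul_self (Fintype.card A)
  set W : Matrix B (ι × A) ℂ := of fun b x => ((√(Fintype.card A))⁻¹ : ℝ) * K x.1 b x.2 with hW
  have hρB : ptraceFirst (idTensor (R := A) (fun M : Matrix A A ℂ => ∑ i, K i * M * (K i)ᴴ) (maxEnt A)) =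
      W * Wᴴ := by
    ext b b'
    simp only [ptraceFirst, of_apply, idTensor_maxEnt_apply]
    rw [mul_apply, Fintype.sum_prod_type_right]
    refine Finset.sum_congr rfl fun a _ => ?_
    rw [Finset.mul_sum]
    refine Finset.sum_congr rfl fun i _ => ?_
    simp only [hW, conjTranspose_apply, of_apply, star_mul', hc]
    rw [Complex.star_def, Complex.conj_ofReal]
    ring
  have hσ : ∀ x y, (Wᴴ * W) x y = (Fintype.card A : ℂ)⁻¹ * ((K x.1)ᴴ * K y.1) x.2 y.2 := by
    intro x y
    rw [mul_apply, mul_apply, Finset.mul_sum]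
    refine Finset.sum_congr rfl fun b _ => ?_
    simp only [hW, conjTranspose_apply, of_apply, star_mul', hc]
    rw [Complex.star_def, Complex.conj_ofReal]
    ring
  have hpos : (Wᴴ * W).PosSemidef := posSemidef_conjTranspose_mul_self W
  have hmarg : ∀ i, ∑ a, ((Wᴴ * W) (i, a) (i, a)).re = p i := fun i => by
    have h1 : ∑ a, (Wᴴ * W) (i, a) (i, a) = (p i : ℂ) := by
      simp only [hσ]
      rw [← Finset.mul_sum, inv_mul_eq_iff_eq_mul₀ hd, ← hK]
      rfl
    rw [← Complex.re_sum, h1, Complex.ofReal_re]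
  have key := eq_diagonal_of_vN_eq hpos (q := fun x => p x.1 / Fintype.card A)
    (fun x => div_nonneg (hp _) (Nat.cast_nonneg _)) ?_ ?_ ?_
  · ext a a'
    have h1 := congrFun (congrFun key (i, a)) (j, a')
    rw [hσ, inv_mul_eq_iff_eq_mul₀ hd, diagonal_apply] at h1
    rw [h1]
    by_cases hij : i = j
    · by_cases haa : a = a'
      · simp [hij, haa, mul_div_cancel₀ _ hd]
      · simp [hij, haa]
    · simp [hij]
  · rintro ⟨i, a⟩ h0
    have h1 := hmarg i
    rw [(div_eq_zero_iff.1 h0).resolve_right hd', Finset.sum_eq_zero_iff_of_nonneg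
      fun a _ => (Complex.nonneg_iff.1 hpos.diag_nonneg).1] at h1
    exact h1 a (Finset.mem_univ a)
  · rw [Fintype.sum_prod_type, Fintype.sum_prod_type]
    simp only [hmarg, Finset.sum_const, Finset.card_univ, nsmul_eq_mul, mul_div_cancel₀ _ hd']
  · rw [cohInfo, hρB, vN_mul_conjTranspose_self, hS, sub_neg_eq_add] at hI
    rw [Fintype.sum_prod_type]
    simp only [← Finset.sum_mul, hmarg]
    have h1 : ∀ i, p i * Real.logb 2 (p i / Fintype.card A) =
        p i * Real.logb 2 (p i) - p i * Real.logb 2 (Fintype.card A) := fun i => by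
      by_cases h0 : p i = 0
      · simp [h0]
      · rw [Real.logb_div h0 hd', mul_sub]
    simp only [h1, Finset.sum_sub_distrib, ← Finset.sum_mul, hp1]
    linarith

open scoped ComplexOrder in
/-- Kraus operators satisfying the Knill–Laflamme conditions in diagonal form admit a decoding
channel. -/
theorem exists_decoder_of_knillLaflamme {A B ι : Type*} [Fintype A] [DecidableEq A] [Nonempty A]
    [Fintype B] [DecidableEq B] [Fintype ι] [DecidableEq ι] {p : ι → ℝ} {K : ι → Matrix B A ℂ}
    (hp : ∀ i, 0 ≤ p i) (hp1 : ∑ i, p i = 1)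
    (hK : ∀ i j, (K i)ᴴ * K j = if i = j then (p i : ℂ) • (1 : Matrix A A ℂ) else 0) :
    ∃ D : Matrix B B ℂ → Matrix A A ℂ, IsQChannel D ∧
      ∀ M, D (∑ i, K i * M * (K i)ᴴ) = M := by
  obtain ⟨a₀⟩ := ‹Nonempty A›
  set c : ι → ℂ := fun i => ((√(p i))⁻¹ : ℝ) with hc
  have hcs : ∀ i, star (c i) = c i := fun i => Complex.conj_ofReal _
  have hcp : ∀ i, c i * c i * p i * p i = p i := fun i => by
    simp only [hc]
    rw [← Complex.ofReal_mul, ← mul_inv, Real.mul_self_sqrt (hp i)]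
    by_cases h0 : p i = 0
    · simp [h0]
    · have : (p i : ℂ) ≠ 0 := Complex.ofReal_ne_zero.2 h0
      push_cast
      field_simp
  have hK0 : ∀ i, p i = 0 → K i = 0 := fun i h0 => by
    have := hK i i
    rwa [if_pos rfl, h0, Complex.ofReal_zero, zero_smul, conjTranspose_mul_self_eq_zero] at this
  have hcK : ∀ i, (c i * c i * p i) • K i = K i := fun i => by
    by_cases h0 : p i = 0
    · simp [hK0 i h0]
    · have h1 : (p i : ℂ) ≠ 0 := Complex.ofReal_ne_zero.2 h0
      have h2 : c i * c i * p i = 1 := mul_right_cancel₀ h1 (by rw [hcp, one_mul])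
      rw [h2, one_smul]
  set Q : Matrix B B ℂ := ∑ i, (c i * c i) • (K i * (K i)ᴴ) with hQ
  have hQK : ∀ j, Q * K j = K j := fun j => by
    rw [hQ, Matrix.sum_mul, Finset.sum_eq_single j]
    · rw [Matrix.smul_mul, Matrix.mul_assoc, hK, if_pos rfl, Matrix.mul_smul, Matrix.mul_one,
        smul_smul, hcK]
    · intro i _ hij
      rw [Matrix.smul_mul, Matrix.mul_assoc, hK, if_neg hij, Matrix.mul_zero, smul_zero]
    · simp
  have hQH : Qᴴ = Q := by
    simp [hQ, conjTranspose_sum, hcs]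
  have hQQ : Q * Q = Q := by
    have : ∑ i, Q * ((c i * c i) • (K i * (K i)ᴴ)) = Q := by
      simp only [Matrix.mul_smul, ← Matrix.mul_assoc, hQK]
      rfl
    rwa [← Matrix.mul_sum] at this
  have hPK : ∀ j, (1 - Q) * K j = 0 := fun j => by
    rw [Matrix.sub_mul, Matrix.one_mul, hQK, sub_self]
  set T : ι ⊕ B → Matrix A B ℂ :=
    Sum.elim (fun i => c i • (K i)ᴴ) fun b => single a₀ b (1 : ℂ) * (1 - Q) with hT
  have hTsum : ∑ t, (T t)ᴴ * T t = 1 := by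
    have h1 : ∑ b : B, (single a₀ b (1 : ℂ))ᴴ * single a₀ b (1 : ℂ) = 1 := by
      simp only [conjTranspose_single, single_mul_single_same, star_one, mul_one]
      exact sum_single_one
    have h2 : ∑ b : B, (single a₀ b (1 : ℂ) * (1 - Q))ᴴ * (single a₀ b (1 : ℂ) * (1 - Q)) = 1 - Q := by
      have : ∀ b : B, (single a₀ b (1 : ℂ) * (1 - Q))ᴴ * (single a₀ b (1 : ℂ) * (1 - Q)) =
          (1 - Q) * ((single a₀ b (1 : ℂ))ᴴ * single a₀ b (1 : ℂ)) * (1 - Q) := fun b => by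
        rw [conjTranspose_mul, conjTranspose_sub, conjTranspose_one, hQH]
        simp only [Matrix.mul_assoc]
      simp only [this]
      rw [← Matrix.sum_mul, ← Matrix.mul_sum, h1, Matrix.mul_one, Matrix.sub_mul, Matrix.mul_sub,
        Matrix.mul_sub, hQQ]
      simp
    rw [Fintype.sum_sum_type]
    simp only [hT, Sum.elim_inl, Sum.elim_inr, h2, conjTranspose_smul, conjTranspose_conjTranspose,
      hcs, Matrix.smul_mul, Matrix.mul_smul, smul_smul]
    exact add_sub_cancel Q 1
  refine ⟨_, isQChannel_of_kraus T hTsum, fun M => ?_⟩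
  have hinl : ∀ i, T (.inl i) * (∑ j, K j * M * (K j)ᴴ) * (T (.inl i))ᴴ = (p i : ℂ) • M := by
    intro i
    rw [Matrix.mul_sum, Matrix.sum_mul, Finset.sum_eq_single i]
    · have : (c i • (K i)ᴴ) * (K i * M * (K i)ᴴ) * (c i • (K i)ᴴ)ᴴ =
          (c i * c i) • (((K i)ᴴ * K i) * M * ((K i)ᴴ * K i)) := by
        simp only [conjTranspose_smul, conjTranspose_conjTranspose, hcs, Matrix.smul_mul,
          Matrix.mul_smul, smul_smul, Matrix.mul_assoc]
      simp only [hT, Sum.elim_inl]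
      rw [this, hK, if_pos rfl]
      simp only [Matrix.smul_mul, Matrix.mul_smul, smul_smul, Matrix.one_mul, Matrix.mul_one]
      rw [← mul_assoc, hcp]
    · intro j _ hji
      simp only [hT, Sum.elim_inl, Matrix.smul_mul, ← Matrix.mul_assoc]
      rw [hK, if_neg hji.symm]
      simp
    · simp
  have hinr : ∀ b, T (.inr b) * (∑ j, K j * M * (K j)ᴴ) * (T (.inr b))ᴴ = 0 := by
    intro b
    have : T (.inr b) * (∑ j, K j * M * (K j)ᴴ) = 0 := by
      simp only [hT, Sum.elim_inr, Matrix.mul_sum]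
      refine Finset.sum_eq_zero fun j _ => ?_
      rw [Matrix.mul_assoc, ← Matrix.mul_assoc (1 - Q), ← Matrix.mul_assoc (1 - Q), hPK]
      simp
    rw [this, Matrix.zero_mul]
  simp only [Fintype.sum_sum_type, hinl, hinr, Finset.sum_const_zero, add_zero]
  rw [← Finset.sum_smul, ← Complex.ofReal_sum, hp1, Complex.ofReal_one, one_smul]

/-- If the coherent information of a channel `ℰ` from `k`-qubit states to
states on `ℂ^m` on the maximally mixed input equals `k`, then there is a decoding channel `𝒟`
with `𝒟(ℰ(|ψ⟩⟨ψ|)) = |ψ⟩⟨ψ|` for every unit vector `ψ`. -/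
theorem decoder_exists_of_max_coherent_info
    (k m : ℕ)
    (E : Matrix (Fin (2 ^ k)) (Fin (2 ^ k)) ℂ → Matrix (Fin m) (Fin m) ℂ)
    (hE : IsQChannel E)
    (hIc : cohInfo E = (k : ℝ)) :
    ∃ D : Matrix (Fin m) (Fin m) ℂ → Matrix (Fin (2 ^ k)) (Fin (2 ^ k)) ℂ,
      IsQChannel D ∧
        ∀ ψ : Fin (2 ^ k) → ℂ, star ψ ⬝ᵥ ψ = 1 →
          D (E (outer ψ)) = outer ψ := by
  obtain ⟨p, K, hp, hp1, hS, hK, rfl⟩ := hE.exists_spectral_kraus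
  obtain ⟨D, hD, hDE⟩ := exists_decoder_of_knillLaflamme hp hp1
    (knillLaflamme_of_cohInfo_eq hp hp1 hS hK (by simp [hIc, Real.logb_pow]))
  exact ⟨D, hD, fun ψ _ => hDE _⟩
end
end

section
/- Let ℰ be a quantum channel from states on ℂ^{2^k} to states on ℂ^{m}. If there exists a quantum channel 𝒟 from states on ℂ^{m} to states on ℂ^{2^k} such that (Id ⊗ (𝒟 ∘ ℰ))(|Φ⟩⟨Φ|) = |Φ⟩⟨Φ| for the maximally entangled state Φ_k, then the coherent information of ℰ on the maximally mixed input satisfies I_c = k. -/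
open Matrix

noncomputable section

/-- The entropy of `X Xᴴ` is read off from a diagonalised Gram matrix `Xᴴ X`. -/
theorem vN_mul_conjTranspose_of_diagonal {ι κ : Type*} [Fintype ι] [DecidableEq ι]
    [Fintype κ] [DecidableEq κ] (X : Matrix ι κ ℂ) (l : κ → ℝ)
    (h : Xᴴ * X = diagonal fun i => (l i : ℂ)) :
    vN (X * Xᴴ) = -∑ i, l i * Real.logb 2 (l i) := by
  have hH : (X * Xᴴ).IsHermitian := isHermitian_mul_conjTranspose_self X
  have hc := congrArg Polynomial.roots (charpoly_mul_comm' X Xᴴ)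
  have hne (n : ℕ) (p : Polynomial ℂ) (hp : p.Monic) : (Polynomial.X ^ n * p) ≠ 0 :=
    ((Polynomial.monic_X_pow n).mul hp).ne_zero
  rw [Polynomial.roots_mul (hne _ _ (charpoly_monic _)),
    Polynomial.roots_mul (hne _ _ (charpoly_monic _)), h, charpoly_diagonal,
    hH.roots_charpoly_eq_eigenvalues,
    Polynomial.roots_prod _ _ (Finset.prod_ne_zero_iff.2 fun i _ => Polynomial.X_sub_C_ne_zero _),
    Polynomial.roots_X_pow, Polynomial.roots_X_pow] at hc
  have hs := congrArg
    (fun s : Multiset ℂ => (s.map fun z => z.re * Real.logb 2 z.re).sum) hc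
  simp [Multiset.map_nsmul, Multiset.sum_nsmul, Multiset.map_map] at hs
  rw [vN, dif_pos hH]
  simpa using hs

/-- A Kraus representation of the identity channel consists of scalar matrices. -/
theorem eq_smul_one_of_sum_kraus_eq {A ι : Type*} [Fintype A] [DecidableEq A] [Fintype ι]
    (N : ι → Matrix A A ℂ)
    (h : ∀ p q r t, ∑ a, N a r p * star (N a t q) = if r = p ∧ t = q then 1 else 0) (a : ι) :
    ∃ c : ℂ, N a = c • (1 : Matrix A A ℂ) := by
  have key (f : ι → ℂ) (hf : ∑ a, f a * star (f a) = 0) (a : ι) : f a = 0 := by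
    have h0 : ∑ a, Complex.normSq (f a) = 0 := by
      have : ((∑ a, Complex.normSq (f a) : ℝ) : ℂ) = 0 := by
        rw [← hf]
        push_cast
        exact Finset.sum_congr rfl fun a _ => (Complex.mul_conj (f a)).symm
      exact_mod_cast this
    exact Complex.normSq_eq_zero.1
      ((Finset.sum_eq_zero_iff_of_nonneg fun a _ => Complex.normSq_nonneg _).1 h0 a
        (Finset.mem_univ a))
  have hoff (p q : A) (hpq : q ≠ p) : N a q p = 0 :=
    key (fun a => N a q p) (by rw [h p p q q, if_neg fun hh => hpq hh.1]) a
  have hdiag (p q : A) : N a p p = N a q q := by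
    refine sub_eq_zero.1 (key (fun a => N a p p - N a q q) ?_ a)
    have h1 := h p p p p
    have h2 := h q q q q
    have h3 := h p q p q
    have h4 := h q p q p
    simp only [and_self, if_true] at h1 h2 h3 h4
    simp only [star_sub, sub_mul, mul_sub, Finset.sum_sub_distrib, h1, h2, h3, h4, sub_self]
  rcases isEmpty_or_nonempty A with hA | ⟨⟨p⟩⟩
  · exact ⟨0, Subsingleton.elim _ _⟩
  · refine ⟨N a p p, ?_⟩
    ext r t
    rcases eq_or_ne r t with rfl | hrt
    · simp [hdiag r p]
    · simp [hoff t r hrt, hrt]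

/-- Kraus operators satisfying the Knill–Laflamme condition can be rotated into
operators with mutually orthogonal ranges. -/
theorem exists_orthogonal_kraus {A B : Type*} [Fintype A] [DecidableEq A] [Nonempty A]
    [Fintype B] {s : ℕ} (K : Fin s → Matrix B A ℂ) (g : Matrix (Fin s) (Fin s) ℂ)
    (hg : ∀ i j, (K i)ᴴ * K j = g i j • (1 : Matrix A A ℂ)) :
    ∃ (F : Fin s → Matrix B A ℂ) (l : Fin s → ℝ),
      (∀ i j, (F i)ᴴ * F j = if i = j then (l i : ℂ) • (1 : Matrix A A ℂ) else 0) ∧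
      ∀ M : Matrix A A ℂ, ∑ i, F i * M * (F i)ᴴ = ∑ i, K i * M * (K i)ᴴ := by
  have hgH : g.IsHermitian := by
    ext i j
    obtain ⟨p⟩ := ‹Nonempty A›
    have h1 := congrFun₂ (congrArg conjTranspose (hg j i)) p p
    have h2 := congrFun₂ (hg i j) p p
    rw [conjTranspose_mul, conjTranspose_conjTranspose, h2] at h1
    simpa using h1.symm
  set U : Matrix (Fin s) (Fin s) ℂ := (hgH.eigenvectorUnitary).1 with hU
  have hUU : U * Uᴴ = 1 := Unitary.mul_star_self_of_mem hgH.eigenvectorUnitary.2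
  have hU' : Uᴴ * U = 1 := Unitary.star_mul_self_of_mem hgH.eigenvectorUnitary.2
  have hd : Uᴴ * g * U = diagonal fun i => (hgH.eigenvalues i : ℂ) := by
    have hs := hgH.spectral_theorem
    rw [Unitary.conjStarAlgAut_apply] at hs
    change g = U * _ * Uᴴ at hs
    conv_lhs => rw [hs]
    rw [Matrix.mul_assoc, Matrix.mul_assoc, hU', Matrix.mul_one, ← Matrix.mul_assoc, hU',
      Matrix.one_mul]
    rfl
  refine ⟨fun i => ∑ j, U j i • K j, hgH.eigenvalues, fun i j => ?_, fun M => ?_⟩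
  · have hij := congrFun₂ hd i j
    simp only [mul_apply, conjTranspose_apply, diagonal_apply] at hij
    have hl : (∑ x, U x i • K x)ᴴ * ∑ x, U x j • K x =
        (∑ y, (∑ x, star (U x i) * g x y) * U y j) • (1 : Matrix A A ℂ) := by
      simp only [conjTranspose_sum, conjTranspose_smul, Matrix.sum_mul, Matrix.mul_sum,
        Matrix.smul_mul, Matrix.mul_smul, hg, Finset.sum_smul, Finset.sum_mul, Finset.smul_sum, smul_smul]
      refine Finset.sum_congr rfl fun y _ => Finset.sum_congr rfl fun x _ => ?_
      congr 1
      ring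
    rw [hl, hij]
    split_ifs <;> simp
  · have hxy (x y : Fin s) : ∑ i, U x i * star (U y i) = if x = y then 1 else 0 := by
      have := congrFun₂ hUU x y
      simpa [mul_apply, one_apply] using this
    simp only [conjTranspose_sum, conjTranspose_smul, Matrix.sum_mul, Matrix.mul_sum,
      Matrix.smul_mul, Matrix.mul_smul, Finset.smul_sum, smul_smul]
    rw [Finset.sum_comm]
    refine Finset.sum_congr rfl fun y _ => ?_
    rw [Finset.sum_comm]
    simp only [← Finset.sum_smul, mul_comm (star _) (U _ _), hxy, ite_smul, one_smul, zero_smul,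
      Finset.sum_ite_eq', Finset.mem_univ, if_true]

/-- If a channel is corrected on the maximally entangled state by some decoding channel, then
its Kraus operators satisfy the Knill–Laflamme condition. -/
theorem exists_gram_of_decoder {A B : Type*} [Fintype A] [DecidableEq A] [Nonempty A]
    [Fintype B] [DecidableEq B] {s t : ℕ} (K : Fin s → Matrix B A ℂ) (L : Fin t → Matrix A B ℂ)
    (hL : ∑ j, (L j)ᴴ * L j = 1)
    (h : idTensor (R := A) (fun M : Matrix A A ℂ => ∑ j, L j * (∑ i, K i * M * (K i)ᴴ) * (L j)ᴴ) (maxEnt A) =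
      maxEnt A) :
    ∃ g : Matrix (Fin s) (Fin s) ℂ, ∀ i j, (K i)ᴴ * K j = g i j • (1 : Matrix A A ℂ) := by
  have hA : (Fintype.card A : ℂ) ≠ 0 := by simp
  have hdec : ∀ a : Fin t × Fin s, ∃ c : ℂ, L a.1 * K a.2 = c • (1 : Matrix A A ℂ) := by
    refine eq_smul_one_of_sum_kraus_eq (fun a : Fin t × Fin s => L a.1 * K a.2)
      fun p q r u => ?_
    have hpq := congrFun₂ h (p, r) (q, u)
    have hM : (Matrix.of fun a a' => maxEnt A (p, a) (q, a')) =
        (Fintype.card A : ℂ)⁻¹ • vecMulVec (Pi.single p (1 : ℂ)) (Pi.single q 1) := by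
      ext a a'
      simp only [maxEnt, of_apply, Matrix.smul_apply, vecMulVec_apply, Pi.single_apply, smul_eq_mul,
        eq_comm (a := a), eq_comm (a := a')]
      split_ifs <;> simp_all
    simp only [idTensor, of_apply, hM] at hpq
    simp only [Matrix.mul_smul, Matrix.smul_mul, ← Finset.smul_sum, Matrix.smul_apply,
      Matrix.mul_sum, Matrix.sum_mul, maxEnt, of_apply, Matrix.sum_apply, smul_eq_mul] at hpq
    rw [Fintype.sum_prod_type]
    have hterm (x : Fin t) (y : Fin s) :
        (L x * (K y * vecMulVec (Pi.single p (1 : ℂ)) (Pi.single q 1) * (K y)ᴴ) * (L x)ᴴ) r u =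
          (L x * K y) r p * star ((L x * K y) u q) := by
      have : L x * (K y * vecMulVec (Pi.single p (1 : ℂ)) (Pi.single q 1) * (K y)ᴴ) * (L x)ᴴ =
          (L x * K y) * vecMulVec (Pi.single p (1 : ℂ)) (Pi.single q 1) * (L x * K y)ᴴ := by
        simp only [conjTranspose_mul, Matrix.mul_assoc]
      rw [this, mul_vecMulVec, vecMulVec_mul, vecMulVec_apply, mulVec_single_one,
        single_one_vecMul]
      rfl
    simp only [hterm, ← Finset.mul_sum] at hpq
    refine mul_left_cancel₀ (inv_ne_zero hA) (hpq.trans ?_)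
    simp [eq_comm]
  choose c hc using hdec
  refine ⟨Matrix.of fun i j => ∑ x, star (c (x, i)) * c (x, j), fun i j => ?_⟩
  calc (K i)ᴴ * K j = (K i)ᴴ * (∑ x, (L x)ᴴ * L x) * K j := by rw [hL, Matrix.mul_one]
    _ = ∑ x, (L x * K i)ᴴ * (L x * K j) := by
      simp only [Matrix.mul_sum, Matrix.sum_mul, conjTranspose_mul, Matrix.mul_assoc]
    _ = _ := by
      simp only [fun x i => hc (x, i), of_apply, conjTranspose_smul, conjTranspose_one,
        Matrix.smul_mul, Matrix.mul_smul, Matrix.one_mul, smul_smul, Finset.sum_smul]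
      refine Finset.sum_congr rfl fun x _ => by rw [mul_comm]

/-- Coherent information, on the maximally mixed input, of a channel whose Kraus operators are
multiples of isometries with mutually orthogonal ranges. -/
theorem cohInfo_of_orthogonal_kraus {A B : Type*} [Fintype A] [DecidableEq A] [Nonempty A]
    [Fintype B] [DecidableEq B] {s : ℕ} (F : Fin s → Matrix B A ℂ) (l : Fin s → ℝ)
    (hF : ∀ i j, (F i)ᴴ * F j = if i = j then (l i : ℂ) • (1 : Matrix A A ℂ) else 0)
    (hl : ∑ i, l i = 1) :
    cohInfo (fun M : Matrix A A ℂ => ∑ i, F i * M * (F i)ᴴ) = Real.logb 2 (Fintype.card A) := by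
  set n : ℝ := (Fintype.card A : ℝ) with hn
  have hn0 : 0 < n := by simp [hn, Fintype.card_pos]
  have hnC : (Fintype.card A : ℂ) = (n : ℂ) := by simp [hn]
  set c : ℂ := (((√n)⁻¹ : ℝ) : ℂ) with hc
  have hcc : c * star c = (n : ℂ)⁻¹ := by
    rw [hc]
    simp only [Complex.star_def, Complex.conj_ofReal]
    rw [← Complex.ofReal_mul, ← mul_inv, Real.mul_self_sqrt hn0.le, Complex.ofReal_inv]
  have hcc' : star c * c = (n : ℂ)⁻¹ := by rw [mul_comm, hcc]
  have hFe (i j : Fin s) (a a' : A) : ∑ b, star (F i b a) * F j b a' =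
      if i = j then (if a = a' then (l i : ℂ) else 0) else 0 := by
    have := congrFun₂ (hF i j) a a'
    rw [mul_apply] at this
    simp only [conjTranspose_apply] at this
    rw [this]
    split_ifs <;> simp_all
  let Y : Matrix (A × B) (Fin s) ℂ := Matrix.of fun x i => c * F i x.2 x.1
  let X : Matrix B (Fin s × A) ℂ := Matrix.of fun b x => c * F x.1 b x.2
  have hρ : idTensor (R := A) (fun M : Matrix A A ℂ => ∑ i, F i * M * (F i)ᴴ) (maxEnt A) = Y * Yᴴ := by
    ext ⟨r, b⟩ ⟨r', b'⟩
    have hM : (Matrix.of fun a a' => maxEnt A (r, a) (r', a')) =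
        (n : ℂ)⁻¹ • vecMulVec (Pi.single r (1 : ℂ)) (Pi.single r' 1) := by
      ext a a'
      simp only [maxEnt, of_apply, Matrix.smul_apply, vecMulVec_apply, Pi.single_apply, smul_eq_mul,
        eq_comm (a := a), eq_comm (a := a'), hnC]
      split_ifs <;> simp_all
    rw [Matrix.mul_apply (M := Y)]
    simp only [idTensor, of_apply, hM, Matrix.sum_apply, conjTranspose_apply, Y]
    refine Finset.sum_congr rfl fun i _ => ?_
    rw [Matrix.mul_smul, Matrix.smul_mul, mul_vecMulVec, vecMulVec_mul, mulVec_single_one,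
      single_one_vecMul, Matrix.smul_apply, vecMulVec_apply, ← hcc]
    simp only [row_apply, col_apply, conjTranspose_apply, star_mul', smul_eq_mul]
    ring
  have hσ : ptraceFirst (Y * Yᴴ) = X * Xᴴ := by
    ext b b'
    simp only [ptraceFirst, of_apply, mul_apply, conjTranspose_apply, X, Y]
    rw [Fintype.sum_prod_type, Finset.sum_comm]
  have hY : Yᴴ * Y = diagonal fun i => (l i : ℂ) := by
    ext i j
    simp only [mul_apply, conjTranspose_apply, Y, of_apply, diagonal_apply,
      Fintype.sum_prod_type, star_mul']
    have : ∀ r b, star c * star (F i b r) * (c * F j b r) =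
        (n : ℂ)⁻¹ * (star (F i b r) * F j b r) := fun r b => by rw [← hcc']; ring
    simp only [this, ← Finset.mul_sum, hFe]
    have : (n : ℂ) ≠ 0 := by exact_mod_cast hn0.ne'
    split_ifs with h
    · simp [hnC, this]
    · simp
  have hX : Xᴴ * X = diagonal fun x : Fin s × A => ((l x.1 / n : ℝ) : ℂ) := by
    ext ⟨i, a⟩ ⟨j, a'⟩
    simp only [mul_apply, conjTranspose_apply, X, of_apply, diagonal_apply, star_mul']
    have : ∀ b, star c * star (F i b a) * (c * F j b a') =
        (n : ℂ)⁻¹ * (star (F i b a) * F j b a') := fun b => by rw [← hcc']; ring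
    simp only [this, ← Finset.mul_sum, hFe, Prod.mk.injEq, ite_and]
    split_ifs <;> simp [div_eq_inv_mul]
  rw [cohInfo, hρ, hσ, vN_mul_conjTranspose_of_diagonal Y l hY,
    vN_mul_conjTranspose_of_diagonal X _ hX, Fintype.sum_prod_type]
  have hterm (i : Fin s) : ∑ _a : A, l i / n * Real.logb 2 (l i / n) =
      l i * Real.logb 2 (l i) - l i * Real.logb 2 n := by
    rw [Finset.sum_const, Finset.card_univ, nsmul_eq_mul, ← hn]
    rcases eq_or_ne (l i) 0 with h | h
    · simp [h]
    · rw [Real.logb_div h hn0.ne']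
      field_simp
  simp only [hterm, Finset.sum_sub_distrib, ← Finset.sum_mul, hl]
  ring

/-- If there is a decoding channel `𝒟` with
`(Id ⊗ (𝒟 ∘ ℰ))(|Φ⟩⟨Φ|) = |Φ⟩⟨Φ|`, then the coherent information of `ℰ` on the maximally
mixed input equals `k`. -/
theorem coherent_info_max_of_decoder
    (k m : ℕ)
    (E : Matrix (Fin (2 ^ k)) (Fin (2 ^ k)) ℂ → Matrix (Fin m) (Fin m) ℂ)
    (hE : IsQChannel E)
    (hD : ∃ D : Matrix (Fin m) (Fin m) ℂ → Matrix (Fin (2 ^ k)) (Fin (2 ^ k)) ℂ,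
      IsQChannel D ∧
        idTensor (R := Fin (2 ^ k)) (fun M => D (E M)) (maxEnt (Fin (2 ^ k))) =
          maxEnt (Fin (2 ^ k))) :
    cohInfo E = (k : ℝ) := by
  obtain ⟨s, K, hK, hEK⟩ := hE
  obtain ⟨D, ⟨t, L, hL, hDL⟩, hid⟩ := hD
  obtain rfl : E = fun M => ∑ j, K j * M * (K j)ᴴ := funext hEK
  obtain rfl : D = fun M => ∑ j, L j * M * (L j)ᴴ := funext hDL
  obtain ⟨g, hg⟩ := exists_gram_of_decoder K L hL hid
  obtain ⟨F, l, hF, hFK⟩ := exists_orthogonal_kraus K g hg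
  have htr : ∑ i, l i = 1 := by
    have h1 := congrArg trace (hFK 1)
    simp only [Matrix.mul_one, trace_sum, fun (P : Matrix (Fin m) (Fin (2 ^ k)) ℂ) =>
      trace_mul_comm P Pᴴ] at h1
    rw [← trace_sum, ← trace_sum, hK] at h1
    simp only [hF, if_true, ← Finset.sum_smul, trace_smul, trace_one, Fintype.card_fin,
      smul_eq_mul] at h1
    have h2 : (∑ i, (l i : ℂ)) = 1 :=
      mul_right_cancel₀ (b := ((2 ^ k : ℕ) : ℂ)) (by simp) (h1.trans (one_mul _).symm)
    exact_mod_cast h2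
  rw [← funext hFK, cohInfo_of_orthogonal_kraus F l hF htr, Fintype.card_fin, Nat.cast_pow, Nat.cast_ofNat,
    ← Real.rpow_natCast, Real.logb_rpow two_pos (by norm_num)]
end
end
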